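/- arXiv:2205.14602 — 5 statements merged into one kernel-verified Lean document; each statement's English description precedes it below -/
import Mathlib

section
/- Let 0 < q < ∞, 0 < α < ∞, let w, v be weights on (0,∞), and let T be a monotone quasilinear operator on M⁺(0,∞). Set V⋆(x) := ∫_x^∞ v(t) dt. Then there exists a constant C > 0 such that ‖Tf‖_{q,w,(0,∞)} ≤ C ‖f‖_{1,v,(0,∞)} for all nondecreasing f ∈ M⁺(0,∞) if and only if there exists a constant C' > 0 such that ‖T(x ↦ V⋆(x)^{-(α+1)} ∫_x^∞ h(t) V⋆(t)^α dt)‖_{q,w,(0,∞)} ≤ C' ∫₀^∞ h(t) dt for all h ∈ M⁺(0,∞). -/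
open MeasureTheory Set ENNReal NNReal

noncomputable section

/-- Lebesgue measure restricted to `(0, ∞)`. -/
def mu0 : Measure ℝ := volume.restrict (Ioi (0 : ℝ))

/-- A weight on `(0, ∞)`: a measurable function that is positive (and finite) a.e. on `(0, ∞)`. -/
def IsWeight (v : ℝ → ℝ≥0∞) : Prop :=
  Measurable v ∧ ∀ᵐ x ∂mu0, 0 < v x ∧ v x < ∞

/-- The weighted Lebesgue functional `‖f‖_{p,w,(0,∞)}`. -/
def wnorm (p : ℝ) (w f : ℝ → ℝ≥0∞) : ℝ≥0∞ :=
  (∫⁻ x in Ioi (0 : ℝ), f x ^ p * w x) ^ (1 / p)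

/-- A monotone quasilinear operator on `M⁺(0,∞)`: positively homogeneous, a.e. monotone
(up to a multiplicative constant) and a.e. subadditive (up to a multiplicative constant). -/
structure IsMQL (T : (ℝ → ℝ≥0∞) → ℝ → ℝ≥0∞) : Prop where
  measurable_map : ∀ f : ℝ → ℝ≥0∞, Measurable f → Measurable (T f)
  homog : ∀ (c : ℝ≥0) (f : ℝ → ℝ≥0∞), Measurable f →
    T (fun x => (c : ℝ≥0∞) * f x) = fun x => (c : ℝ≥0∞) * T f x
  mono : ∃ C : ℝ≥0, 0 < C ∧ ∀ f g : ℝ → ℝ≥0∞, Measurable f → Measurable g →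
    (∀ᵐ x ∂mu0, f x ≤ g x) → ∀ᵐ x ∂mu0, T f x ≤ (C : ℝ≥0∞) * T g x
  subadd : ∃ C : ℝ≥0, 0 < C ∧ ∀ f g : ℝ → ℝ≥0∞, Measurable f → Measurable g →
    ∀ᵐ x ∂mu0, T (fun y => f y + g y) x ≤ (C : ℝ≥0∞) * (T f x + T g x)

/-- For an atomless measure, the set where the upper tail is at most `c` has measure at most `c`. -/
theorem measure_setOf_tail_le (ν : Measure ℝ) [NullSingletonClass ν] (c : ℝ≥0∞) :
    ν {s | ν (Ioi s) ≤ c} ≤ c := by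
  set F := {s | ν (Ioi s) ≤ c} with hF
  rcases F.eq_empty_or_nonempty with h0 | hne
  · simp [h0]
  have hsub : F ⊆ (⋃ s : F, Ioi (s : ℝ)) ∪ {sInf F} := by
    intro x hx
    by_cases hlow : ∃ s ∈ F, s < x
    · obtain ⟨s, hs, hsx⟩ := hlow
      exact Or.inl (mem_iUnion.2 ⟨⟨s, hs⟩, hsx⟩)
    · push Not at hlow
      exact Or.inr ((IsLeast.csInf_eq ⟨hx, hlow⟩).symm)
  obtain ⟨C, hCc, hC⟩ : ∃ C : Set F, C.Countable ∧ ⋃ s ∈ C, Ioi (s : ℝ) = ⋃ s : F, Ioi (s : ℝ) :=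
    TopologicalSpace.isOpen_iUnion_countable (fun s : F => Ioi (s : ℝ)) fun _ => isOpen_Ioi
  calc ν F ≤ ν ((⋃ s : F, Ioi (s : ℝ)) ∪ {sInf F}) := measure_mono hsub
    _ ≤ ν (⋃ s : F, Ioi (s : ℝ)) + ν {sInf F} := measure_union_le _ _
    _ = ν (⋃ s ∈ C, Ioi (s : ℝ)) := by rw [hC, measure_singleton, add_zero]
    _ = ⨆ s ∈ C, ν (Ioi (s : ℝ)) := by
      refine measure_biUnion_eq_iSup hCc ?_
      intro a ha b hb
      rcases le_total a b with h | h
      · exact ⟨a, ha, le_rfl, Ioi_subset_Ioi h⟩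
      · exact ⟨b, hb, Ioi_subset_Ioi h, le_rfl⟩
    _ ≤ c := iSup₂_le fun s _ => s.2

/-- The tail `V⋆(x) = ∫_x^∞ v`. -/
def tail (v : ℝ → ℝ≥0∞) (x : ℝ) : ℝ≥0∞ := ∫⁻ t in Ioi x, v t

theorem tail_antitone (v : ℝ → ℝ≥0∞) : Antitone (tail v) := fun _ _ h =>
  lintegral_mono_set (Ioi_subset_Ioi h)

theorem measurable_tail (v : ℝ → ℝ≥0∞) : Measurable (tail v) := (tail_antitone v).measurable

theorem setLIntegral_setOf_tail_le (v : ℝ → ℝ≥0∞) (c : ℝ≥0∞) :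
    ∫⁻ s in {s | tail v s ≤ c}, v s ≤ c := by
  have hna : NullSingletonClass (volume.withDensity v) :=
    ⟨fun x => withDensity_absolutelyContinuous _ _ (measure_singleton x)⟩
  have h := measure_setOf_tail_le (volume.withDensity v) c
  simp only [withDensity_apply _ measurableSet_Ioi] at h
  change (volume.withDensity v) {s | tail v s ≤ c} ≤ c at h
  rwa [withDensity_apply _ (measurableSet_le (measurable_tail v) measurable_const)] at h

theorem tail_pos {v : ℝ → ℝ≥0∞} (hv : IsWeight v) {x : ℝ} (hx : 0 < x) : 0 < tail v x := by
  rw [tail, setLIntegral_pos_iff hv.1]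
  have hpos : ∀ᵐ t ∂volume.restrict (Ioi x), t ∈ Function.support v :=
    (ae_restrict_of_ae_restrict_of_subset (Ioi_subset_Ioi hx.le) hv.2).mono fun t ht => ht.1.ne'
  have hae : (Function.support v ∩ Ioi x : Set ℝ) =ᵐ[volume] Ioi x := by
    rw [ae_restrict_iff' measurableSet_Ioi] at hpos
    filter_upwards [hpos] with t ht
    exact propext ⟨fun h => h.2, fun h => ⟨ht h, h⟩⟩
  rw [measure_congr hae]
  simp

theorem le_setLIntegral_mul_tail_rpow {v f : ℝ → ℝ≥0∞} (hv : Measurable v) {α : ℝ} (hα : 0 < α)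
    {x : ℝ} (hfx : ∀ t ∈ Ioi x, f x ≤ f t) (htop : tail v x ≠ ∞) :
    f x * (tail v x / 2) ^ (α + 1) ≤ ∫⁻ t in Ioi x, f t * v t * tail v t ^ α := by
  set a := tail v x / 2 with ha
  have hatop : a ≠ ∞ := (ENNReal.div_lt_top htop two_ne_zero).ne
  set E := Ioi x \ {s | tail v s ≤ a} with hE
  have hEm : MeasurableSet E :=
    measurableSet_Ioi.diff (measurableSet_le (measurable_tail v) measurable_const)
  have hmass : a ≤ ∫⁻ t in E, v t := by
    have h1 : a + a ≤ (∫⁻ t in E, v t) + a := by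
      calc a + a = tail v x := ENNReal.add_halves _
        _ ≤ ∫⁻ t in E ∪ {s | tail v s ≤ a}, v t :=
          lintegral_mono_set (by rw [hE, sdiff_union_self]; exact subset_union_left)
        _ ≤ (∫⁻ t in E, v t) + ∫⁻ t in {s | tail v s ≤ a}, v t := lintegral_union_le _ _ _
        _ ≤ _ := by gcongr; exact setLIntegral_setOf_tail_le v a
    exact (ENNReal.add_le_add_iff_right hatop).1 h1
  calc f x * a ^ (α + 1) = f x * a ^ α * a := by
        rw [ENNReal.rpow_add_of_nonneg _ _ hα.le zero_le_one, ENNReal.rpow_one, mul_assoc]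
    _ ≤ f x * a ^ α * ∫⁻ t in E, v t := by gcongr
    _ = ∫⁻ t in E, f x * a ^ α * v t := (lintegral_const_mul _ hv).symm
    _ ≤ ∫⁻ t in E, f t * v t * tail v t ^ α := by
      refine setLIntegral_mono' hEm fun t ht => ?_
      have h1 : a ≤ tail v t := (not_le.1 ht.2).le
      calc f x * a ^ α * v t = f x * v t * a ^ α := by ring
        _ ≤ _ := by gcongr; exact hfx t ht.1
    _ ≤ _ := lintegral_mono_set sdiff_subset

theorem ennreal_rpow_le_rpow_of_nonpos {a b : ℝ≥0∞} {p : ℝ} (hp : p ≤ 0) (hab : a ≤ b) :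
    b ^ p ≤ a ^ p := by
  rw [← neg_neg p, ENNReal.rpow_neg, ENNReal.rpow_neg a]
  exact ENNReal.inv_le_inv.2 (ENNReal.rpow_le_rpow hab (by linarith))

theorem exists_nat_two_pow_bracket {a b : ℝ≥0∞} (ha : a ≠ 0) (hab : a ≤ b) (hb : b ≠ ∞) :
    ∃ k : ℕ, 2 ^ k * a ≤ b ∧ b ≤ 2 ^ (k + 1) * a := by
  have hatop : a ≠ ∞ := (hab.trans_lt hb.lt_top).ne
  lift a to ℝ≥0 using hatop
  lift b to ℝ≥0 using hb
  norm_cast at ha hab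
  have ha' : 0 < a := pos_iff_ne_zero.2 ha
  obtain ⟨k, hk1, hk2⟩ := exists_nat_pow_near (x := b / a) (y := 2)
    ((one_le_div ha').2 hab) (by norm_num)
  refine ⟨k, ?_, ?_⟩
  · exact_mod_cast (le_div_iff₀ ha').1 hk1
  · exact_mod_cast ((div_lt_iff₀ ha').1 hk2).le

theorem exists_setLIntegral_mul_tail_rpow_neg_le {v : ℝ → ℝ≥0∞} (hv : IsWeight v) {α : ℝ}
    (hα : 0 < α) : ∃ K : ℝ≥0, ∀ t, 0 < t →
      tail v t ^ α * ∫⁻ x in Ioo 0 t, v x * tail v x ^ (-(α + 1)) ≤ K := by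
  set r : ℝ≥0∞ := (2 ^ α)⁻¹ with hr
  have hr1 : r < 1 := ENNReal.inv_lt_one.2 (ENNReal.one_lt_rpow one_lt_two hα)
  have hKtop : 2 * (1 - r)⁻¹ ≠ ∞ :=
    ENNReal.mul_ne_top (by simp) (ENNReal.inv_ne_top.2 (tsub_pos_of_lt hr1).ne')
  refine ⟨(2 * (1 - r)⁻¹).toNNReal, fun t ht => ?_⟩
  rw [ENNReal.coe_toNNReal hKtop]
  set a := tail v t with ha
  have ha0 : a ≠ 0 := (tail_pos hv ht).ne'
  rcases eq_or_ne a ∞ with htop | htop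
  · have h0 : ∫⁻ x in Ioo 0 t, v x * tail v x ^ (-(α + 1)) = 0 := by
      rw [setLIntegral_congr_fun (g := fun _ => 0) measurableSet_Ioo, lintegral_zero]
      intro x hx
      have : tail v x = ∞ := top_le_iff.1 (htop ▸ tail_antitone v hx.2.le)
      simp only [this, ENNReal.top_rpow_of_neg (by linarith : -(α + 1) < 0), mul_zero]
    rw [h0, mul_zero]
    exact zero_le
  have hlevel : ∀ k : ℕ, MeasurableSet {s | tail v s ≤ 2 ^ (k + 1) * a} := fun k =>
    measurableSet_le (measurable_tail v) measurable_const
  have hpt : ∀ x ∈ Ioo 0 t, v x * tail v x ^ (-(α + 1)) ≤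
      ∑' k : ℕ, {s | tail v s ≤ 2 ^ (k + 1) * a}.indicator
        (fun s => (2 ^ k * a) ^ (-(α + 1)) * v s) x := by
    intro x hx
    rcases eq_or_ne (tail v x) ∞ with hxt | hxt
    · rw [hxt, ENNReal.top_rpow_of_neg (by linarith : -(α + 1) < 0), mul_zero]
      exact zero_le
    obtain ⟨k, hk1, hk2⟩ := exists_nat_two_pow_bracket ha0 (tail_antitone v hx.2.le) hxt
    refine le_trans ?_ (ENNReal.le_tsum k)
    rw [indicator_of_mem (by exact hk2), mul_comm]
    exact mul_le_mul_left (ennreal_rpow_le_rpow_of_nonpos (by linarith) hk1) _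
  have hterm : ∀ k : ℕ,
      a ^ α * ((2 ^ k * a) ^ (-(α + 1)) * (2 ^ (k + 1) * a)) = 2 * r ^ k := by
    intro k
    have hb0 : (2 : ℝ≥0∞) ^ k * a ≠ 0 := mul_ne_zero (by simp) ha0
    have hbt : (2 : ℝ≥0∞) ^ k * a ≠ ∞ := ENNReal.mul_ne_top (by simp) htop
    have h1 : (2 ^ k * a) ^ (-(α + 1)) * (2 ^ (k + 1) * a) = 2 * (2 ^ k * a) ^ (-α) := by
      calc (2 ^ k * a) ^ (-(α + 1)) * (2 ^ (k + 1) * a)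
          = 2 * ((2 ^ k * a) ^ (-(α + 1)) * (2 ^ k * a) ^ (1 : ℝ)) := by
            rw [ENNReal.rpow_one]; ring
        _ = _ := by rw [← ENNReal.rpow_add _ _ hb0 hbt]; congr 2; ring
    rw [h1, ENNReal.mul_rpow_of_ne_top (by simp) htop, hr]
    have h2 : ((2 : ℝ≥0∞) ^ k) ^ (-α) = ((2 ^ α)⁻¹) ^ k := by
      rw [ENNReal.rpow_neg, ← ENNReal.inv_pow, ← ENNReal.rpow_natCast, ← ENNReal.rpow_natCast,
        ← ENNReal.rpow_mul, ← ENNReal.rpow_mul, mul_comm]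
    have h3 : a ^ α * a ^ (-α) = 1 := by
      rw [← ENNReal.rpow_add _ _ ha0 htop]; simp
    calc a ^ α * (2 * (((2 : ℝ≥0∞) ^ k) ^ (-α) * a ^ (-α)))
        = 2 * ((2 : ℝ≥0∞) ^ k) ^ (-α) * (a ^ α * a ^ (-α)) := by ring
      _ = _ := by rw [h3, h2, mul_one]
  calc a ^ α * ∫⁻ x in Ioo 0 t, v x * tail v x ^ (-(α + 1))
      ≤ a ^ α * ∫⁻ x, ∑' k : ℕ, {s | tail v s ≤ 2 ^ (k + 1) * a}.indicator
        (fun s => (2 ^ k * a) ^ (-(α + 1)) * v s) x := by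
        refine mul_le_mul_right ?_ _
        exact (setLIntegral_mono' measurableSet_Ioo hpt).trans (setLIntegral_le_lintegral _ _)
    _ = a ^ α * ∑' k : ℕ, (2 ^ k * a) ^ (-(α + 1)) *
          ∫⁻ s in {s | tail v s ≤ 2 ^ (k + 1) * a}, v s := by
        rw [lintegral_tsum fun k => ((hv.1.const_mul _).indicator (hlevel k)).aemeasurable]
        congr 2 with k
        rw [lintegral_indicator (hlevel k), lintegral_const_mul _ hv.1]
    _ ≤ a ^ α * ∑' k : ℕ, (2 ^ k * a) ^ (-(α + 1)) * (2 ^ (k + 1) * a) := by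
        gcongr
        exact setLIntegral_setOf_tail_le v _
    _ = 2 * (1 - r)⁻¹ := by
        rw [← ENNReal.tsum_mul_left, tsum_congr hterm, ENNReal.tsum_mul_left,
          ENNReal.tsum_geometric]

theorem setLIntegral_mul_tail_swap {a b : ℝ → ℝ≥0∞} (ha : Measurable a) (hb : Measurable b) :
    ∫⁻ x in Ioi (0 : ℝ), a x * ∫⁻ t in Ioi x, b t =
      ∫⁻ t in Ioi (0 : ℝ), b t * ∫⁻ x in Ioo 0 t, a x := by
  have hS : MeasurableSet {p : ℝ × ℝ | 0 < p.1 ∧ p.1 < p.2} :=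
    (measurableSet_lt measurable_const measurable_fst).inter
      (measurableSet_lt measurable_fst measurable_snd)
  set G : ℝ → ℝ → ℝ≥0∞ := fun x t =>
    {p : ℝ × ℝ | 0 < p.1 ∧ p.1 < p.2}.indicator (fun p => a p.1 * b p.2) (x, t) with hG
  have hGm : Measurable (Function.uncurry G) :=
    ((ha.comp measurable_fst).mul (hb.comp measurable_snd)).indicator hS
  have h1 : ∫⁻ x in Ioi (0 : ℝ), a x * ∫⁻ t in Ioi x, b t = ∫⁻ x, ∫⁻ t, G x t := by
    rw [← lintegral_indicator measurableSet_Ioi]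
    refine lintegral_congr fun x => ?_
    by_cases hx : 0 < x
    · rw [indicator_of_mem (by exact hx), ← lintegral_const_mul _ hb,
        ← lintegral_indicator measurableSet_Ioi]
      refine lintegral_congr fun t => ?_
      simp [hG, indicator, hx]
    · simp [hG, indicator, hx]
  have h2 : ∫⁻ t in Ioi (0 : ℝ), b t * ∫⁻ x in Ioo 0 t, a x = ∫⁻ t, ∫⁻ x, G x t := by
    rw [← lintegral_indicator measurableSet_Ioi]
    refine lintegral_congr fun t => ?_
    by_cases ht : 0 < t
    · rw [indicator_of_mem (by exact ht), ← lintegral_const_mul _ ha,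
        ← lintegral_indicator measurableSet_Ioo]
      refine lintegral_congr fun x => ?_
      simp [hG, indicator, mul_comm]
    · have : ∀ x, ¬ (0 < x ∧ x < t) := fun x h => ht (h.1.trans h.2)
      simp [hG, indicator, ht, this]
  rw [h1, h2, lintegral_lintegral_swap hGm.aemeasurable]

theorem wnorm_le_mul_wnorm {q : ℝ} (hq : 0 < q) (w : ℝ → ℝ≥0∞) {f g : ℝ → ℝ≥0∞}
    (hw : Measurable w) (hg : Measurable g) (c : ℝ≥0)
    (h : ∀ᵐ x ∂mu0, f x ≤ c * g x) : wnorm q w f ≤ c * wnorm q w g := by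
  have hc : (c : ℝ≥0∞) = ((c : ℝ≥0∞) ^ q) ^ (1 / q) := by
    rw [← ENNReal.rpow_mul, mul_one_div_cancel hq.ne', ENNReal.rpow_one]
  unfold wnorm
  rw [hc, ← ENNReal.mul_rpow_of_nonneg _ _ (by positivity : 0 ≤ 1 / q),
    ← lintegral_const_mul _ (by fun_prop)]
  refine ENNReal.rpow_le_rpow (lintegral_mono_ae ?_) (by positivity)
  filter_upwards [h] with x hx
  calc f x ^ q * w x ≤ (c * g x) ^ q * w x := by gcongr
    _ = _ := by rw [ENNReal.mul_rpow_of_nonneg _ _ hq.le, mul_assoc]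

/-- The operator `h ↦ V⋆^{-(α+1)} ∫_x^∞ h V⋆^α`. -/
def tailMean (α : ℝ) (v h : ℝ → ℝ≥0∞) (x : ℝ) : ℝ≥0∞ :=
  tail v x ^ (-(α + 1)) * ∫⁻ t in Ioi x, h t * tail v t ^ α

theorem measurable_tailMean (α : ℝ) (v h : ℝ → ℝ≥0∞) : Measurable (tailMean α v h) :=
  ((measurable_tail v).pow_const _).mul (measurable_tail fun t => h t * tail v t ^ α)

theorem le_mul_tailMean {v f : ℝ → ℝ≥0∞} (hv : IsWeight v) {α : ℝ} (hα : 0 < α)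
    (hmono : MonotoneOn f (Ioi 0)) (hfin : ∫⁻ x in Ioi 0, f x * v x ≠ ∞)
    {x : ℝ} (hx : 0 < x) :
    f x ≤ 2 ^ (α + 1) * tailMean α v (fun t => f t * v t) x := by
  have hfx : ∀ t ∈ Ioi x, f x ≤ f t := fun t ht => hmono hx (hx.trans ht) (le_of_lt ht)
  have h0 : tail v x ≠ 0 := (tail_pos hv hx).ne'
  rcases eq_or_ne (tail v x) ∞ with htop | htop
  · have h1 : f x * tail v x ≤ ∫⁻ t in Ioi 0, f t * v t :=
      calc f x * tail v x = ∫⁻ t in Ioi x, f x * v t := (lintegral_const_mul _ hv.1).symm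
        _ ≤ ∫⁻ t in Ioi x, f t * v t :=
          setLIntegral_mono' measurableSet_Ioi fun t ht => by gcongr; exact hfx t ht
        _ ≤ _ := lintegral_mono_set (Ioi_subset_Ioi hx.le)
    have h2 : f x = 0 := by
      by_contra hne
      rw [htop, ENNReal.mul_top hne] at h1
      exact hfin (top_le_iff.1 h1)
    rw [h2]
    exact zero_le
  have hp : 0 < α + 1 := by linarith
  have key := le_setLIntegral_mul_tail_rpow hv.1 hα hfx htop
  have hcancel : 2 ^ (α + 1) * (tail v x ^ (-(α + 1)) * (tail v x / 2) ^ (α + 1)) = 1 := by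
    have hpos : tail v x ^ (α + 1) ≠ 0 := (ENNReal.rpow_pos (tail_pos hv hx) htop).ne'
    have hfin : tail v x ^ (α + 1) ≠ ∞ := ENNReal.rpow_ne_top_of_nonneg hp.le htop
    rw [ENNReal.div_rpow_of_nonneg _ _ hp.le, ENNReal.rpow_neg, ← mul_div_assoc,
      ENNReal.inv_mul_cancel hpos hfin]
    exact ENNReal.mul_div_cancel (ENNReal.rpow_pos (by simp) (by simp)).ne'
      (ENNReal.rpow_ne_top_of_nonneg hp.le (by simp))
  calc f x = 2 ^ (α + 1) * (tail v x ^ (-(α + 1)) * (tail v x / 2) ^ (α + 1)) * f x := by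
        rw [hcancel, one_mul]
    _ = 2 ^ (α + 1) * (tail v x ^ (-(α + 1)) * (f x * (tail v x / 2) ^ (α + 1))) := by ring
    _ ≤ _ := by unfold tailMean; gcongr

/-- A nondecreasing majorant of `tailMean α v h`. -/
def tailMajorant (α : ℝ) (v h : ℝ → ℝ≥0∞) (x : ℝ) : ℝ≥0∞ :=
  (∫⁻ t in Ioc 0 x, h t * (tail v t)⁻¹) + tailMean α v h x

theorem measurable_tailMajorant (α : ℝ) (v h : ℝ → ℝ≥0∞) :
    Measurable (tailMajorant α v h) := by
  have hm : Monotone fun x : ℝ => ∫⁻ t in Ioc 0 x, h t * (tail v t)⁻¹ := fun _ _ hxy =>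
    lintegral_mono_set (Ioc_subset_Ioc_right hxy)
  exact hm.measurable.add (measurable_tailMean α v h)

theorem monotoneOn_tailMajorant {v h : ℝ → ℝ≥0∞} (hv : IsWeight v) {α : ℝ} (hα : 0 < α)
    (hh : Measurable h) : MonotoneOn (tailMajorant α v h) (Ioi 0) := by
  intro x hx y hy hxy
  have hn : -(α + 1) < 0 := by linarith
  have hsplit : (∫⁻ t in Ioc 0 y, h t * (tail v t)⁻¹) =
      (∫⁻ t in Ioc 0 x, h t * (tail v t)⁻¹) + ∫⁻ t in Ioc x y, h t * (tail v t)⁻¹ := by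
    rw [← lintegral_union measurableSet_Ioc, Ioc_union_Ioc_eq_Ioc (le_of_lt hx) hxy]
    exact Ioc_disjoint_Ioc_of_le le_rfl
  unfold tailMajorant
  rw [hsplit, add_assoc]
  gcongr
  rcases eq_or_ne (tail v x) ∞ with htop | htop
  · rw [tailMean, htop, ENNReal.top_rpow_of_neg hn, zero_mul]
    exact zero_le
  have hsplit2 : (∫⁻ t in Ioi x, h t * tail v t ^ α) =
      (∫⁻ t in Ioc x y, h t * tail v t ^ α) + ∫⁻ t in Ioi y, h t * tail v t ^ α := by
    rw [← lintegral_union measurableSet_Ioi, Ioc_union_Ioi_eq_Ioi hxy]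
    exact disjoint_left.2 fun t h1 h2 => not_lt.2 h1.2 h2
  rw [tailMean, hsplit2, mul_add]
  gcongr ?_ + ?_
  · rw [← lintegral_const_mul (f := fun t => h t * tail v t ^ α) _
      (hh.mul ((measurable_tail v).pow_const α))]
    refine setLIntegral_mono' measurableSet_Ioc fun t ht => ?_
    have hle : tail v t ≤ tail v x := tail_antitone v ht.1.le
    have h0 : tail v t ≠ 0 := (tail_pos hv (lt_trans hx ht.1)).ne'
    have ht' : tail v t ≠ ∞ := (hle.trans_lt htop.lt_top).ne
    calc tail v x ^ (-(α + 1)) * (h t * tail v t ^ α)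
        ≤ tail v t ^ (-(α + 1)) * (h t * tail v t ^ α) := by
          exact mul_le_mul_left (ennreal_rpow_le_rpow_of_nonpos hn.le hle) _
      _ = h t * (tail v t ^ (-(α + 1)) * tail v t ^ α) := by ring
      _ = h t * (tail v t)⁻¹ := by
          rw [← ENNReal.rpow_add _ _ h0 ht', ← ENNReal.rpow_neg_one]
          congr 2
          ring
  · unfold tailMean
    exact mul_le_mul_left (ennreal_rpow_le_rpow_of_nonpos hn.le (tail_antitone v hxy)) _

theorem exists_wnorm_one_tailMajorant_le {v : ℝ → ℝ≥0∞} (hv : IsWeight v) {α : ℝ}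
    (hα : 0 < α) : ∃ K : ℝ≥0, 0 < K ∧ ∀ h : ℝ → ℝ≥0∞, Measurable h →
      wnorm 1 v (tailMajorant α v h) ≤ K * ∫⁻ t in Ioi (0 : ℝ), h t := by
  obtain ⟨K, hK⟩ := exists_setLIntegral_mul_tail_rpow_neg_le hv hα
  refine ⟨1 + K, by positivity, fun h hh => ?_⟩
  have hi : Measurable fun t => h t * (tail v t)⁻¹ := hh.mul (measurable_tail v).inv
  have hpow (p : ℝ) : Measurable fun t => tail v t ^ p := (measurable_tail v).pow_const p
  have h1 : ∫⁻ x in Ioi (0 : ℝ), v x * ∫⁻ t in Ioc 0 x, h t * (tail v t)⁻¹ ≤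
      ∫⁻ t in Ioi (0 : ℝ), h t := by
    simp_rw [← setLIntegral_congr (Ioo_ae_eq_Ioc (μ := volume))]
    rw [← setLIntegral_mul_tail_swap hi hv.1]
    refine lintegral_mono fun t => ?_
    calc h t * (tail v t)⁻¹ * tail v t = h t * ((tail v t)⁻¹ * tail v t) := mul_assoc _ _ _
      _ ≤ h t * 1 := by gcongr; exact ENNReal.inv_mul_le_one _
      _ = h t := mul_one _
  have h2 : ∫⁻ x in Ioi (0 : ℝ), v x * tailMean α v h x ≤ K * ∫⁻ t in Ioi (0 : ℝ), h t := by
    simp only [tailMean, ← mul_assoc]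
    rw [setLIntegral_mul_tail_swap (a := fun x => v x * tail v x ^ (-(α + 1)))
      (b := fun t => h t * tail v t ^ α) (hv.1.mul (hpow _)) (hh.mul (hpow _)),
      ← lintegral_const_mul _ hh]
    refine setLIntegral_mono' measurableSet_Ioi fun t ht => ?_
    rw [mul_assoc, mul_comm (K : ℝ≥0∞)]
    gcongr
    exact hK t ht
  calc wnorm 1 v (tailMajorant α v h)
      = ∫⁻ x in Ioi (0 : ℝ), (v x * (∫⁻ t in Ioc 0 x, h t * (tail v t)⁻¹) +
          v x * tailMean α v h x) := by
        simp only [wnorm, ENNReal.rpow_one, div_one, tailMajorant]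
        exact lintegral_congr fun x => by ring
    _ = (∫⁻ x in Ioi (0 : ℝ), v x * ∫⁻ t in Ioc 0 x, h t * (tail v t)⁻¹) +
          ∫⁻ x in Ioi (0 : ℝ), v x * tailMean α v h x :=
        lintegral_add_right _ (hv.1.mul (measurable_tailMean α v h))
    _ ≤ (∫⁻ t in Ioi (0 : ℝ), h t) + K * ∫⁻ t in Ioi (0 : ℝ), h t := add_le_add h1 h2
    _ = ((1 + K : ℝ≥0) : ℝ≥0∞) * ∫⁻ t in Ioi (0 : ℝ), h t := by push_cast; ring

theorem statement5 (q α : ℝ) (hq : 0 < q) (hα : 0 < α)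
    (w v : ℝ → ℝ≥0∞) (hw : IsWeight w) (hv : IsWeight v)
    (T : (ℝ → ℝ≥0∞) → ℝ → ℝ≥0∞) (hT : IsMQL T) :
    (∃ C : ℝ≥0, 0 < C ∧ ∀ f : ℝ → ℝ≥0∞, Measurable f → MonotoneOn f (Ioi (0 : ℝ)) →
        wnorm q w (T f) ≤ (C : ℝ≥0∞) * wnorm 1 v f) ↔
      (∃ C' : ℝ≥0, 0 < C' ∧ ∀ h : ℝ → ℝ≥0∞, Measurable h →
        wnorm q w (T fun x =>
            (∫⁻ t in Ioi x, v t) ^ (-(α + 1)) *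
              ∫⁻ t in Ioi x, h t * (∫⁻ s in Ioi t, v s) ^ α) ≤
          (C' : ℝ≥0∞) * ∫⁻ t in Ioi (0 : ℝ), h t) := by
  obtain ⟨C₁, hC₁, hmono⟩ := hT.mono
  constructor
  · rintro ⟨C, hC, H⟩
    obtain ⟨K, hK, hKle⟩ := exists_wnorm_one_tailMajorant_le hv hα
    refine ⟨C₁ * (C * K), by positivity, fun h hh => ?_⟩
    change wnorm q w (T (tailMean α v h)) ≤ _
    have hm := measurable_tailMajorant α v h
    calc wnorm q w (T (tailMean α v h))
        ≤ C₁ * wnorm q w (T (tailMajorant α v h)) :=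
          wnorm_le_mul_wnorm hq w hw.1 (hT.measurable_map _ hm) C₁
            (hmono _ _ (measurable_tailMean α v h) hm
              (Filter.Eventually.of_forall fun _ => le_add_self))
      _ ≤ C₁ * (C * (K * ∫⁻ t in Ioi (0 : ℝ), h t)) := by
          gcongr
          exact (H _ hm (monotoneOn_tailMajorant hv hα hh)).trans (by gcongr; exact hKle h hh)
      _ = _ := by push_cast; ring
  · rintro ⟨C, hC, H⟩
    set c : ℝ≥0 := 2 ^ (α + 1) with hc
    have hc2 : (c : ℝ≥0∞) = 2 ^ (α + 1) := by
      rw [hc, ENNReal.coe_rpow_of_nonneg _ (by linarith)]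
      simp
    have hcpos : 0 < c := NNReal.rpow_pos (by norm_num)
    refine ⟨C₁ * c * C, by positivity, fun f hf hfm => ?_⟩
    have hone : wnorm 1 v f = ∫⁻ x in Ioi (0 : ℝ), f x * v x := by simp [wnorm]
    rw [hone]
    rcases eq_or_ne (∫⁻ x in Ioi (0 : ℝ), f x * v x) ∞ with htop | hfin
    · rw [htop, ENNReal.mul_top (by exact_mod_cast (by positivity : C₁ * c * C ≠ 0))]
      exact le_top
    set g := tailMean α v (fun t => f t * v t) with hg
    have hgm : Measurable g := measurable_tailMean α v _
    have hle : ∀ᵐ x ∂mu0, f x ≤ c * g x := by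
      rw [mu0, ae_restrict_iff' measurableSet_Ioi, hc2]
      exact Filter.Eventually.of_forall fun x hx => le_mul_tailMean hv hα hfm hfin hx
    calc wnorm q w (T f) ≤ ((C₁ * c : ℝ≥0) : ℝ≥0∞) * wnorm q w (T g) := by
          refine wnorm_le_mul_wnorm hq w hw.1 (hT.measurable_map _ hgm) _ ?_
          have := hmono f (fun x => c * g x) hf (hgm.const_mul _) hle
          rw [hT.homog c g hgm] at this
          filter_upwards [this] with x hx
          rwa [ENNReal.coe_mul, mul_assoc]
      _ ≤ ((C₁ * c : ℝ≥0) : ℝ≥0∞) * (C * ∫⁻ x in Ioi (0 : ℝ), f x * v x) := by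
          gcongr
          exact H _ (hf.mul hv.1)
      _ = _ := by push_cast; ring
end
end

section
/- Let 0 < q < ∞ and 1 < p < ∞, let w be a weight on (0,∞), and let v be a weight on (0,∞) such that ∫₀^x v(t)^{1-p'} dt < ∞ for every x ∈ (0,∞). Then there exists a constant C > 0 such that (∫₀^∞ (∫₀^x h(t) dt)^q w(x) dx)^{1/q} ≤ C (∫₀^∞ h(t)^p v(t) dt)^{1/p} for all h ∈ M⁺(0,∞) if and only if there exists a constant C' > 0 such that (∫₀^∞ (∫₀^x h(t) dt)^{q/p} w(x) dx)^{p/q} ≤ C' ∫₀^∞ h(t) Φ(t)^{1-2p} dt for all h ∈ M⁺(0,∞), where Φ(x) := (∫₀^x v(t)^{1-p'} dt)^{1/(p'+1)}. -/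
open MeasureTheory Set ENNReal NNReal

noncomputable section

/-- `Φ(x) = (∫₀^x v(t)^(1-p') dt)^(1/(p'+1))`, where `p' = p/(p-1)`. -/
def Phi (p : ℝ) (v : ℝ → ℝ≥0∞) (x : ℝ) : ℝ≥0∞ :=
  (∫⁻ t in Ioc (0 : ℝ) x, v t ^ (1 - p / (p - 1))) ^ (1 / (p / (p - 1) + 1))

/-- The primitive `x ↦ ∫₀ˣ f` of a nonnegative function. -/
def cumul (f : ℝ → ℝ≥0∞) (x : ℝ) : ℝ≥0∞ := ∫⁻ t in Ioc (0 : ℝ) x, f t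

lemma cumul_mono (f : ℝ → ℝ≥0∞) : Monotone (cumul f) := fun _ _ h =>
  lintegral_mono_set (Ioc_subset_Ioc_right h)

lemma measurable_cumul (f : ℝ → ℝ≥0∞) : Measurable (cumul f) := (cumul_mono f).measurable

lemma continuousOn_cumul_toReal {f : ℝ → ℝ≥0∞} (hf : Measurable f) {x : ℝ}
    (hfin : cumul f x < ∞) : ContinuousOn (fun t => (cumul f t).toReal) (Icc 0 x) := by
  have hint : IntegrableOn (fun t => (f t).toReal) (Icc 0 x) := by
    rw [integrableOn_Icc_iff_integrableOn_Ioc]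
    exact integrable_toReal_of_lintegral_ne_top hf.aemeasurable hfin.ne
  refine (intervalIntegral.continuousOn_primitive hint).congr fun t ht => ?_
  have ht' : cumul f t < ∞ := (cumul_mono f ht.2).trans_lt hfin
  exact (integral_toReal hf.aemeasurable (ae_lt_top hf ht'.ne)).symm

/-- Pushing the measure `f dt` on `(0, x]` forward along its primitive gives Lebesgue measure. -/
lemma map_cumul_toReal {f : ℝ → ℝ≥0∞} (hf : Measurable f) {x : ℝ} (hx : 0 ≤ x)
    (hfin : cumul f x < ∞) :
    ((volume.withDensity f).restrict (Ioc 0 x)).map (fun t => (cumul f t).toReal) =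
      volume.restrict (Ioc 0 (cumul f x).toReal) := by
  have hmeas : Measurable fun t => (cumul f t).toReal := (measurable_cumul f).ennreal_toReal
  have hIoc : ∀ c, (volume.withDensity f) (Ioc 0 c) = cumul f c := fun c =>
    withDensity_apply f measurableSet_Ioc
  have hfinite : ∀ t ≤ x, cumul f t ≠ ∞ := fun t ht => ((cumul_mono f ht).trans_lt hfin).ne
  have hmono : ∀ s t, s ≤ t → t ≤ x → (cumul f s).toReal ≤ (cumul f t).toReal := fun s t hst ht =>
    ENNReal.toReal_mono (hfinite t ht) (cumul_mono f hst)
  have hzero : (cumul f 0).toReal = 0 := by simp [cumul]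
  have : IsFiniteMeasure ((volume.withDensity f).restrict (Ioc 0 x)) := by
    constructor
    rw [Measure.restrict_apply_univ, hIoc]
    exact hfin
  refine Measure.ext_of_Iic _ _ fun a => ?_
  rw [Measure.map_apply hmeas measurableSet_Iic,
    Measure.restrict_apply (hmeas measurableSet_Iic), Measure.restrict_apply measurableSet_Iic]
  rcases lt_or_ge a 0 with ha | ha
  · have h1 : (fun t => (cumul f t).toReal) ⁻¹' Iic a ∩ Ioc 0 x = ∅ := by
      ext t
      simp only [mem_inter_iff, mem_preimage, mem_Iic, mem_empty_iff_false, iff_false]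
      rintro ⟨h, -⟩
      exact absurd (ENNReal.toReal_nonneg (a := cumul f t)) (by linarith)
    have h2 : Iic a ∩ Ioc 0 (cumul f x).toReal = ∅ := by
      ext t
      simp only [mem_inter_iff, mem_Iic, mem_Ioc, mem_empty_iff_false, iff_false]
      rintro ⟨h, h', -⟩
      linarith
    rw [h1, h2, measure_empty, measure_empty]
  rcases le_or_gt (cumul f x).toReal a with hax | hax
  · have h1 : (fun t => (cumul f t).toReal) ⁻¹' Iic a ∩ Ioc 0 x = Ioc 0 x :=
      inter_eq_right.2 fun t ht => (hmono t x ht.2 le_rfl).trans hax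
    have h2 : Iic a ∩ Ioc 0 (cumul f x).toReal = Ioc 0 (cumul f x).toReal :=
      inter_eq_right.2 fun t ht => ht.2.trans hax
    rw [h1, h2, hIoc, Real.volume_Ioc, sub_zero, ENNReal.ofReal_toReal hfin.ne]
  · have hcont := continuousOn_cumul_toReal hf hfin
    obtain ⟨d, hd, hda⟩ := intermediate_value_Icc hx hcont (show a ∈ Icc _ _ by
      rw [hzero]; exact ⟨ha, hax.le⟩)
    have hcpt : IsCompact (Icc 0 x ∩ (fun t => (cumul f t).toReal) ⁻¹' Iic a) :=
      isCompact_Icc.of_isClosed_subset (hcont.preimage_isClosed_of_isClosed isClosed_Icc isClosed_Iic)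
        inter_subset_left
    obtain ⟨c, ⟨hc, hca⟩, hcmax⟩ := hcpt.exists_isGreatest ⟨d, hd, hda.le⟩
    have hceq : (cumul f c).toReal = a := by
      refine le_antisymm hca ?_
      rw [← hda]
      exact hmono d c (hcmax ⟨hd, hda.le⟩) hc.2
    have h1 : (fun t => (cumul f t).toReal) ⁻¹' Iic a ∩ Ioc 0 x = Ioc 0 c := by
      ext t
      constructor
      · rintro ⟨h, h0, hx⟩
        exact ⟨h0, hcmax ⟨⟨h0.le, hx⟩, h⟩⟩
      · rintro ⟨h0, h⟩
        exact ⟨(hmono t c h hc.2).trans hca, h0, h.trans hc.2⟩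
    have h2 : Iic a ∩ Ioc 0 (cumul f x).toReal = Ioc 0 a := by
      ext t
      constructor
      · rintro ⟨h, h0, -⟩
        exact ⟨h0, h⟩
      · rintro ⟨h0, h⟩
        exact ⟨h, h0, h.trans hax.le⟩
    rw [h1, h2, hIoc, Real.volume_Ioc, sub_zero, ← hceq, ENNReal.ofReal_toReal (hfinite c hc.2)]

lemma lintegral_comp_cumul {f : ℝ → ℝ≥0∞} (hf : Measurable f) {x : ℝ} (hx : 0 ≤ x)
    (hfin : cumul f x < ∞) {φ : ℝ≥0∞ → ℝ≥0∞} (hφ : Measurable φ) :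
    ∫⁻ t in Ioc (0 : ℝ) x, φ (cumul f t) * f t =
      ∫⁻ y in Ioc (0 : ℝ) (cumul f x).toReal, φ (ENNReal.ofReal y) := by
  have hm : Measurable fun t => (cumul f t).toReal := (measurable_cumul f).ennreal_toReal
  have hφ' : Measurable fun y : ℝ => φ (ENNReal.ofReal y) := hφ.comp ENNReal.measurable_ofReal
  rw [← map_cumul_toReal hf hx hfin, lintegral_map hφ' hm,
    setLIntegral_withDensity_eq_setLIntegral_mul _ hf
      (g := fun t => φ (ENNReal.ofReal (cumul f t).toReal)) (hφ'.comp hm) measurableSet_Ioc]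
  refine setLIntegral_congr_fun measurableSet_Ioc fun t ht => ?_
  have ht' : cumul f t ≠ ∞ := ((cumul_mono f ht.2).trans_lt hfin).ne
  simp only [Pi.mul_apply, ENNReal.ofReal_toReal ht', mul_comm]

lemma lintegral_cumul_rpow_mul {f : ℝ → ℝ≥0∞} (hf : Measurable f) {x : ℝ} (hx : 0 ≤ x)
    (hfin : cumul f x < ∞) {a : ℝ} (ha : 0 < a) :
    ENNReal.ofReal a * ∫⁻ t in Ioc (0 : ℝ) x, cumul f t ^ (a - 1) * f t = cumul f x ^ a := by
  rw [lintegral_comp_cumul hf hx hfin (φ := fun y => y ^ (a - 1)) (by fun_prop)]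
  set b := (cumul f x).toReal with hb
  have hb0 : 0 ≤ b := ENNReal.toReal_nonneg
  have hint : IntegrableOn (fun y : ℝ => y ^ (a - 1)) (Ioc 0 b) :=
    (intervalIntegrable_iff_integrableOn_Ioc_of_le hb0).1
      (intervalIntegral.intervalIntegrable_rpow' (by linarith))
  have hcongr : ∫⁻ y in Ioc (0 : ℝ) b, ENNReal.ofReal y ^ (a - 1) =
      ∫⁻ y in Ioc (0 : ℝ) b, ENNReal.ofReal (y ^ (a - 1)) :=
    setLIntegral_congr_fun measurableSet_Ioc fun y hy => ENNReal.ofReal_rpow_of_pos hy.1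
  rw [hcongr, ← ofReal_integral_eq_lintegral_ofReal hint
    ((ae_restrict_iff' measurableSet_Ioc).2 (ae_of_all _ fun y hy => Real.rpow_nonneg hy.1.le _)),
    ← intervalIntegral.integral_of_le hb0, integral_rpow (Or.inl (by linarith)),
    ← ENNReal.ofReal_mul ha.le, sub_add_cancel, Real.zero_rpow ha.ne', sub_zero,
    mul_div_cancel₀ _ ha.ne', ← ENNReal.ofReal_rpow_of_nonneg hb0 ha.le, hb,
    ENNReal.ofReal_toReal hfin.ne]

lemma lintegral_Ici_cumul_rpow_mul_le {f : ℝ → ℝ≥0∞} (hf : Measurable f)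
    (hfin : ∀ x, cumul f x < ∞) {s : ℝ} (hs : 0 < s) (hpos : 0 < cumul f s) {a : ℝ} (ha : 0 < a) :
    ENNReal.ofReal a * ∫⁻ t in Ici s, cumul f t ^ (-a - 1) * f t ≤ cumul f s ^ (-a) := by
  set b := (cumul f s).toReal with hb
  have hb0 : 0 < b := ENNReal.toReal_pos hpos.ne' (hfin s).ne
  have hbs : ENNReal.ofReal b = cumul f s := ENNReal.ofReal_toReal (hfin s).ne
  have htail : ENNReal.ofReal a * ∫⁻ y in Ici b, ENNReal.ofReal y ^ (-a - 1) = cumul f s ^ (-a) := by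
    rw [setLIntegral_congr Ioi_ae_eq_Ici.symm,
      setLIntegral_congr_fun measurableSet_Ioi
        fun y (hy : b < y) => ENNReal.ofReal_rpow_of_pos (p := -a - 1) (hb0.trans hy),
      ← ofReal_integral_eq_lintegral_ofReal (integrableOn_Ioi_rpow_of_lt (by linarith) hb0)
        ((ae_restrict_iff' measurableSet_Ioi).2 (ae_of_all _ fun y (hy : b < y) =>
          Real.rpow_nonneg (hb0.trans hy).le _)),
      integral_Ioi_rpow_of_lt (by linarith) hb0, ← ENNReal.ofReal_mul ha.le, sub_add_cancel,
      neg_div_neg_eq, mul_div_cancel₀ _ ha.ne', ← ENNReal.ofReal_rpow_of_pos hb0, hbs]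
  have hbound : ∀ n : ℕ, ∫⁻ t in Icc s n, cumul f t ^ (-a - 1) * f t ≤
      ∫⁻ y in Ici b, ENNReal.ofReal y ^ (-a - 1) := by
    intro n
    have hφ : Measurable ((Ici (cumul f s)).indicator fun y : ℝ≥0∞ => y ^ (-a - 1)) :=
      (show Measurable fun y : ℝ≥0∞ => y ^ (-a - 1) by fun_prop).indicator measurableSet_Ici
    calc ∫⁻ t in Icc s n, cumul f t ^ (-a - 1) * f t
        = ∫⁻ t in Icc s n, (Ici (cumul f s)).indicator (fun y => y ^ (-a - 1)) (cumul f t) * f t :=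
          setLIntegral_congr_fun measurableSet_Icc fun t ht => by
            rw [indicator_of_mem (show cumul f t ∈ Ici (cumul f s) from cumul_mono f ht.1)]
      _ ≤ ∫⁻ t in Ioc 0 (n : ℝ),
            (Ici (cumul f s)).indicator (fun y => y ^ (-a - 1)) (cumul f t) * f t :=
          lintegral_mono_set fun t ht => ⟨hs.trans_le ht.1, ht.2⟩
      _ = ∫⁻ y in Ioc (0 : ℝ) (cumul f n).toReal,
            (Ici (cumul f s)).indicator (fun y => y ^ (-a - 1)) (ENNReal.ofReal y) :=
          lintegral_comp_cumul hf n.cast_nonneg (hfin n) hφ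
      _ ≤ ∫⁻ y, (Ici (cumul f s)).indicator (fun y => y ^ (-a - 1)) (ENNReal.ofReal y) :=
          setLIntegral_le_lintegral _ _
      _ = ∫⁻ y, (Ici b).indicator (fun y => ENNReal.ofReal y ^ (-a - 1)) y := by
          congr 1 with y
          have : ENNReal.ofReal y ∈ Ici (cumul f s) ↔ y ∈ Ici b := by
            rw [mem_Ici, mem_Ici, ← hbs, ENNReal.ofReal_le_ofReal_iff']
            constructor
            · rintro (h | h) <;> linarith
            · exact Or.inl
          by_cases h : y ∈ Ici b
          · rw [indicator_of_mem h, indicator_of_mem (this.2 h)]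
          · rw [indicator_of_notMem h, indicator_of_notMem (mt this.1 h)]
      _ = _ := lintegral_indicator measurableSet_Ici _
  have hunion : Ici s = ⋃ n : ℕ, Icc s (n : ℝ) := by
    ext t
    simp only [mem_Ici, mem_iUnion, mem_Icc, exists_and_left, iff_self_and]
    exact fun _ => exists_nat_ge t
  rw [← htail, hunion, setLIntegral_iUnion_of_directed]
  · gcongr
    exact iSup_le hbound
  · exact Monotone.directed_le fun m n hmn => Icc_subset_Icc_right (by exact_mod_cast hmn)

lemma lintegral_mul_lintegral_Ici {a b : ℝ → ℝ≥0∞} (ha : Measurable a) (hb : Measurable b) :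
    ∫⁻ t in Ioi (0 : ℝ), a t * ∫⁻ s in Ici t, b s = ∫⁻ s in Ioi (0 : ℝ), b s * cumul a s := by
  have hset : MeasurableSet {z : ℝ × ℝ | z.1 ≤ z.2} := measurableSet_le measurable_fst measurable_snd
  set F : ℝ → ℝ → ℝ≥0∞ := fun t s =>
    {z : ℝ × ℝ | z.1 ≤ z.2}.indicator (fun z => a z.1 * b z.2) (t, s) with hF
  have hFm : Measurable (Function.uncurry F) :=
    ((ha.comp measurable_fst).mul (hb.comp measurable_snd)).indicator hset
  have hl : ∀ t ∈ Ioi (0 : ℝ), a t * ∫⁻ s in Ici t, b s = ∫⁻ s in Ioi (0 : ℝ), F t s := by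
    intro t ht
    have h1 : ∀ s, F t s = (Ici t).indicator (fun s => a t * b s) s := fun s => by
      simp [hF, indicator]
    simp_rw [h1]
    rw [lintegral_indicator measurableSet_Ici, Measure.restrict_restrict measurableSet_Ici,
      inter_eq_left.2 (Ici_subset_Ioi.2 ht), lintegral_const_mul _ hb]
  have hr : ∀ s ∈ Ioi (0 : ℝ), b s * cumul a s = ∫⁻ t in Ioi (0 : ℝ), F t s := by
    intro s hs
    have h1 : ∀ t, F t s = (Iic s).indicator (fun t => b s * a t) t := fun t => by
      simp [hF, indicator, mul_comm]
    simp_rw [h1]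
    rw [lintegral_indicator measurableSet_Iic, Measure.restrict_restrict measurableSet_Iic,
      inter_comm, Ioi_inter_Iic, lintegral_const_mul _ ha, cumul]
  rw [setLIntegral_congr_fun measurableSet_Ioi hl, setLIntegral_congr_fun measurableSet_Ioi hr]
  exact lintegral_lintegral_swap hFm.aemeasurable

lemma rpow_mul_rpow_of_add_eq {x : ℝ≥0∞} (h0 : 0 < x) (hfin : x < ∞) {a b c : ℝ}
    (h : a + b = c) : x ^ a * x ^ b = x ^ c := by
  rw [← ENNReal.rpow_add _ _ h0.ne' hfin.ne, h]

/-- For `b = h U⁻ᵖ` with `U = ∫₀ u`, the integral of `h` is controlled by the `p`-th power of the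
integral of `g = (∫ₜ^∞ b)^(1/p) u`, while `∫ gᵖ v = ∫ h U^(1-p)`. -/
lemma exists_cumul_le_rpow_cumul {p : ℝ} (hp : 1 < p) {u v : ℝ → ℝ≥0∞} (hu : Measurable u)
    (hfin : ∀ x, cumul u x < ∞) (hpos : ∀ x, 0 < x → 0 < cumul u x)
    (huv : ∀ᵐ x ∂mu0, 0 < u x ∧ u x < ∞ ∧ v x = u x ^ (1 - p))
    {h : ℝ → ℝ≥0∞} (hh : Measurable h) :
    ∃ g : ℝ → ℝ≥0∞, Measurable g ∧
      (∀ x, 0 < x → cumul h x ≤ ENNReal.ofReal p * cumul g x ^ p) ∧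
      ∫⁻ t in Ioi (0 : ℝ), g t ^ p * v t = ∫⁻ t in Ioi (0 : ℝ), h t * cumul u t ^ (1 - p) := by
  have hp0 : 0 < p := by linarith
  have hU := measurable_cumul u
  set b : ℝ → ℝ≥0∞ := fun s => h s * cumul u s ^ (-p) with hb
  have hbm : Measurable b := by fun_prop
  set R : ℝ → ℝ≥0∞ := fun t => ∫⁻ s in Ici t, b s with hR
  have hRanti : Antitone R := fun s t hst => lintegral_mono_set (Ici_subset_Ici.2 hst)
  have hRm : Measurable R := hRanti.measurable
  set g : ℝ → ℝ≥0∞ := fun t => R t ^ (1 / p) * u t with hg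
  have hgm : Measurable g := by fun_prop
  refine ⟨g, hgm, fun x hx => ?_, ?_⟩
  · set a : ℝ → ℝ≥0∞ := fun t => cumul u t ^ (p - 1) * u t with ha
    have ham : Measurable a := by fun_prop
    have hUg : ∀ t, cumul u t * R t ^ (1 / p) ≤ cumul g t := fun t => by
      rw [cumul, ← lintegral_mul_const _ hu]
      refine setLIntegral_mono hgm fun s hs => ?_
      rw [mul_comm]
      exact mul_le_mul_left (ENNReal.rpow_le_rpow (hRanti hs.2) (by positivity)) _
    calc cumul h x
        = ∫⁻ s in Ioi (0 : ℝ), ENNReal.ofReal p * ((Ioc 0 x).indicator b s * cumul a s) := by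
          have hsub : cumul h x = ∫⁻ s in Ioi (0 : ℝ), (Ioc 0 x).indicator h s := by
            rw [lintegral_indicator measurableSet_Ioc, Measure.restrict_restrict measurableSet_Ioc,
              inter_eq_left.2 Ioc_subset_Ioi_self, cumul]
          rw [hsub]
          refine setLIntegral_congr_fun measurableSet_Ioi fun s (hs : 0 < s) => ?_
          by_cases hsx : s ∈ Ioc 0 x
          · have has : ENNReal.ofReal p * cumul a s = cumul u s ^ p :=
              lintegral_cumul_rpow_mul hu hs.le (hfin s) hp0
            simp only [indicator_of_mem hsx, hb]
            rw [mul_left_comm, has, mul_assoc,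
              rpow_mul_rpow_of_add_eq (hpos s hs) (hfin s) (neg_add_cancel p), ENNReal.rpow_zero,
              mul_one]
          · simp [indicator_of_notMem hsx]
      _ = ENNReal.ofReal p *
            ∫⁻ t in Ioi (0 : ℝ), a t * ∫⁻ s in Ici t, (Ioc 0 x).indicator b s := by
          have hba : Measurable fun s => (Ioc 0 x).indicator b s * cumul a s :=
            (hbm.indicator measurableSet_Ioc).mul (measurable_cumul a)
          rw [lintegral_const_mul _ hba,
            lintegral_mul_lintegral_Ici ham (hbm.indicator measurableSet_Ioc)]
      _ ≤ ENNReal.ofReal p * ∫⁻ t in Ioi (0 : ℝ), (Ioc 0 x).indicator (fun t => a t * R t) t := by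
          gcongr _ * ?_
          refine setLIntegral_mono ((ham.mul hRm).indicator measurableSet_Ioc) fun t ht => ?_
          by_cases htx : t ∈ Ioc 0 x
          · rw [indicator_of_mem htx]
            gcongr
            exact lintegral_mono (indicator_le_self _ _)
          · have hz : ∫⁻ s in Ici t, (Ioc 0 x).indicator b s = 0 := by
              rw [setLIntegral_congr_fun (g := 0) measurableSet_Ici fun s (hs : t ≤ s) =>
                indicator_of_notMem (fun h => htx ⟨ht, hs.trans h.2⟩) _]
              simp
            rw [hz, mul_zero]
            exact zero_le
      _ = ENNReal.ofReal p * ∫⁻ t in Ioc (0 : ℝ) x, a t * R t := by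
          rw [lintegral_indicator measurableSet_Ioc, Measure.restrict_restrict measurableSet_Ioc,
            inter_eq_left.2 Ioc_subset_Ioi_self]
      _ ≤ ENNReal.ofReal p * ∫⁻ t in Ioc (0 : ℝ) x, cumul g x ^ (p - 1) * g t := by
          gcongr _ * ?_
          refine setLIntegral_mono (hgm.const_mul _) fun t ht => ?_
          have hRt : R t = (R t ^ (1 / p)) ^ (p - 1) * R t ^ (1 / p) := by
            rw [← ENNReal.rpow_mul, ← ENNReal.rpow_add_of_nonneg]
            · rw [show 1 / p * (p - 1) + 1 / p = 1 by field_simp; ring, ENNReal.rpow_one]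
            · exact mul_nonneg (by positivity) (by linarith)
            · positivity
          calc a t * R t = (cumul u t * R t ^ (1 / p)) ^ (p - 1) * g t := by
                rw [ENNReal.mul_rpow_of_nonneg _ _ (by linarith)]
                conv_lhs => rw [hRt]
                simp only [ha, hg]
                ring
            _ ≤ cumul g x ^ (p - 1) * g t := by
                gcongr ?_ ^ _ * _
                exact (hUg t).trans (cumul_mono g ht.2)
      _ = ENNReal.ofReal p * cumul g x ^ p := by
          rw [lintegral_const_mul _ hgm]
          congr 1
          change cumul g x ^ (p - 1) * cumul g x = _
          nth_rw 2 [← ENNReal.rpow_one (cumul g x)]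
          rw [← ENNReal.rpow_add_of_nonneg _ _ (by linarith) zero_le_one, sub_add_cancel]
  · calc ∫⁻ t in Ioi (0 : ℝ), g t ^ p * v t = ∫⁻ t in Ioi (0 : ℝ), u t * R t := by
          refine lintegral_congr_ae ?_
          filter_upwards [huv] with t ⟨h0, h1, h2⟩
          rw [h2, hg, ENNReal.mul_rpow_of_nonneg _ _ hp0.le, ← ENNReal.rpow_mul,
            one_div_mul_cancel hp0.ne', ENNReal.rpow_one, mul_assoc,
            rpow_mul_rpow_of_add_eq h0 h1 (add_sub_cancel p 1), ENNReal.rpow_one, mul_comm]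
      _ = ∫⁻ s in Ioi (0 : ℝ), b s * cumul u s := lintegral_mul_lintegral_Ici hu hbm
      _ = _ := by
          refine setLIntegral_congr_fun measurableSet_Ioi fun s (hs : 0 < s) => ?_
          simp only [hb]
          rw [mul_assoc]
          nth_rw 2 [← ENNReal.rpow_one (cumul u s)]
          rw [rpow_mul_rpow_of_add_eq (hpos s hs) (hfin s) (neg_add_eq_sub p 1)]

lemma rpow_cumul_le {p r : ℝ} (hp : 1 < p) (hr : r = (p - 1) / p) {u v : ℝ → ℝ≥0∞}
    (hu : Measurable u) (hfin : ∀ x, cumul u x < ∞) (hpos : ∀ x, 0 < x → 0 < cumul u x)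
    (huv : ∀ᵐ x ∂mu0, 0 < u x ∧ u x < ∞ ∧ v x = u x ^ (1 - p))
    {h : ℝ → ℝ≥0∞} (hh : Measurable h) {x : ℝ} (hx : 0 < x) :
    cumul h x ^ p ≤ cumul (fun t => h t ^ p * v t * cumul u t ^ r) x *
      ((ENNReal.ofReal r)⁻¹ * cumul u x ^ r) ^ (p - 1) := by
  have hp0 : 0 < p := by linarith
  have hp1 : 0 < p - 1 := by linarith
  have hr0 : 0 < r := hr ▸ by positivity
  have hU := measurable_cumul u
  have huv' := ae_restrict_of_ae_restrict_of_subset 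
    (Ioc_subset_Ioi_self : Ioc (0 : ℝ) x ⊆ Ioi 0) huv
  set F : ℝ → ℝ≥0∞ := fun t => h t * u t ^ (-r) * cumul u t ^ (r / p) with hF
  set G : ℝ → ℝ≥0∞ := fun t => u t ^ r * cumul u t ^ (-(r / p)) with hG
  have hmul : cumul h x = ∫⁻ t in Ioc (0 : ℝ) x, (F * G) t := by
    refine lintegral_congr_ae ?_
    filter_upwards [huv', ae_restrict_mem measurableSet_Ioc] with t ⟨h0, h1, _⟩ ht
    have e1 := rpow_mul_rpow_of_add_eq h0 h1 (neg_add_cancel r)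
    have e2 := rpow_mul_rpow_of_add_eq (hpos t ht.1) (hfin t) (add_neg_cancel (r / p))
    rw [ENNReal.rpow_zero] at e1 e2
    calc h t = h t * (u t ^ (-r) * u t ^ r) * (cumul u t ^ (r / p) * cumul u t ^ (-(r / p))) := by
          rw [e1, e2, mul_one, mul_one]
      _ = (F * G) t := by simp only [hF, hG, Pi.mul_apply]; ring
  have hFp : ∫⁻ t in Ioc (0 : ℝ) x, F t ^ p = cumul (fun t => h t ^ p * v t * cumul u t ^ r) x := by
    refine lintegral_congr_ae ?_
    filter_upwards [huv'] with t ⟨h0, h1, h2⟩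
    simp only [hF]
    rw [ENNReal.mul_rpow_of_nonneg _ _ hp0.le, ENNReal.mul_rpow_of_nonneg _ _ hp0.le,
      ← ENNReal.rpow_mul, ← ENNReal.rpow_mul, h2, div_mul_cancel₀ _ hp0.ne',
      show -r * p = 1 - p by rw [hr]; field_simp; ring]
  have hGp : ∫⁻ t in Ioc (0 : ℝ) x, G t ^ (p / (p - 1)) =
      (ENNReal.ofReal r)⁻¹ * cumul u x ^ r := by
    rw [← lintegral_cumul_rpow_mul hu hx.le (hfin x) hr0, ← mul_assoc,
      ENNReal.inv_mul_cancel (ENNReal.ofReal_pos.2 hr0).ne' ENNReal.ofReal_ne_top, one_mul]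
    refine setLIntegral_congr_fun measurableSet_Ioc fun t ht => ?_
    simp only [hG]
    rw [ENNReal.mul_rpow_of_nonneg _ _ (by positivity), ← ENNReal.rpow_mul, ← ENNReal.rpow_mul,
      show r * (p / (p - 1)) = 1 by rw [hr]; field_simp,
      show -(r / p) * (p / (p - 1)) = r - 1 by rw [hr]; field_simp; ring, ENNReal.rpow_one, mul_comm]
  have hconj : p.HolderConjugate (p / (p - 1)) := Real.HolderConjugate.conjExponent hp
  have hhold := ENNReal.lintegral_mul_le_Lp_mul_Lq (volume.restrict (Ioc (0 : ℝ) x)) hconj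
    (f := F) (g := G) (by fun_prop) (by fun_prop)
  rw [← hmul, hFp, hGp] at hhold
  refine (ENNReal.rpow_le_rpow hhold hp0.le).trans_eq ?_
  rw [ENNReal.mul_rpow_of_nonneg _ _ hp0.le, ← ENNReal.rpow_mul, ← ENNReal.rpow_mul,
    one_div_mul_cancel hp0.ne', ENNReal.rpow_one,
    show 1 / (p / (p - 1)) * p = p - 1 by field_simp]

/-- Hardy's inequality for averages with respect to the measure `u dt`. -/
lemma lintegral_rpow_cumul_div_le {p r : ℝ} (hp : 1 < p) (hr : r = (p - 1) / p) {u v : ℝ → ℝ≥0∞}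
    (hu : Measurable u) (hv : Measurable v) (hfin : ∀ x, cumul u x < ∞)
    (hpos : ∀ x, 0 < x → 0 < cumul u x)
    (huv : ∀ᵐ x ∂mu0, 0 < u x ∧ u x < ∞ ∧ v x = u x ^ (1 - p))
    {h : ℝ → ℝ≥0∞} (hh : Measurable h) :
    ∫⁻ x in Ioi (0 : ℝ), u x * (cumul h x ^ p * cumul u x ^ (-p)) ≤
      (ENNReal.ofReal r)⁻¹ ^ p * ∫⁻ t in Ioi (0 : ℝ), h t ^ p * v t := by
  have hp0 : 0 < p := by linarith
  have hp1 : 0 < p - 1 := by linarith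
  have hr0 : 0 < r := hr ▸ by positivity
  have hU := measurable_cumul u
  set K := (ENNReal.ofReal r)⁻¹ with hK
  have hKtop : K ≠ ∞ := ENNReal.inv_ne_top.2 (ENNReal.ofReal_pos.2 hr0).ne'
  have hKr : K * ENNReal.ofReal r = 1 :=
    ENNReal.inv_mul_cancel (ENNReal.ofReal_pos.2 hr0).ne' ENNReal.ofReal_ne_top
  set f : ℝ → ℝ≥0∞ := fun t => h t ^ p * v t * cumul u t ^ r with hf
  have hfm : Measurable f := by fun_prop
  set b : ℝ → ℝ≥0∞ := fun t => cumul u t ^ (-r - 1) * u t with hb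
  have hbm : Measurable b := by fun_prop
  have hbf : Measurable fun x => K ^ (p - 1) * (b x * cumul f x) :=
    (hbm.mul (measurable_cumul f)).const_mul _
  calc ∫⁻ x in Ioi (0 : ℝ), u x * (cumul h x ^ p * cumul u x ^ (-p))
      ≤ ∫⁻ x in Ioi (0 : ℝ), K ^ (p - 1) * (b x * cumul f x) := by
        refine setLIntegral_mono hbf fun x (hx : 0 < x) => ?_
        calc u x * (cumul h x ^ p * cumul u x ^ (-p))
            ≤ u x * (cumul f x * (K * cumul u x ^ r) ^ (p - 1) * cumul u x ^ (-p)) := by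
              gcongr
              exact rpow_cumul_le hp hr hu hfin hpos huv hh hx
          _ = K ^ (p - 1) * ((cumul u x ^ (r * (p - 1)) * cumul u x ^ (-p)) * u x * cumul f x) := by
              rw [ENNReal.mul_rpow_of_nonneg _ _ hp1.le, ← ENNReal.rpow_mul]
              ring
          _ = _ := by
              rw [rpow_mul_rpow_of_add_eq (hpos x hx) (hfin x)
                (show r * (p - 1) + -p = -r - 1 by rw [hr]; field_simp; ring)]
    _ = K ^ (p - 1) * ∫⁻ t in Ioi (0 : ℝ), f t * ∫⁻ s in Ici t, b s := by
        rw [lintegral_const_mul' _ _ (ENNReal.rpow_ne_top_of_nonneg hp1.le hKtop),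
          lintegral_mul_lintegral_Ici hfm hbm]
    _ ≤ K ^ (p - 1) * ∫⁻ t in Ioi (0 : ℝ), K * (h t ^ p * v t) := by
        gcongr _ * ?_
        refine setLIntegral_mono (by fun_prop) fun t (ht : 0 < t) => ?_
        calc f t * ∫⁻ s in Ici t, b s
            = K * (f t * (ENNReal.ofReal r * ∫⁻ s in Ici t, b s)) := by
              rw [mul_left_comm (f t), ← mul_assoc K, hKr, one_mul]
          _ ≤ K * (f t * cumul u t ^ (-r)) := by
              gcongr
              exact lintegral_Ici_cumul_rpow_mul_le hu hfin ht (hpos t ht) hr0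
          _ = K * (h t ^ p * v t) := by
              rw [hf]
              simp only
              rw [mul_assoc (h t ^ p * v t), rpow_mul_rpow_of_add_eq (hpos t ht) (hfin t)
                (add_neg_cancel r), ENNReal.rpow_zero, mul_one]
    _ = K ^ p * ∫⁻ t in Ioi (0 : ℝ), h t ^ p * v t := by
        rw [lintegral_const_mul _ (by fun_prop), ← mul_assoc]
        congr 1
        nth_rw 2 [← ENNReal.rpow_one K]
        rw [← ENNReal.rpow_add_of_nonneg _ _ hp1.le zero_le_one, sub_add_cancel]

lemma mul_rpow_sub_one_le {p : ℝ} (hp : 1 ≤ p) (x y : ℝ≥0∞) :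
    x * y ^ (p - 1) ≤ x ^ p + y ^ p := by
  have key : ∀ z : ℝ≥0∞, z * z ^ (p - 1) = z ^ p := fun z => by
    nth_rw 1 [← ENNReal.rpow_one z]
    rw [← ENNReal.rpow_add_of_nonneg _ _ zero_le_one (by linarith), add_sub_cancel]
  have hp' : 0 ≤ p - 1 := by linarith
  rcases le_total x y with hxy | hxy
  · calc x * y ^ (p - 1) ≤ y * y ^ (p - 1) := by gcongr
      _ ≤ x ^ p + y ^ p := by rw [key]; exact le_add_self
  · calc x * y ^ (p - 1) ≤ x * x ^ (p - 1) := by gcongr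
      _ ≤ x ^ p + y ^ p := by rw [key]; exact le_self_add

/-- The function `k = H^(p-1) h`, with `H = ∫₀ h`, satisfies `Hᵖ = p ∫₀ k`, and `∫ k U^(1-p)` is
controlled by `∫ hᵖ v`. -/
lemma exists_rpow_cumul_eq_cumul {p r : ℝ} (hp : 1 < p) (hr : r = (p - 1) / p)
    {u v : ℝ → ℝ≥0∞} (hu : Measurable u) (hv : Measurable v) (hfin : ∀ x, cumul u x < ∞)
    (hpos : ∀ x, 0 < x → 0 < cumul u x)
    (huv : ∀ᵐ x ∂mu0, 0 < u x ∧ u x < ∞ ∧ v x = u x ^ (1 - p))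
    {h : ℝ → ℝ≥0∞} (hh : Measurable h) (hhfin : ∫⁻ t in Ioi (0 : ℝ), h t ^ p * v t < ∞) :
    ∃ k : ℝ → ℝ≥0∞, Measurable k ∧
      (∀ x, 0 < x → cumul h x ^ p = ENNReal.ofReal p * cumul k x) ∧
      ∫⁻ t in Ioi (0 : ℝ), k t * cumul u t ^ (1 - p) ≤
        (1 + (ENNReal.ofReal r)⁻¹ ^ p) * ∫⁻ t in Ioi (0 : ℝ), h t ^ p * v t := by
  have hp0 : 0 < p := by linarith
  have hp1 : 0 < p - 1 := by linarith
  have hr0 : 0 < r := hr ▸ by positivity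
  have hU := measurable_cumul u
  have hH := measurable_cumul h
  have hHfin : ∀ x, 0 < x → cumul h x < ∞ := by
    intro x hx
    refine (ENNReal.rpow_lt_top_iff_of_pos hp0).1 ?_
    refine (rpow_cumul_le hp hr hu hfin hpos huv hh hx).trans_lt (ENNReal.mul_lt_top ?_ ?_)
    · calc cumul (fun t => h t ^ p * v t * cumul u t ^ r) x
          ≤ ∫⁻ t in Ioc (0 : ℝ) x, h t ^ p * v t * cumul u x ^ r := by
            refine setLIntegral_mono (by fun_prop) fun t ht => ?_
            gcongr
            exact cumul_mono u ht.2
        _ = (∫⁻ t in Ioc (0 : ℝ) x, h t ^ p * v t) * cumul u x ^ r :=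
            lintegral_mul_const _ (by fun_prop)
        _ < ∞ := ENNReal.mul_lt_top
            ((lintegral_mono_set Ioc_subset_Ioi_self).trans_lt hhfin)
            (ENNReal.rpow_lt_top_of_nonneg hr0.le (hfin x).ne)
    · refine ENNReal.rpow_lt_top_of_nonneg hp1.le (ENNReal.mul_lt_top ?_ ?_).ne
      · exact ENNReal.inv_lt_top.2 (ENNReal.ofReal_pos.2 hr0)
      · exact ENNReal.rpow_lt_top_of_nonneg hr0.le (hfin x).ne
  refine ⟨fun t => cumul h t ^ (p - 1) * h t, by fun_prop, fun x hx =>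
    (lintegral_cumul_rpow_mul hh hx.le (hHfin x hx) hp0).symm, ?_⟩
  rw [add_mul, one_mul]
  refine le_trans ?_ (add_le_add_right
    (lintegral_rpow_cumul_div_le hp hr hu hv hfin hpos huv hh) _)
  rw [← lintegral_add_left (by fun_prop)]
  refine lintegral_mono_ae ?_
  filter_upwards [huv, ae_restrict_mem measurableSet_Ioi] with t ⟨h0, h1, h2⟩ ht
  have hyoung := mul_rpow_sub_one_le hp.le (h t) (u t * cumul h t * cumul u t ^ (-1 : ℝ))
  rw [ENNReal.mul_rpow_of_nonneg _ _ hp1.le, ENNReal.mul_rpow_of_nonneg _ _ hp1.le,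
    ENNReal.mul_rpow_of_nonneg _ _ hp0.le, ENNReal.mul_rpow_of_nonneg _ _ hp0.le,
    ← ENNReal.rpow_mul, ← ENNReal.rpow_mul, neg_one_mul, neg_one_mul, neg_sub] at hyoung
  have e1 := rpow_mul_rpow_of_add_eq h0 h1 (show p - 1 + (1 - p) = 0 by ring)
  have e2 := rpow_mul_rpow_of_add_eq h0 h1 (add_sub_cancel p 1)
  rw [ENNReal.rpow_zero] at e1
  rw [ENNReal.rpow_one] at e2
  calc cumul h t ^ (p - 1) * h t * cumul u t ^ (1 - p)
      = h t * (u t ^ (p - 1) * cumul h t ^ (p - 1) * cumul u t ^ (1 - p)) * u t ^ (1 - p) := by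
        rw [← mul_one (_ * _ * _), ← e1]
        ring
    _ ≤ (h t ^ p + u t ^ p * cumul h t ^ p * cumul u t ^ (-p)) * u t ^ (1 - p) := by gcongr
    _ = h t ^ p * u t ^ (1 - p) +
          (u t ^ p * u t ^ (1 - p)) * (cumul h t ^ p * cumul u t ^ (-p)) := by ring
    _ = h t ^ p * v t + u t * (cumul h t ^ p * cumul u t ^ (-p)) := by rw [e2, h2]

lemma lintegral_const_mul_rpow_mul {c : ℝ≥0∞} (hc : c ≠ ∞) {s : ℝ} (hs : 0 < s)
    (k w : ℝ → ℝ≥0∞) (μ : Measure ℝ) :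
    (∫⁻ x, (c * k x) ^ s * w x ∂μ) ^ (1 / s) = c * (∫⁻ x, k x ^ s * w x ∂μ) ^ (1 / s) := by
  simp_rw [ENNReal.mul_rpow_of_nonneg _ _ hs.le, mul_assoc]
  rw [lintegral_const_mul' _ _ (ENNReal.rpow_ne_top_of_nonneg hs.le hc),
    ENNReal.mul_rpow_of_nonneg _ _ (by positivity), ← ENNReal.rpow_mul, mul_one_div_cancel hs.ne',
    ENNReal.rpow_one]

theorem statement6 (p q : ℝ) (hq : 0 < q) (hp : 1 < p)
    (w v : ℝ → ℝ≥0∞) (hw : IsWeight w) (hv : IsWeight v)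
    (hvfin : ∀ x ∈ Ioi (0 : ℝ), (∫⁻ t in Ioc (0 : ℝ) x, v t ^ (1 - p / (p - 1))) < ∞) :
    (∃ C : ℝ≥0, 0 < C ∧ ∀ h : ℝ → ℝ≥0∞, Measurable h →
        (∫⁻ x in Ioi (0 : ℝ), (∫⁻ t in Ioc (0 : ℝ) x, h t) ^ q * w x) ^ (1 / q) ≤
          (C : ℝ≥0∞) * (∫⁻ t in Ioi (0 : ℝ), h t ^ p * v t) ^ (1 / p)) ↔
      (∃ C' : ℝ≥0, 0 < C' ∧ ∀ h : ℝ → ℝ≥0∞, Measurable h →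
        (∫⁻ x in Ioi (0 : ℝ), (∫⁻ t in Ioc (0 : ℝ) x, h t) ^ (q / p) * w x) ^ (p / q) ≤
          (C' : ℝ≥0∞) * ∫⁻ t in Ioi (0 : ℝ), h t * Phi p v t ^ (1 - 2 * p)) := by

  have hp0 : 0 < p := by linarith
  have hp1 : 0 < p - 1 := by linarith
  have hs : 0 < q / p := by positivity
  set u : ℝ → ℝ≥0∞ := fun t => v t ^ (1 - p / (p - 1)) with hu_def
  have hexp : 1 - p / (p - 1) = -(1 / (p - 1)) := by field_simp; ring
  have hvm : Measurable v := hv.1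
  have hu : Measurable u := by fun_prop
  have huv : ∀ᵐ x ∂mu0, 0 < u x ∧ u x < ∞ ∧ v x = u x ^ (1 - p) := by
    filter_upwards [hv.2] with x ⟨h0, h1⟩
    refine ⟨ENNReal.rpow_pos h0 h1.ne, (ENNReal.rpow_ne_top_of_ne_zero h0.ne' h1.ne).lt_top, ?_⟩
    rw [hu_def, ← ENNReal.rpow_mul, hexp,
      show -(1 / (p - 1)) * (1 - p) = 1 by field_simp; ring, ENNReal.rpow_one]
  have hfin : ∀ x, cumul u x < ∞ := by
    intro x
    rcases le_or_gt x 0 with hx | hx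
    · simp [cumul, Ioc_eq_empty hx.not_gt]
    · exact hvfin x hx
  have hpos : ∀ x, 0 < x → 0 < cumul u x := by
    intro x hx
    refine pos_iff_ne_zero.2 fun hzero => ?_
    have h0 := (lintegral_eq_zero_iff hu).1 hzero
    have hx' : (volume.restrict (Ioc (0 : ℝ) x)) ≠ 0 := by
      rw [Ne, Measure.restrict_eq_zero, Real.volume_Ioc]
      simpa using hx
    have : (ae (volume.restrict (Ioc (0 : ℝ) x))).NeBot := ae_neBot.2 hx'
    obtain ⟨t, ht, ht'⟩ := (h0.and (ae_restrict_of_ae_restrict_of_subset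
      (Ioc_subset_Ioi_self : Ioc (0 : ℝ) x ⊆ Ioi 0) huv)).exists
    exact ht'.1.ne' ht
  have hPhi : ∀ t, Phi p v t ^ (1 - 2 * p) = cumul u t ^ (1 - p) := by
    intro t
    rw [Phi, ← ENNReal.rpow_mul, show 1 / (p / (p - 1) + 1) * (1 - 2 * p) = 1 - p by
      have : p + (p - 1) ≠ 0 := by linarith
      field_simp
      ring]
    rfl
  simp_rw [hPhi]
  have hpow : ∀ h : ℝ → ℝ≥0∞, (∫⁻ x in Ioi (0 : ℝ), (cumul h x ^ p) ^ (q / p) * w x) ^ (p / q) =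
      ((∫⁻ x in Ioi (0 : ℝ), cumul h x ^ q * w x) ^ (1 / q)) ^ p := by
    intro h
    rw [← ENNReal.rpow_mul, one_div_mul_eq_div]
    simp_rw [← ENNReal.rpow_mul, mul_div_cancel₀ q hp0.ne']
  have hscale : ∀ k : ℝ → ℝ≥0∞,
      (∫⁻ x in Ioi (0 : ℝ), (ENNReal.ofReal p * k x) ^ (q / p) * w x) ^ (p / q) =
        ENNReal.ofReal p * (∫⁻ x in Ioi (0 : ℝ), k x ^ (q / p) * w x) ^ (p / q) := by
    intro k
    simpa using lintegral_const_mul_rpow_mul ENNReal.ofReal_ne_top hs k w _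
  constructor
  · rintro ⟨C, hC, hineq⟩
    refine ⟨Real.toNNReal p * C ^ p, mul_pos (Real.toNNReal_pos.2 hp0) (NNReal.rpow_pos hC),
      fun h hh => ?_⟩
    obtain ⟨g, hg, hhg, hgv⟩ := exists_cumul_le_rpow_cumul hp hu hfin hpos huv hh
    calc (∫⁻ x in Ioi (0 : ℝ), cumul h x ^ (q / p) * w x) ^ (p / q)
        ≤ (∫⁻ x in Ioi (0 : ℝ), (ENNReal.ofReal p * cumul g x ^ p) ^ (q / p) * w x) ^ (p / q) := by
          refine ENNReal.rpow_le_rpow (setLIntegral_mono' measurableSet_Ioi fun x hx => ?_)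
            (by positivity)
          gcongr
          exact hhg x hx
      _ = ENNReal.ofReal p * ((∫⁻ x in Ioi (0 : ℝ), cumul g x ^ q * w x) ^ (1 / q)) ^ p := by
          rw [hscale, hpow]
      _ ≤ ENNReal.ofReal p * (C * (∫⁻ t in Ioi (0 : ℝ), g t ^ p * v t) ^ (1 / p)) ^ p := by
          gcongr
          exact hineq g hg
      _ = _ := by
          rw [ENNReal.mul_rpow_of_nonneg _ _ hp0.le, ← ENNReal.rpow_mul, one_div_mul_cancel hp0.ne',
            ENNReal.rpow_one, hgv, ← mul_assoc, ENNReal.coe_mul,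
            ENNReal.coe_rpow_of_nonneg _ hp0.le]
          rfl
  · rintro ⟨C, hC, hineq⟩
    set r := (p - 1) / p with hr
    have hr0 : 0 < r := by positivity
    set M : ℝ≥0 := Real.toNNReal p * (C * (1 + (Real.toNNReal r)⁻¹ ^ p)) with hM
    have hM0 : 0 < M := mul_pos (Real.toNNReal_pos.2 hp0) (by positivity)
    have hMcoe : (M : ℝ≥0∞) = ENNReal.ofReal p * (C * (1 + (ENNReal.ofReal r)⁻¹ ^ p)) := by
      rw [hM, ENNReal.coe_mul, ENNReal.coe_mul, ENNReal.coe_add, ENNReal.coe_one,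
        ENNReal.coe_rpow_of_nonneg _ hp0.le, ENNReal.coe_inv (Real.toNNReal_pos.2 hr0).ne']
      rfl
    refine ⟨M ^ (1 / p), NNReal.rpow_pos hM0, fun h hh => ?_⟩
    rw [ENNReal.coe_rpow_of_nonneg _ (by positivity),
      ← ENNReal.mul_rpow_of_nonneg _ _ (by positivity)]
    rcases eq_or_ne (∫⁻ t in Ioi (0 : ℝ), h t ^ p * v t) ∞ with htop | htop
    · rw [htop, ENNReal.mul_top (by exact_mod_cast hM0.ne'),
        ENNReal.top_rpow_of_pos (by positivity)]
      exact le_top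
    obtain ⟨k, hk, hhk, hkv⟩ :=
      exists_rpow_cumul_eq_cumul hp hr hu hvm hfin hpos huv hh htop.lt_top
    rw [one_div p, ENNReal.le_rpow_inv_iff hp0]
    change ((∫⁻ x in Ioi (0 : ℝ), cumul h x ^ q * w x) ^ (1 / q)) ^ p ≤ _
    rw [← hpow h, setLIntegral_congr_fun measurableSet_Ioi
      (g := fun x => (ENNReal.ofReal p * cumul k x) ^ (q / p) * w x)
      fun x hx => by simp only [hhk x hx], hscale, hMcoe, mul_assoc, mul_assoc]
    gcongr
    exact (hineq k hk).trans (by gcongr)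
end
end

section
/- Let 0 < q < ∞ and 1 < p < ∞, let w be a weight on (0,∞), and let v be a weight on (0,∞) such that ∫_x^∞ v(t)^{1-p'} dt < ∞ for every x ∈ (0,∞). Then there exists a constant C > 0 such that (∫₀^∞ (∫_x^∞ h(t) dt)^q w(x) dx)^{1/q} ≤ C (∫₀^∞ h(t)^p v(t) dt)^{1/p} for all h ∈ M⁺(0,∞) if and only if there exists a constant C' > 0 such that (∫₀^∞ (∫_x^∞ h(t) dt)^{q/p} w(x) dx)^{p/q} ≤ C' ∫₀^∞ h(t) Ψ(t)^{1-2p} dt for all h ∈ M⁺(0,∞), where Ψ(x) := (∫_x^∞ v(t)^{1-p'} dt)^{1/(p'+1)}. -/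
open MeasureTheory Set ENNReal NNReal

noncomputable section

/-- `Ψ(x) = (∫_x^∞ v(t)^(1-p') dt)^(1/(p'+1))`, where `p' = p/(p-1)`. -/
def Psi (p : ℝ) (v : ℝ → ℝ≥0∞) (x : ℝ) : ℝ≥0∞ :=
  (∫⁻ t in Ioi x, v t ^ (1 - p / (p - 1))) ^ (1 / (p / (p - 1) + 1))

/-- The tail integral `x ↦ ∫_x^∞ f`. -/
def tailIntegral (f : ℝ → ℝ≥0∞) (x : ℝ) : ℝ≥0∞ := ∫⁻ t in Ioi x, f t

theorem tailIntegral_antitone (f : ℝ → ℝ≥0∞) : Antitone (tailIntegral f) :=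
  fun _ _ hxy => lintegral_mono_set (Ioi_subset_Ioi hxy)

theorem measurable_tailIntegral (f : ℝ → ℝ≥0∞) : Measurable (tailIntegral f) :=
  (tailIntegral_antitone f).measurable

/-- Tonelli's theorem on the triangle `x < s < t`. -/
theorem setLIntegral_mul_setLIntegral_Ioo {a b : ℝ → ℝ≥0∞} (ha : Measurable a)
    (hb : Measurable b) (x : ℝ) :
    ∫⁻ t in Ioi x, a t * ∫⁻ s in Ioo x t, b s = ∫⁻ s in Ioi x, b s * tailIntegral a s := by
  have hm : Measurable (fun z : ℝ × ℝ => (Iio z.1).indicator b z.2 * a z.1) := by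
    have h1 : Measurable (fun z : ℝ × ℝ => (Iio z.1).indicator b z.2) := by
      have : (fun z : ℝ × ℝ => (Iio z.1).indicator b z.2)
          = {z : ℝ × ℝ | z.2 < z.1}.indicator (fun z => b z.2) := by
        ext z; simp [indicator]
      rw [this]
      exact (hb.comp measurable_snd).indicator (measurableSet_lt measurable_snd measurable_fst)
    exact h1.mul (ha.comp measurable_fst)
  have hl : ∀ t, a t * ∫⁻ s in Ioo x t, b s
      = ∫⁻ s in Ioi x, (Iio t).indicator b s * a t := by
    intro t
    rw [lintegral_mul_const _ (hb.indicator measurableSet_Iio),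
      setLIntegral_indicator measurableSet_Iio, mul_comm, inter_comm, Ioi_inter_Iio]
  have hr : ∀ s ∈ Ioi x, ∫⁻ t in Ioi x, (Iio t).indicator b s * a t
      = b s * tailIntegral a s := by
    intro s hs
    have : ∀ t, (Iio t).indicator b s * a t = b s * (Ioi s).indicator a t := by
      intro t; by_cases h : s < t <;> simp [h]
    simp_rw [this]
    rw [lintegral_const_mul _ (ha.indicator measurableSet_Ioi),
      setLIntegral_indicator measurableSet_Ioi, Ioi_inter_Ioi, sup_eq_left.2 (le_of_lt hs),
      tailIntegral]
  simp_rw [hl]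
  rw [lintegral_lintegral_swap hm.aemeasurable]
  exact setLIntegral_congr_fun measurableSet_Ioi hr

/-- With `V` the tail integral of `f`, the set where `V ≤ y` has `f`-mass at most `y`. -/
theorem setLIntegral_tailIntegral_le (f : ℝ → ℝ≥0∞) (y : ℝ≥0∞) :
    ∫⁻ t in {t | tailIntegral f t ≤ y}, f t ≤ y := by
  set S := {t | tailIntegral f t ≤ y} with hS
  have hup : ∀ s ∈ S, ∀ t, s ≤ t → t ∈ S := fun s hs t hst =>
    (tailIntegral_antitone f hst).trans hs
  let U : Set ℝ := ⋃ r : {r : ℚ // (r : ℝ) ∈ S}, Ioi (r.1 : ℝ)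
  have hU : ∫⁻ t in U, f t ≤ y := by
    rw [setLIntegral_iUnion_of_directed]
    · exact iSup_le fun r => r.2
    · intro r s
      rcases le_total r.1 s.1 with h | h
      · exact ⟨r, subset_rfl, Ioi_subset_Ioi (by exact_mod_cast h)⟩
      · exact ⟨s, Ioi_subset_Ioi (by exact_mod_cast h), subset_rfl⟩
  have hsub : S ⊆ U ∪ {z | IsLeast S z} := by
    intro t ht
    by_cases hl : IsLeast S t
    · exact Or.inr hl
    · left
      have : ∃ s ∈ S, s < t := by
        by_contra! hc
        exact hl ⟨ht, hc⟩
      obtain ⟨s, hs, hst⟩ := this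
      obtain ⟨r, hr, hrt⟩ := exists_rat_btwn hst
      exact mem_iUnion.2 ⟨⟨r, hup s hs _ hr.le⟩, hrt⟩
  have hnull : volume {z | IsLeast S z} = 0 :=
    Set.Subsingleton.measure_zero (fun a ha b hb => ha.unique hb) _
  calc ∫⁻ t in S, f t ≤ ∫⁻ t in U ∪ {z | IsLeast S z}, f t := lintegral_mono_set hsub
    _ ≤ (∫⁻ t in U, f t) + ∫⁻ t in {z | IsLeast S z}, f t := lintegral_union_le _ _ _
    _ ≤ y := by rw [setLIntegral_measure_zero _ _ hnull, add_zero]; exact hU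

/-- A set covered by geometrically scaled level sets of the tail integral `V` of `σ` satisfies a
geometric-series bound for `∫ V ^ (-ρ) σ`. -/
theorem setLIntegral_rpow_neg_mul_le_of_subset_iUnion {σ : ℝ → ℝ≥0∞} (hσ : Measurable σ)
    {ρ : ℝ} (hρ : 0 < ρ) {a b s : ℝ≥0} (ha : a ≠ 0) (hs : s ≠ 0) {m : ℝ≥0} (hm : m ≠ 0)
    {A : Set ℝ} (hA : A ⊆ ⋃ n : ℕ, {t | (↑(m * a * s ^ n) : ℝ≥0∞) ≤ tailIntegral σ t ∧
      tailIntegral σ t ≤ ↑(m * b * s ^ n)}) :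
    ∫⁻ t in A, tailIntegral σ t ^ (-ρ) * σ t ≤
      ((a : ℝ≥0∞) ^ (-ρ) * b * (1 - (s : ℝ≥0∞) ^ (1 - ρ))⁻¹) * (m : ℝ≥0∞) ^ (1 - ρ) := by
  have hlevel : ∀ y z : ℝ≥0∞,
      ∫⁻ t in {t | y ≤ tailIntegral σ t ∧ tailIntegral σ t ≤ z}, tailIntegral σ t ^ (-ρ) * σ t
        ≤ y ^ (-ρ) * z := by
    intro y z
    have hms : MeasurableSet {t | y ≤ tailIntegral σ t ∧ tailIntegral σ t ≤ z} :=
      (measurableSet_le measurable_const (measurable_tailIntegral σ)).inter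
        (measurableSet_le (measurable_tailIntegral σ) measurable_const)
    calc _ ≤ ∫⁻ t in {t | y ≤ tailIntegral σ t ∧ tailIntegral σ t ≤ z}, y ^ (-ρ) * σ t := by
          refine setLIntegral_mono' hms fun t ht => ?_
          gcongr ?_ * _
          rw [ENNReal.rpow_neg, ENNReal.rpow_neg]
          exact ENNReal.inv_le_inv.2 (ENNReal.rpow_le_rpow ht.1 hρ.le)
      _ = y ^ (-ρ) * ∫⁻ t in {t | y ≤ tailIntegral σ t ∧ tailIntegral σ t ≤ z}, σ t :=
          lintegral_const_mul _ hσ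
      _ ≤ y ^ (-ρ) * z := by
          gcongr
          exact (lintegral_mono_set fun t ht => ht.2).trans (setLIntegral_tailIntegral_le σ z)
  have hterm : ∀ n : ℕ, (↑(m * a * s ^ n) : ℝ≥0∞) ^ (-ρ) * ↑(m * b * s ^ n)
      = ((a : ℝ≥0∞) ^ (-ρ) * b * (m : ℝ≥0∞) ^ (1 - ρ)) * ((s : ℝ≥0∞) ^ (1 - ρ)) ^ n := by
    intro n
    have h0 : m * a * s ^ n ≠ 0 := mul_ne_zero (mul_ne_zero hm ha) (pow_ne_zero _ hs)
    rw [← ENNReal.coe_rpow_of_ne_zero h0, ← ENNReal.coe_rpow_of_ne_zero ha,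
      ← ENNReal.coe_rpow_of_ne_zero hm, ← ENNReal.coe_rpow_of_ne_zero hs]
    norm_cast
    rw [NNReal.mul_rpow, NNReal.mul_rpow, sub_eq_add_neg, NNReal.rpow_add hm, NNReal.rpow_add hs,
      NNReal.rpow_one, NNReal.rpow_one, mul_pow]
    have : (s ^ n) ^ (-ρ) = (s ^ (-ρ)) ^ n := by
      rw [← NNReal.rpow_natCast, ← NNReal.rpow_natCast, ← NNReal.rpow_mul, ← NNReal.rpow_mul,
        mul_comm]
    rw [this]
    ring
  calc _ ≤ ∫⁻ t in ⋃ n : ℕ, {t | (↑(m * a * s ^ n) : ℝ≥0∞) ≤ tailIntegral σ t ∧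
      tailIntegral σ t ≤ ↑(m * b * s ^ n)}, tailIntegral σ t ^ (-ρ) * σ t := lintegral_mono_set hA
    _ ≤ ∑' n : ℕ, (↑(m * a * s ^ n) : ℝ≥0∞) ^ (-ρ) * ↑(m * b * s ^ n) :=
      (lintegral_iUnion_le _ _).trans (ENNReal.tsum_le_tsum fun n => hlevel _ _)
    _ = _ := by
      simp_rw [hterm]
      rw [ENNReal.tsum_mul_left, ENNReal.tsum_geometric]
      ring

theorem tailIntegral_rpow_neg_mul_le {σ : ℝ → ℝ≥0∞} (hσ : Measurable σ)
    (hpos : ∀ t, tailIntegral σ t ≠ 0) {δ : ℝ} (hδ0 : 0 < δ) (hδ1 : δ < 1) :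
    ∃ K : ℝ≥0, ∀ x, tailIntegral σ x ≠ ∞ →
      tailIntegral (fun t => tailIntegral σ t ^ (-δ) * σ t) x
        ≤ K * tailIntegral σ x ^ (1 - δ) := by
  have hr : (((1 / 2 : ℝ≥0) : ℝ≥0∞)) ^ (1 - δ) < 1 := by
    rw [← ENNReal.coe_rpow_of_ne_zero (by norm_num)]
    exact_mod_cast NNReal.rpow_lt_one (by norm_num) (by linarith)
  obtain ⟨K, hK⟩ : ∃ K : ℝ≥0, (((1 / 2 : ℝ≥0) : ℝ≥0∞)) ^ (-δ) * ((1 : ℝ≥0) : ℝ≥0∞)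
      * (1 - (((1 / 2 : ℝ≥0) : ℝ≥0∞)) ^ (1 - δ))⁻¹
      = K := by
    refine ⟨_, (ENNReal.coe_toNNReal ?_).symm⟩
    refine ENNReal.mul_ne_top (ENNReal.mul_ne_top ?_ ENNReal.coe_ne_top)
      (ENNReal.inv_ne_top.2 (tsub_pos_of_lt hr).ne')
    rw [← ENNReal.coe_rpow_of_ne_zero (by norm_num)]
    exact ENNReal.coe_ne_top
  refine ⟨K, fun x hx => ?_⟩
  lift tailIntegral σ x to ℝ≥0 using hx with m hm
  have hm0 : m ≠ 0 := by
    intro h; exact hpos x (by rw [← hm, h]; rfl)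
  refine (setLIntegral_rpow_neg_mul_le_of_subset_iUnion hσ hδ0 (a := 1 / 2) (b := 1)
    (s := 1 / 2) (by norm_num) (by norm_num) hm0 ?_).trans
    (mul_le_mul_left hK.le _)
  intro t ht
  have h1 : tailIntegral σ t ≤ m := hm ▸ tailIntegral_antitone σ (le_of_lt ht)
  have h2 := hpos t
  obtain ⟨y, hy⟩ : ∃ y : ℝ≥0, tailIntegral σ t = y :=
    ⟨_, (ENNReal.coe_toNNReal (h1.trans_lt ENNReal.coe_lt_top).ne).symm⟩
  rw [hy] at h1 h2
  have h1' : y ≤ m := by exact_mod_cast h1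
  have h2' : 0 < y := by exact_mod_cast pos_iff_ne_zero.2 h2
  obtain ⟨n, hn1, hn2⟩ := exists_nat_pow_near_of_lt_one (x := y / m) (y := (1 / 2 : ℝ≥0))
    (div_pos h2' (pos_iff_ne_zero.2 hm0)) (div_le_one_of_le₀ h1' zero_le)
    (by norm_num) (by norm_num)
  rw [lt_div_iff₀ (pos_iff_ne_zero.2 hm0)] at hn1
  rw [div_le_iff₀ (pos_iff_ne_zero.2 hm0)] at hn2
  refine mem_iUnion.2 ⟨n, ?_, ?_⟩
  · rw [hy]
    refine ENNReal.coe_le_coe.2 (le_of_eq_of_le ?_ hn1.le)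
    ring
  · rw [hy]
    refine ENNReal.coe_le_coe.2 (hn2.trans_eq ?_)
    ring

theorem setLIntegral_Ioo_rpow_neg_mul_le {σ : ℝ → ℝ≥0∞} (hσ : Measurable σ)
    (hpos : ∀ t, tailIntegral σ t ≠ 0) (hfin : ∀ t > 0, tailIntegral σ t ≠ ∞)
    {β : ℝ} (hβ : 0 < β) :
    ∃ K : ℝ≥0, ∀ x > 0,
      ∫⁻ t in Ioo 0 x, tailIntegral σ t ^ (-(1 + β)) * σ t
        ≤ K * tailIntegral σ x ^ (-β) := by
  have hr : (((2 : ℝ≥0) : ℝ≥0∞)) ^ (1 - (1 + β)) < 1 := by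
    rw [← ENNReal.coe_rpow_of_ne_zero (by norm_num)]
    exact_mod_cast NNReal.rpow_lt_one_of_one_lt_of_neg (by norm_num) (by linarith)
  obtain ⟨K, hK⟩ : ∃ K : ℝ≥0, ((1 : ℝ≥0) : ℝ≥0∞) ^ (-(1 + β)) * ((2 : ℝ≥0) : ℝ≥0∞)
      * (1 - (((2 : ℝ≥0) : ℝ≥0∞)) ^ (1 - (1 + β)))⁻¹
      = K := by
    refine ⟨_, (ENNReal.coe_toNNReal ?_).symm⟩
    refine ENNReal.mul_ne_top (ENNReal.mul_ne_top (by simp) ENNReal.coe_ne_top)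
      (ENNReal.inv_ne_top.2 (tsub_pos_of_lt hr).ne')
  refine ⟨K, fun x hx => ?_⟩
  have hx' := hfin x hx
  have hpx := hpos x
  have hanti : ∀ t ∈ Ioo 0 x, tailIntegral σ x ≤ tailIntegral σ t :=
    fun t ht => tailIntegral_antitone σ ht.2.le
  lift tailIntegral σ x to ℝ≥0 using hx' with m hm
  have hm0 : m ≠ 0 := by simpa using hpx
  have := (setLIntegral_rpow_neg_mul_le_of_subset_iUnion hσ (ρ := 1 + β) (A := Ioo 0 x)
    (by linarith) (a := 1) (b := 2)
    (s := 2) (by norm_num) (by norm_num) hm0 ?_).trans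
    (mul_le_mul_left hK.le _)
  · rwa [show 1 - (1 + β) = -β by ring] at this
  intro t ht
  have h1 := hanti t ht
  obtain ⟨y, hy⟩ : ∃ y : ℝ≥0, tailIntegral σ t = y :=
    ⟨_, (ENNReal.coe_toNNReal (hfin t ht.1)).symm⟩
  rw [hy] at h1
  have h1' : m ≤ y := by exact_mod_cast h1
  obtain ⟨n, hn1, hn2⟩ := exists_nat_pow_near (x := y / m) (y := (2 : ℝ≥0))
    ((one_le_div₀ (pos_iff_ne_zero.2 hm0)).2 h1') (by norm_num)
  rw [le_div_iff₀ (pos_iff_ne_zero.2 hm0)] at hn1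
  rw [div_lt_iff₀ (pos_iff_ne_zero.2 hm0)] at hn2
  refine mem_iUnion.2 ⟨n, ?_, ?_⟩
  · rw [hy]
    refine ENNReal.coe_le_coe.2 (le_of_eq_of_le ?_ hn1)
    ring
  · rw [hy]
    refine ENNReal.coe_le_coe.2 (hn2.le.trans_eq ?_)
    ring

/-- A form of Minkowski's integral inequality. -/
theorem rpow_tailIntegral_le {σ : ℝ → ℝ≥0∞} (hσ : Measurable σ)
    (hpos : ∀ t, tailIntegral σ t ≠ 0) (hfin : ∀ t > 0, tailIntegral σ t ≠ ∞)
    {p : ℝ} (hp : 1 < p) {h : ℝ → ℝ≥0∞} (hh : Measurable h) {x : ℝ} (hx : 0 < x)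
    (hfinh : tailIntegral h x ≠ ∞) :
    tailIntegral h x ^ (1 / p) ≤ tailIntegral
      (fun t => σ t * (∫⁻ s in Ioo 0 t, h s * tailIntegral σ s ^ (-p)) ^ (1 / p)) x := by
  have hV := measurable_tailIntegral σ
  have hpp : p.HolderConjugate (p / (p - 1)) := Real.HolderConjugate.conjExponent hp
  have hp0 : 0 < p := by linarith
  have hq0 : 0 < p / (p - 1) := div_pos hp0 (by linarith)
  set q := p / (p - 1) with hq
  have hsum : 1 / p + 1 / q = 1 := by simpa [one_div] using hpp.inv_add_inv_eq_one
  have hholder : ∀ t, ∫⁻ s in Ioo x t, h s * (tailIntegral σ s)⁻¹ ≤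
      (∫⁻ s in Ioo 0 t, h s * tailIntegral σ s ^ (-p)) ^ (1 / p)
        * tailIntegral h x ^ (1 / q) := by
    intro t
    have h1 := ENNReal.lintegral_mul_le_Lp_mul_Lq (volume.restrict (Ioo x t)) hpp
      (f := fun s => h s ^ (1 / p) * (tailIntegral σ s)⁻¹) (g := fun s => h s ^ (1 / q))
      ((hh.pow_const _).mul hV.inv).aemeasurable (hh.pow_const _).aemeasurable
    have e1 : ∀ s, ((fun s => h s ^ (1 / p) * (tailIntegral σ s)⁻¹) *
        (fun s => h s ^ (1 / q))) s = h s * (tailIntegral σ s)⁻¹ := by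
      intro s
      simp only [Pi.mul_apply]
      rw [mul_right_comm, ← ENNReal.rpow_add_of_nonneg _ _ (by positivity) (by positivity), hsum,
        ENNReal.rpow_one]
    have e2 : ∀ s, (h s ^ (1 / p) * (tailIntegral σ s)⁻¹) ^ p
        = h s * tailIntegral σ s ^ (-p) := by
      intro s
      rw [ENNReal.mul_rpow_of_nonneg _ _ hp0.le, ← ENNReal.rpow_mul, one_div_mul_cancel hp0.ne',
        ENNReal.rpow_one, ENNReal.inv_rpow, ENNReal.rpow_neg]
    have e3 : ∀ s, (h s ^ (1 / q)) ^ q = h s := by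
      intro s
      rw [← ENNReal.rpow_mul, one_div_mul_cancel hq0.ne', ENNReal.rpow_one]
    simp_rw [e1, e2, e3] at h1
    refine h1.trans ?_
    exact mul_le_mul'
      (ENNReal.rpow_le_rpow (lintegral_mono_set (Ioo_subset_Ioo_left hx.le)) (by positivity))
      (ENNReal.rpow_le_rpow (lintegral_mono_set Ioo_subset_Ioi_self) (by positivity))
  set u := fun t => (∫⁻ s in Ioo 0 t, h s * tailIntegral σ s ^ (-p)) ^ (1 / p) with hu
  have humeas : Measurable u := Monotone.measurable fun a b hab => by
    exact ENNReal.rpow_le_rpow (lintegral_mono_set (Ioo_subset_Ioo_right hab)) (by positivity)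
  have key : tailIntegral h x ≤ tailIntegral (fun t => σ t * u t) x
      * tailIntegral h x ^ (1 / q) := by
    calc tailIntegral h x
        = ∫⁻ s in Ioi x, (h s * (tailIntegral σ s)⁻¹) * tailIntegral σ s := by
          refine setLIntegral_congr_fun measurableSet_Ioi fun s hs => ?_
          rw [mul_assoc, ENNReal.inv_mul_cancel (hpos s) (hfin s (hx.trans hs)), mul_one]
      _ = ∫⁻ t in Ioi x, σ t * ∫⁻ s in Ioo x t, h s * (tailIntegral σ s)⁻¹ :=
          (setLIntegral_mul_setLIntegral_Ioo hσ (hh.mul hV.inv) x).symm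
      _ ≤ ∫⁻ t in Ioi x, (σ t * u t) * tailIntegral h x ^ (1 / q) := by
          refine lintegral_mono fun t => ?_
          rw [mul_assoc]
          gcongr
          exact hholder t
      _ = _ := lintegral_mul_const _ (hσ.mul humeas)
  by_cases h0 : tailIntegral h x = 0
  · rw [h0, ENNReal.zero_rpow_of_pos (by positivity)]; exact zero_le
  have h2 : tailIntegral h x ^ (1 / p) * tailIntegral h x ^ (1 / q)
      ≤ tailIntegral (fun t => σ t * u t) x * tailIntegral h x ^ (1 / q) := by
    rwa [← ENNReal.rpow_add _ _ h0 hfinh, hsum, ENNReal.rpow_one]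
  exact (ENNReal.mul_le_mul_iff_left (ENNReal.rpow_pos (pos_iff_ne_zero.2 h0) hfinh).ne'
    (ENNReal.rpow_ne_top_of_nonneg (by positivity) hfinh)).1 h2

/-- With `V` the tail integral of `σ`, the function `V ^ γ ∫_x^∞ φ V ^ β` is dominated by the tail
integral of some `k` whose weighted integral is controlled by that of `φ`. -/
theorem exists_tailIntegral_ge {σ : ℝ → ℝ≥0∞} (hσ : Measurable σ)
    (hpos : ∀ t, tailIntegral σ t ≠ 0) (hfin : ∀ t > 0, tailIntegral σ t ≠ ∞)
    {γ β : ℝ} (hγ0 : 0 < γ) (hγ1 : γ < 1) (hβ : 0 < β) :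
    ∃ K : ℝ≥0, ∀ φ : ℝ → ℝ≥0∞, Measurable φ → ∃ k : ℝ → ℝ≥0∞, Measurable k ∧
      (∀ x > 0, tailIntegral σ x ^ γ * tailIntegral (fun t => φ t * tailIntegral σ t ^ β) x
        ≤ tailIntegral k x) ∧
      ∫⁻ t in Ioi 0, k t * tailIntegral σ t ^ (-(γ + β)) ≤ K * ∫⁻ t in Ioi 0, φ t := by
  obtain ⟨K₁, hK₁⟩ := tailIntegral_rpow_neg_mul_le hσ hpos (δ := 1 - γ) (by linarith) (by linarith)
  obtain ⟨K₂, hK₂⟩ := setLIntegral_Ioo_rpow_neg_mul_le hσ hpos hfin hβ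
  have hV := measurable_tailIntegral σ
  refine ⟨K₁ + K₂, fun φ hφ => ?_⟩
  set V := tailIntegral σ with hVdef
  set a := fun t => V t ^ (-(1 - γ)) * σ t with ha
  set b := fun t => φ t * V t ^ β with hb
  have ham : Measurable a := (hV.pow_const _).mul hσ
  have hbm : Measurable b := hφ.mul (hV.pow_const _)
  refine ⟨fun t => K₁ * (φ t * V t ^ (γ + β)) + a t * tailIntegral b t,
    ((hφ.mul (hV.pow_const _)).const_mul _).add (ham.mul (measurable_tailIntegral b)), ?_, ?_⟩
  · intro x hx
    have hVa : V x ^ γ ≤ tailIntegral a x := by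
      calc V x ^ γ = V x ^ (-(1 - γ)) * V x := by
            conv_rhs => rw [← ENNReal.rpow_one (V x), ← ENNReal.rpow_mul, one_mul,
              ← ENNReal.rpow_add _ _ (hpos x) (hfin x hx)]
            congr 1; ring
        _ = ∫⁻ t in Ioi x, V x ^ (-(1 - γ)) * σ t := (lintegral_const_mul _ hσ).symm
        _ ≤ tailIntegral a x := by
            refine setLIntegral_mono' measurableSet_Ioi fun t ht => ?_
            simp only [ha]
            gcongr ?_ * _
            rw [ENNReal.rpow_neg, ENNReal.rpow_neg]
            exact ENNReal.inv_le_inv.2 (ENNReal.rpow_le_rpow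
              (tailIntegral_antitone σ (le_of_lt ht)) (by linarith))
    have hsplit : ∀ t ∈ Ioi x, tailIntegral a x ≤ (∫⁻ s in Ioo x t, a s) + K₁ * V t ^ γ := by
      intro t ht
      have h1 : tailIntegral a x ≤ (∫⁻ s in Ioo x t, a s) + ∫⁻ s in Ici t, a s := by
        rw [tailIntegral, ← Ioo_union_Ici_eq_Ioi ht]
        exact lintegral_union_le _ _ _
      refine h1.trans ?_
      gcongr
      rw [setLIntegral_congr Ioi_ae_eq_Ici.symm]
      have h2 := hK₁ t (hfin t (hx.trans ht))
      rwa [_root_.sub_sub_cancel] at h2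
    calc V x ^ γ * tailIntegral b x ≤ tailIntegral a x * tailIntegral b x := by gcongr
      _ = ∫⁻ t in Ioi x, tailIntegral a x * b t := (lintegral_const_mul _ hbm).symm
      _ ≤ ∫⁻ t in Ioi x, (K₁ * (φ t * V t ^ (γ + β)) + b t * ∫⁻ s in Ioo x t, a s) := by
          refine setLIntegral_mono' measurableSet_Ioi fun t ht => ?_
          refine (mul_le_mul_left (hsplit t ht) _).trans_eq ?_
          rw [ENNReal.rpow_add _ _ (hpos t) (hfin t (hx.trans ht))]
          simp only [hb]
          ring
      _ = (∫⁻ t in Ioi x, K₁ * (φ t * V t ^ (γ + β)))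
            + ∫⁻ t in Ioi x, b t * ∫⁻ s in Ioo x t, a s :=
          lintegral_add_left ((hφ.mul (hV.pow_const _)).const_mul _) _
      _ = (∫⁻ t in Ioi x, K₁ * (φ t * V t ^ (γ + β)))
            + ∫⁻ t in Ioi x, a t * tailIntegral b t := by
          rw [setLIntegral_mul_setLIntegral_Ioo hbm ham]
      _ = _ := (lintegral_add_left ((hφ.mul (hV.pow_const _)).const_mul _) _).symm
  · have hcm : Measurable fun t => V t ^ (-(1 + β)) * σ t := (hV.pow_const _).mul hσ
    calc _ = ∫⁻ t in Ioi 0, (K₁ * φ t + (V t ^ (-(1 + β)) * σ t) * tailIntegral b t) := by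
          refine setLIntegral_congr_fun measurableSet_Ioi fun t ht => ?_
          have h1 : V t ^ (γ + β) * V t ^ (-(γ + β)) = 1 := by
            rw [← ENNReal.rpow_add _ _ (hpos t) (hfin t ht)]; simp
          have h2 : V t ^ (-(1 - γ)) * V t ^ (-(γ + β)) = V t ^ (-(1 + β)) := by
            rw [← ENNReal.rpow_add _ _ (hpos t) (hfin t ht)]; congr 1; ring
          simp only [ha]
          calc _ = K₁ * φ t * (V t ^ (γ + β) * V t ^ (-(γ + β)))
                + (V t ^ (-(1 - γ)) * V t ^ (-(γ + β))) * σ t * tailIntegral b t := by ring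
            _ = _ := by rw [h1, h2, mul_one]
      _ = (∫⁻ t in Ioi 0, K₁ * φ t)
            + ∫⁻ t in Ioi 0, (V t ^ (-(1 + β)) * σ t) * tailIntegral b t :=
          lintegral_add_left (hφ.const_mul _) _
      _ = K₁ * (∫⁻ t in Ioi 0, φ t)
            + ∫⁻ t in Ioi 0, b t * ∫⁻ s in Ioo 0 t, V s ^ (-(1 + β)) * σ s := by
          rw [lintegral_const_mul _ hφ, setLIntegral_mul_setLIntegral_Ioo hbm hcm]
      _ ≤ K₁ * (∫⁻ t in Ioi 0, φ t) + ∫⁻ t in Ioi 0, K₂ * φ t := by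
          refine add_le_add le_rfl ?_
          refine setLIntegral_mono' measurableSet_Ioi fun t ht => ?_
          calc b t * ∫⁻ s in Ioo 0 t, V s ^ (-(1 + β)) * σ s
              ≤ b t * (K₂ * V t ^ (-β)) := by gcongr; exact hK₂ t ht
            _ = K₂ * φ t * (V t ^ β * V t ^ (-β)) := by simp only [hb]; ring
            _ = K₂ * φ t := by
              rw [← ENNReal.rpow_add _ _ (hpos t) (hfin t ht)]; simp
      _ = _ := by
          rw [lintegral_const_mul _ hφ]; push_cast; ring

/-- Hölder's inequality for tail integrals, with weights `v` and `V ^ β`. -/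
theorem tailIntegral_rpow_le_mul {v : ℝ → ℝ≥0∞} (hv : IsWeight v) {p : ℝ} (hp : 1 < p)
    {V : ℝ → ℝ≥0∞} (hVm : Measurable V) (hpos : ∀ t, V t ≠ 0) (hfin : ∀ t > 0, V t ≠ ∞)
    (β : ℝ) {h : ℝ → ℝ≥0∞} (hh : Measurable h) {x : ℝ} (hx : 0 < x) :
    tailIntegral h x ^ p ≤ tailIntegral (fun t => h t ^ p * v t * V t ^ β) x *
      tailIntegral (fun t => V t ^ (-(β / (p - 1))) * v t ^ (1 - p / (p - 1))) x ^ (p - 1) := by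
  have hpp : p.HolderConjugate (p / (p - 1)) := Real.HolderConjugate.conjExponent hp
  have hp0 : 0 < p := by linarith
  have hp1 : 0 < p - 1 := by linarith
  have h1 := ENNReal.lintegral_mul_le_Lp_mul_Lq (volume.restrict (Ioi x)) hpp
      (f := fun s => h s * v s ^ (1 / p) * V s ^ (β / p))
      (g := fun s => V s ^ (-(β / p)) * v s ^ (-(1 / p)))
      ((hh.mul (hv.1.pow_const _)).mul (hVm.pow_const _)).aemeasurable
      ((hVm.pow_const _).mul (hv.1.pow_const _)).aemeasurable
  have e1 : tailIntegral h x = ∫⁻ s in Ioi x, ((fun s => h s * v s ^ (1 / p) * V s ^ (β / p)) *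
      (fun s => V s ^ (-(β / p)) * v s ^ (-(1 / p)))) s := by
    have hae : ∀ᵐ s ∂volume.restrict (Ioi x), 0 < v s ∧ v s < ∞ :=
      ae_mono (Measure.restrict_mono (Ioi_subset_Ioi hx.le) le_rfl) hv.2
    refine lintegral_congr_ae ?_
    filter_upwards [hae, ae_restrict_mem measurableSet_Ioi] with s hs hsx
    simp only [Pi.mul_apply]
    have h2 : v s ^ (1 / p) * v s ^ (-(1 / p)) = 1 := by
      rw [← ENNReal.rpow_add _ _ hs.1.ne' hs.2.ne]; simp
    have h3 : V s ^ (β / p) * V s ^ (-(β / p)) = 1 := by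
      rw [← ENNReal.rpow_add _ _ (hpos s) (hfin s (hx.trans hsx))]; simp
    calc h s = h s * (v s ^ (1 / p) * v s ^ (-(1 / p))) * (V s ^ (β / p) * V s ^ (-(β / p))) := by
          rw [h2, h3, mul_one, mul_one]
      _ = _ := by ring
  have e2 : ∀ s, (h s * v s ^ (1 / p) * V s ^ (β / p)) ^ p = h s ^ p * v s * V s ^ β := by
    intro s
    rw [ENNReal.mul_rpow_of_nonneg _ _ hp0.le, ENNReal.mul_rpow_of_nonneg _ _ hp0.le,
      ← ENNReal.rpow_mul, ← ENNReal.rpow_mul, one_div_mul_cancel hp0.ne', ENNReal.rpow_one,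
      div_mul_cancel₀ _ hp0.ne']
  have e3 : ∀ s, (V s ^ (-(β / p)) * v s ^ (-(1 / p))) ^ (p / (p - 1))
      = V s ^ (-(β / (p - 1))) * v s ^ (1 - p / (p - 1)) := by
    intro s
    rw [ENNReal.mul_rpow_of_nonneg _ _ (by positivity), ← ENNReal.rpow_mul, ← ENNReal.rpow_mul]
    congr 2 <;> field_simp
    ring
  rw [← e1] at h1
  simp_rw [e2, e3] at h1
  refine (ENNReal.rpow_le_rpow h1 hp0.le).trans_eq ?_
  rw [ENNReal.mul_rpow_of_nonneg _ _ hp0.le, ← ENNReal.rpow_mul, ← ENNReal.rpow_mul,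
    one_div_mul_cancel hp0.ne', ENNReal.rpow_one, tailIntegral, tailIntegral]
  congr 2
  field_simp

theorem Psi_rpow {p : ℝ} (hp : 1 < p) (v : ℝ → ℝ≥0∞) (x : ℝ) :
    Psi p v x ^ (1 - 2 * p)
      = tailIntegral (fun t => v t ^ (1 - p / (p - 1))) x ^ (1 - p) := by
  rw [Psi, ← ENNReal.rpow_mul, tailIntegral]
  congr 1
  have h1 : p - 1 ≠ 0 := by linarith
  have h2 : p / (p - 1) + 1 ≠ 0 := by
    have : 0 < p / (p - 1) := div_pos (by linarith) (by linarith)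
    linarith
  have h3 : p + (p - 1) ≠ 0 := by linarith
  field_simp
  ring

theorem tailIntegral_rpow_weight_ne_zero {v : ℝ → ℝ≥0∞} (hv : IsWeight v) {p : ℝ} (hp : 1 < p)
    (x : ℝ) : tailIntegral (fun t => v t ^ (1 - p / (p - 1))) x ≠ 0 := by
  intro h0
  have hp1 : 0 < p - 1 := by linarith
  have h1 : tailIntegral (fun t => v t ^ (1 - p / (p - 1))) (max x 0) = 0 :=
    le_antisymm (h0 ▸ tailIntegral_antitone _ (le_max_left x 0)) zero_le
  rw [tailIntegral, lintegral_eq_zero_iff (hv.1.pow_const _)] at h1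
  have hae : ∀ᵐ s ∂volume.restrict (Ioi (max x 0)), 0 < v s ∧ v s < ∞ :=
    ae_mono (Measure.restrict_mono (Ioi_subset_Ioi (le_max_right x 0)) le_rfl) hv.2
  have hfalse : ∀ᵐ s ∂volume.restrict (Ioi (max x 0)), False := by
    filter_upwards [h1, hae] with s hs hvs
    exact (ENNReal.rpow_pos hvs.1 hvs.2.ne).ne' hs
  have hnull : volume (Ioi (max x 0)) = 0 := by
    rw [ae_iff] at hfalse
    simpa only [not_false_eq_true, Set.ofPred_true, Measure.restrict_apply_univ] using hfalse
  simp at hnull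

theorem statement7 (p q : ℝ) (hq : 0 < q) (hp : 1 < p)
    (w v : ℝ → ℝ≥0∞) (hw : IsWeight w) (hv : IsWeight v)
    (hvfin : ∀ x ∈ Ioi (0 : ℝ), (∫⁻ t in Ioi x, v t ^ (1 - p / (p - 1))) < ∞) :
    (∃ C : ℝ≥0, 0 < C ∧ ∀ h : ℝ → ℝ≥0∞, Measurable h →
        (∫⁻ x in Ioi (0 : ℝ), (∫⁻ t in Ioi x, h t) ^ q * w x) ^ (1 / q) ≤
          (C : ℝ≥0∞) * (∫⁻ t in Ioi (0 : ℝ), h t ^ p * v t) ^ (1 / p)) ↔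
      (∃ C' : ℝ≥0, 0 < C' ∧ ∀ h : ℝ → ℝ≥0∞, Measurable h →
        (∫⁻ x in Ioi (0 : ℝ), (∫⁻ t in Ioi x, h t) ^ (q / p) * w x) ^ (p / q) ≤
          (C' : ℝ≥0∞) * ∫⁻ t in Ioi (0 : ℝ), h t * Psi p v t ^ (1 - 2 * p)) := by
  have hp0 : 0 < p := by linarith
  have hp1 : 0 < p - 1 := by linarith
  have hpos := tailIntegral_rpow_weight_ne_zero hv hp
  simp_rw [Psi_rpow hp]
  set σ : ℝ → ℝ≥0∞ := fun t => v t ^ (1 - p / (p - 1)) with hσdef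
  have hσ : Measurable σ := hv.1.pow_const _
  have hfin : ∀ t > 0, tailIntegral σ t ≠ ∞ := fun t ht => (hvfin t ht).ne
  have hV := measurable_tailIntegral σ
  constructor
  · rintro ⟨C, hC, hA⟩
    refine ⟨C ^ p, NNReal.rpow_pos hC, fun h hh => ?_⟩
    by_cases hR : ∫⁻ t in Ioi 0, h t * tailIntegral σ t ^ (1 - p) = ∞
    · rw [hR, ENNReal.mul_top (by exact_mod_cast (NNReal.rpow_pos hC).ne')]
      exact le_top
    have hI : ∀ x > 0, tailIntegral h x ≠ ∞ := by
      intro x hx htop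
      apply hR
      have hc : tailIntegral σ x ^ (1 - p) ≠ 0 := by
        simp [ENNReal.rpow_eq_zero_iff, hpos x, hfin x hx]
      rw [← top_le_iff]
      calc ∞ = tailIntegral h x * tailIntegral σ x ^ (1 - p) := by
            rw [htop, ENNReal.top_mul hc]
        _ = ∫⁻ t in Ioi x, h t * tailIntegral σ x ^ (1 - p) := (lintegral_mul_const _ hh).symm
        _ ≤ ∫⁻ t in Ioi x, h t * tailIntegral σ t ^ (1 - p) := by
            refine setLIntegral_mono' measurableSet_Ioi fun t ht => mul_le_mul_right ?_ _
            rw [← neg_sub, ENNReal.rpow_neg, ENNReal.rpow_neg]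
            exact ENNReal.inv_le_inv.2 (ENNReal.rpow_le_rpow
              (tailIntegral_antitone σ (le_of_lt ht)) hp1.le)
        _ ≤ _ := lintegral_mono_set (Ioi_subset_Ioi hx.le)
    set F : ℝ → ℝ≥0∞ := fun t => ∫⁻ s in Ioo 0 t, h s * tailIntegral σ s ^ (-p) with hF
    have hFm : Measurable F :=
      Monotone.measurable fun a b hab => lintegral_mono_set (Ioo_subset_Ioo_right hab)
    have hgm : Measurable fun t => σ t * F t ^ (1 / p) := hσ.mul (hFm.pow_const _)
    have hnorm : ∫⁻ t in Ioi 0, (σ t * F t ^ (1 / p)) ^ p * v t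
        = ∫⁻ t in Ioi 0, h t * tailIntegral σ t ^ (1 - p) := by
      calc _ = ∫⁻ t in Ioi 0, σ t * F t := by
            refine lintegral_congr_ae ?_
            filter_upwards [hv.2] with t ht
            have h1 : σ t ^ p * v t = σ t := by
              simp only [hσdef]
              nth_rewrite 2 [← ENNReal.rpow_one (v t)]
              rw [← ENNReal.rpow_mul, ← ENNReal.rpow_add _ _ ht.1.ne' ht.2.ne]
              congr 1
              field_simp
              ring
            rw [ENNReal.mul_rpow_of_nonneg _ _ hp0.le, ← ENNReal.rpow_mul (F t),
              one_div_mul_cancel hp0.ne', ENNReal.rpow_one, mul_right_comm, h1]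
        _ = ∫⁻ s in Ioi 0, (h s * tailIntegral σ s ^ (-p)) * tailIntegral σ s :=
            setLIntegral_mul_setLIntegral_Ioo hσ (hh.mul (hV.pow_const _)) 0
        _ = _ := by
            refine setLIntegral_congr_fun measurableSet_Ioi fun s hs => ?_
            rw [mul_assoc, sub_eq_neg_add, ENNReal.rpow_add _ _ (hpos s) (hfin s hs),
              ENNReal.rpow_one]
    have hAg := hA _ hgm
    rw [hnorm] at hAg
    calc _ ≤ (∫⁻ x in Ioi 0,
            (∫⁻ t in Ioi x, σ t * F t ^ (1 / p)) ^ q * w x) ^ (p / q) := by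
          refine ENNReal.rpow_le_rpow
            (setLIntegral_mono' measurableSet_Ioi fun x hx => mul_le_mul_left ?_ _) (by positivity)
          rw [← one_div_mul_eq_div, ENNReal.rpow_mul]
          exact ENNReal.rpow_le_rpow (rpow_tailIntegral_le hσ hpos hfin hp hh hx (hI x hx)) hq.le
      _ = ((∫⁻ x in Ioi 0,
            (∫⁻ t in Ioi x, σ t * F t ^ (1 / p)) ^ q * w x) ^ (1 / q)) ^ p := by
          rw [← ENNReal.rpow_mul, one_div_mul_eq_div]
      _ ≤ _ := ENNReal.rpow_le_rpow hAg hp0.le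
      _ = _ := by
          rw [ENNReal.mul_rpow_of_nonneg _ _ hp0.le, ← ENNReal.rpow_mul,
            one_div_mul_cancel hp0.ne', ENNReal.rpow_one, ENNReal.coe_rpow_of_nonneg _ hp0.le]
  · rintro ⟨C, hC, hB⟩
    have hγ0 : 0 < (p - 1) / p := by positivity
    have hγ1 : (p - 1) / p < 1 := (div_lt_one hp0).2 (by linarith)
    obtain ⟨K₁, hK₁⟩ := tailIntegral_rpow_neg_mul_le hσ hpos hγ0 hγ1
    obtain ⟨K₂, hK₂⟩ := exists_tailIntegral_ge hσ hpos hfin hγ0 hγ1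
      (β := (p - 1) ^ 2 / p) (by positivity)
    set β := (p - 1) ^ 2 / p with hβ
    have hβ1 : β / (p - 1) = (p - 1) / p := by rw [hβ]; field_simp
    have hγβ : -((p - 1) / p + β) = 1 - p := by rw [hβ]; field_simp; ring
    set D : ℝ≥0 := K₁ ^ (p - 1) with hD
    refine ⟨(C * (D * K₂)) ^ (1 / p) + 1, by positivity, fun h hh => ?_⟩
    obtain ⟨k, hk, hkge, hkle⟩ := hK₂ (fun t => h t ^ p * v t) ((hh.pow_const _).mul hv.1)
    rw [hγβ] at hkle
    have hpoint : ∀ x > 0, tailIntegral h x ^ p ≤ ∫⁻ t in Ioi x, D * k t := by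
      intro x hx
      rw [lintegral_const_mul _ hk]
      calc tailIntegral h x ^ p
          ≤ tailIntegral (fun t => h t ^ p * v t * tailIntegral σ t ^ β) x *
            tailIntegral (fun t => tailIntegral σ t ^ (-(β / (p - 1))) * σ t) x ^ (p - 1) :=
            tailIntegral_rpow_le_mul hv hp hV hpos hfin β hh hx
        _ ≤ tailIntegral (fun t => h t ^ p * v t * tailIntegral σ t ^ β) x *
            (K₁ * tailIntegral σ x ^ (1 - (p - 1) / p)) ^ (p - 1) := by
            rw [hβ1]
            exact mul_le_mul_right (ENNReal.rpow_le_rpow (hK₁ x (hfin x hx)) hp1.le) _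
        _ = D * (tailIntegral σ x ^ ((p - 1) / p) *
            tailIntegral (fun t => h t ^ p * v t * tailIntegral σ t ^ β) x) := by
            rw [ENNReal.mul_rpow_of_nonneg _ _ hp1.le, ← ENNReal.rpow_mul,
              show (1 - (p - 1) / p) * (p - 1) = (p - 1) / p by field_simp; ring, hD,
              ENNReal.coe_rpow_of_nonneg _ hp1.le]
            ring
        _ ≤ _ := mul_le_mul_right (hkge x hx) _
    calc _ ≤ (∫⁻ x in Ioi 0, (∫⁻ t in Ioi x, D * k t) ^ (q / p) * w x) ^ (1 / q) := by
          refine ENNReal.rpow_le_rpow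
            (setLIntegral_mono' measurableSet_Ioi fun x hx => mul_le_mul_left ?_ _) (by positivity)
          rw [show q = p * (q / p) by field_simp, ENNReal.rpow_mul,
            show p * (q / p) / p = q / p by field_simp]
          exact ENNReal.rpow_le_rpow (hpoint x hx) (by positivity)
      _ = ((∫⁻ x in Ioi 0, (∫⁻ t in Ioi x, D * k t) ^ (q / p) * w x) ^ (p / q)) ^ (1 / p) := by
          rw [← ENNReal.rpow_mul]
          congr 1
          field_simp
      _ ≤ (C * ∫⁻ t in Ioi 0, D * k t * tailIntegral σ t ^ (1 - p)) ^ (1 / p) :=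
          ENNReal.rpow_le_rpow (hB _ (hk.const_mul _)) (by positivity)
      _ ≤ (↑(C * (D * K₂)) * ∫⁻ t in Ioi 0, h t ^ p * v t) ^ (1 / p) := by
          refine ENNReal.rpow_le_rpow ?_ (by positivity)
          simp_rw [mul_assoc (D : ℝ≥0∞)]
          rw [lintegral_const_mul _ (by fun_prop), ENNReal.coe_mul, ENNReal.coe_mul,
            mul_assoc, mul_assoc]
          gcongr
      _ ≤ _ := by
          rw [ENNReal.mul_rpow_of_nonneg _ _ (by positivity),
            ← ENNReal.coe_rpow_of_nonneg _ (by positivity)]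
          gcongr
          exact le_self_add
end
end

section
/- Let 1 < p ≤ q < ∞ and let v, w be weights on (0,∞). Then there exist constants c₁, c₂ > 0 depending only on p and q such that the least constant C ∈ [0,∞] for which (∫₀^∞ (∫₀^x h(t) dt)^q w(x) dx)^{1/q} ≤ C (∫₀^∞ h(t)^p v(t) dt)^{1/p} holds for all h ∈ M⁺(0,∞) satisfies c₁ A ≤ C ≤ c₂ A, where A := sup_{x∈(0,∞)} (∫_x^∞ w(t) dt)^{1/q} (∫₀^x v(t)^{1-p'} dt)^{1/p'}. -/
open MeasureTheory Set ENNReal NNReal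

noncomputable section

namespace HardyWeighted

lemma tsum_rpow_le_rpow_tsum {ι : Type*} (a : ι → ℝ≥0∞) {r : ℝ} (hr : 1 ≤ r) :
    ∑' k, a k ^ r ≤ (∑' k, a k) ^ r := by
  have key : ∀ b : ℝ≥0∞, b ^ r = b * b ^ (r - 1) := fun b => by
    conv_lhs => rw [show r = 1 + (r - 1) by ring]
    rw [ENNReal.rpow_add_of_nonneg _ _ zero_le_one (by linarith), ENNReal.rpow_one]
  rw [key (∑' k, a k), ← ENNReal.tsum_mul_right]
  refine ENNReal.tsum_le_tsum fun k => ?_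
  rw [key]
  exact mul_le_mul_right (ENNReal.rpow_le_rpow (ENNReal.le_tsum k) (by linarith)) _

lemma setLIntegral_ne_zero_of_ae_pos {f : ℝ → ℝ≥0∞} (hf : Measurable f)
    (hpos : ∀ᵐ x ∂mu0, 0 < f x) {s : Set ℝ} (hs : s ⊆ Ioi 0) (hvol : volume s ≠ 0) :
    ∫⁻ x in s, f x ≠ 0 := by
  intro h0
  rw [lintegral_eq_zero_iff hf] at h0
  have h1 : ∀ᵐ x ∂volume.restrict s, 0 < f x :=
    ae_mono (Measure.restrict_mono hs le_rfl) hpos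
  have h2 : ∀ᵐ x ∂volume.restrict s, False := by
    filter_upwards [h0, h1] with x hx hx'
    simp [hx] at hx'
  rw [Filter.eventually_false_iff_eq_bot, ae_eq_bot, Measure.restrict_eq_zero] at h2
  exact hvol h2

lemma exists_setLIntegral_Ioc_eq {h : ℝ → ℝ≥0∞} (hm : Measurable h) {b : ℝ} (hb : 0 < b)
    (hfin : ∫⁻ t in Ioc 0 b, h t ≠ ∞) {y : ℝ≥0∞} (hy0 : y ≠ 0)
    (hy : y ≤ ∫⁻ t in Ioc 0 b, h t) :
    ∃ a, 0 < a ∧ a ≤ b ∧ ∫⁻ t in Ioc 0 a, h t = y := by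
  have hfin' : ∀ x ≤ b, ∫⁻ t in Ioc 0 x, h t ≠ ∞ := fun x hx =>
    ne_top_of_le_ne_top hfin (lintegral_mono_set (Ioc_subset_Ioc_right hx))
  have hint : IntegrableOn (fun t => (h t).toReal) (Icc 0 b) := by
    refine integrable_toReal_of_lintegral_ne_top hm.aemeasurable ?_
    rwa [restrict_Ioc_eq_restrict_Icc] at hfin
  have heq : ∀ x ≤ b, ∫ t in Ioc 0 x, (h t).toReal = (∫⁻ t in Ioc 0 x, h t).toReal :=
    fun x hx => integral_toReal hm.aemeasurable (ae_lt_top hm (hfin' x hx))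
  have hytop : y ≠ ∞ := ne_top_of_le_ne_top hfin hy
  obtain ⟨a, ⟨ha0, hab⟩, ha⟩ : y.toReal ∈
      (fun x => ∫ t in Ioc 0 x, (h t).toReal) '' Icc 0 b := by
    refine intermediate_value_Icc hb.le
      (intervalIntegral.continuousOn_primitive hint) ⟨by simp, ?_⟩
    rw [heq b le_rfl]
    exact ENNReal.toReal_mono hfin hy
  simp only [heq a hab] at ha
  rw [ENNReal.toReal_eq_toReal_iff' (hfin' a hab) hytop] at ha
  refine ⟨a, lt_of_le_of_ne ha0 ?_, hab, ha⟩
  rintro rfl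
  simp at ha
  exact hy0 ha.symm

lemma setLIntegral_le_rpow_mul_rpow {p : ℝ} (hp : 1 < p) {v h : ℝ → ℝ≥0∞} (hv : IsWeight v)
    (hm : Measurable h) {s : Set ℝ} (hs : s ⊆ Ioi 0) :
    ∫⁻ t in s, h t ≤ (∫⁻ t in s, h t ^ p * v t) ^ (1 / p) *
      (∫⁻ t in s, v t ^ (1 - p / (p - 1))) ^ ((p - 1) / p) := by
  have hp0 : 0 < p := by linarith
  have hp1 : p - 1 ≠ 0 := by linarith
  have hconj : p.HolderConjugate (p / (p - 1)) := Real.HolderConjugate.conjExponent hp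
  have hw : ∀ᵐ x ∂volume.restrict s, 0 < v x ∧ v x < ∞ :=
    ae_mono (Measure.restrict_mono hs le_rfl) hv.2
  have hvm := hv.1
  have H := ENNReal.lintegral_mul_le_Lp_mul_Lq (volume.restrict s) hconj
    (f := fun t => h t * v t ^ (1 / p)) (g := fun t => v t ^ (-(1 / p)))
    (by fun_prop) (by fun_prop)
  have e1 : ∫⁻ t in s, ((fun t => h t * v t ^ (1 / p)) * fun t => v t ^ (-(1 / p))) t =
      ∫⁻ t in s, h t := by
    refine lintegral_congr_ae ?_
    filter_upwards [hw] with t ht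
    simp only [Pi.mul_apply]
    rw [mul_assoc, ← ENNReal.rpow_add _ _ ht.1.ne' ht.2.ne]
    simp
  have e2 : ∀ t, (h t * v t ^ (1 / p)) ^ p = h t ^ p * v t := fun t => by
    rw [ENNReal.mul_rpow_of_nonneg _ _ hp0.le, ← ENNReal.rpow_mul,
      one_div_mul_cancel hp0.ne', ENNReal.rpow_one]
  have e3 : ∀ t, (v t ^ (-(1 / p))) ^ (p / (p - 1)) = v t ^ (1 - p / (p - 1)) := fun t => by
    rw [← ENNReal.rpow_mul]
    congr 1
    field_simp
    ring
  rw [e1] at H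
  simpa only [e2, e3, one_div_div] using H

lemma mul_rpow_le_of_hardy {p q : ℝ} (hp : 1 < p) (hq : 0 < q) {v w : ℝ → ℝ≥0∞}
    (hv : IsWeight v) {c : ℝ≥0∞}
    (hc : ∀ h : ℝ → ℝ≥0∞, Measurable h →
      (∫⁻ x in Ioi (0 : ℝ), (∫⁻ t in Ioc (0 : ℝ) x, h t) ^ q * w x) ^ (1 / q) ≤
        c * (∫⁻ t in Ioi (0 : ℝ), h t ^ p * v t) ^ (1 / p)) {x : ℝ} (hx : 0 < x)
    {s : Set ℝ} (hs : MeasurableSet s) (hsx : s ⊆ Ioc 0 x)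
    (hfin : ∫⁻ t in s, v t ^ (1 - p / (p - 1)) ≠ ∞) :
    (∫⁻ t in Ioi x, w t) ^ (1 / q) *
      (∫⁻ t in s, v t ^ (1 - p / (p - 1))) ^ ((p - 1) / p) ≤ c := by
  have hp0 : 0 < p := by linarith
  have hp1 : 0 < p - 1 := by linarith
  have hvm := hv.1
  set σ : ℝ → ℝ≥0∞ := fun t => v t ^ (1 - p / (p - 1)) with hσ
  have hσm : Measurable σ := by fun_prop
  set V := ∫⁻ t in s, σ t with hV
  have hs0 : s ⊆ Ioi 0 := fun t ht => (hsx ht).1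
  rcases eq_or_ne V 0 with h0 | h0
  · rw [h0, ENNReal.zero_rpow_of_pos (by positivity), mul_zero]
    exact zero_le
  have H := hc (s.indicator σ) (hσm.indicator hs)
  have hR : ∫⁻ t in Ioi (0 : ℝ), s.indicator σ t ^ p * v t = V := by
    have : ∀ t, s.indicator σ t ^ p * v t = s.indicator (fun t => σ t ^ p * v t) t := fun t => by
      by_cases ht : t ∈ s <;> simp [ht, hp0]
    simp_rw [this]
    rw [lintegral_indicator hs, Measure.restrict_restrict hs, inter_eq_left.2 hs0]
    refine lintegral_congr_ae ?_
    filter_upwards [ae_mono (Measure.restrict_mono hs0 le_rfl) hv.2] with t ht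
    simp only [hσ]
    rw [← ENNReal.rpow_mul]
    conv_lhs => rw [← ENNReal.rpow_one (v t), ← ENNReal.rpow_mul, one_mul]
    rw [← ENNReal.rpow_add _ _ ht.1.ne' ht.2.ne]
    congr 1
    field_simp
    ring
  have hL : V * (∫⁻ t in Ioi x, w t) ^ (1 / q) ≤
      (∫⁻ y in Ioi (0 : ℝ), (∫⁻ t in Ioc (0 : ℝ) y, s.indicator σ t) ^ q * w y) ^ (1 / q) := by
    calc V * (∫⁻ t in Ioi x, w t) ^ (1 / q)
        = (V ^ q * ∫⁻ t in Ioi x, w t) ^ (1 / q) := by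
          rw [ENNReal.mul_rpow_of_nonneg _ _ (by positivity), ← ENNReal.rpow_mul,
            mul_one_div_cancel hq.ne', ENNReal.rpow_one]
      _ ≤ _ := by
          gcongr
          rw [← lintegral_const_mul' _ _ (ENNReal.rpow_ne_top_of_nonneg hq.le hfin)]
          refine le_trans (setLIntegral_mono' measurableSet_Ioi fun y hy => ?_)
            (lintegral_mono_set (Ioi_subset_Ioi hx.le))
          gcongr
          rw [lintegral_indicator hs, Measure.restrict_restrict hs,
            inter_eq_left.2 (hsx.trans (Ioc_subset_Ioc_right (le_of_lt hy)))]
  rw [hR] at H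
  have hsplit : V = V ^ ((p - 1) / p) * V ^ (1 / p) := by
    rw [← ENNReal.rpow_add _ _ h0 hfin, ← add_div, sub_add_cancel, div_self hp0.ne',
      ENNReal.rpow_one]
  have h3 := hL.trans H
  refine (ENNReal.mul_le_mul_iff_left (c := V ^ (1 / p))
    (by simp [h0, hfin]) (ENNReal.rpow_ne_top_of_nonneg (by positivity) hfin)).1 ?_
  calc (∫⁻ t in Ioi x, w t) ^ (1 / q) * V ^ ((p - 1) / p) * V ^ (1 / p)
      = V ^ ((p - 1) / p) * V ^ (1 / p) * (∫⁻ t in Ioi x, w t) ^ (1 / q) := by ring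
    _ ≤ _ := by rw [← hsplit]; exact h3

lemma muckenhoupt_le_of_hardy {p q : ℝ} (hp : 1 < p) (hq : 0 < q) {v w : ℝ → ℝ≥0∞}
    (hv : IsWeight v) {c : ℝ≥0∞}
    (hc : ∀ h : ℝ → ℝ≥0∞, Measurable h →
      (∫⁻ x in Ioi (0 : ℝ), (∫⁻ t in Ioc (0 : ℝ) x, h t) ^ q * w x) ^ (1 / q) ≤
        c * (∫⁻ t in Ioi (0 : ℝ), h t ^ p * v t) ^ (1 / p)) {x : ℝ} (hx : 0 < x) :
    (∫⁻ t in Ioi x, w t) ^ (1 / q) *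
      (∫⁻ t in Ioc 0 x, v t ^ (1 - p / (p - 1))) ^ ((p - 1) / p) ≤ c := by
  have hp0 : 0 < p := by linarith
  have hp1 : 0 < p - 1 := by linarith
  have hvm := hv.1
  set σ : ℝ → ℝ≥0∞ := fun t => v t ^ (1 - p / (p - 1)) with hσ
  have hσm : Measurable σ := by fun_prop
  set s : ℕ → Set ℝ := fun n => Ioc 0 x ∩ {t | σ t ≤ n} with hs
  have hsm : ∀ n, MeasurableSet (s n) := fun n =>
    measurableSet_Ioc.inter (measurableSet_le hσm measurable_const)
  have hmono : Monotone s := fun m n hmn t ht =>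
    ⟨ht.1, le_trans (show σ t ≤ m from ht.2) (by exact_mod_cast hmn)⟩
  have hU : ∫⁻ t in Ioc 0 x, σ t = ⨆ n, ∫⁻ t in s n, σ t := by
    rw [← setLIntegral_iUnion_of_directed _ hmono.directed_le]
    refine setLIntegral_congr ?_
    have hae : ∀ᵐ t, t ∈ Ioi (0 : ℝ) → 0 < v t ∧ v t < ∞ :=
      (ae_restrict_iff' measurableSet_Ioi).1 hv.2
    filter_upwards [hae] with t ht
    refine propext ⟨fun h => ?_, fun h => ?_⟩
    · have hlt : σ t ≠ ∞ := ENNReal.rpow_ne_top_of_ne_zero (ht h.1).1.ne' (ht h.1).2.ne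
      obtain ⟨n, hn⟩ := ENNReal.exists_nat_gt hlt
      exact mem_iUnion.2 ⟨n, h, hn.le⟩
    · obtain ⟨n, hn⟩ := mem_iUnion.1 h
      exact hn.1
  have hn : ∀ n, ((∫⁻ t in Ioi x, w t) ^ (1 / q)) ^ (p / (p - 1)) * ∫⁻ t in s n, σ t ≤
      c ^ (p / (p - 1)) := fun n => by
    have hfin : ∫⁻ t in s n, σ t ≠ ∞ := by
      refine ne_top_of_le_ne_top ?_ ((setLIntegral_mono measurable_const
        fun t (ht : t ∈ s n) => ht.2).trans (lintegral_mono_set inter_subset_left))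
      simp [ENNReal.mul_eq_top]
    have H := mul_rpow_le_of_hardy hp hq hv hc hx (hsm n) inter_subset_left hfin
    have H' := ENNReal.rpow_le_rpow H (z := p / (p - 1)) (by positivity)
    rwa [ENNReal.mul_rpow_of_nonneg _ _ (by positivity), ← ENNReal.rpow_mul _ ((p - 1) / p),
      div_mul_div_cancel₀ hp0.ne', div_self hp1.ne', ENNReal.rpow_one] at H'
  have hsup := iSup_le hn
  rw [← ENNReal.mul_iSup, ← hU] at hsup
  rw [← ENNReal.rpow_le_rpow_iff (z := p / (p - 1)) (by positivity),
    ENNReal.mul_rpow_of_nonneg _ _ (by positivity), ← ENNReal.rpow_mul _ ((p - 1) / p),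
    div_mul_div_cancel₀ hp0.ne', div_self hp1.ne', ENNReal.rpow_one]
  exact hsup

lemma setLIntegral_Ioc_eq_of_double {h : ℝ → ℝ≥0∞} {a b : ℝ} (ha : 0 < a) {y : ℝ≥0∞}
    (hy : y ≠ ∞) (hFa : ∫⁻ t in Ioc 0 a, h t = y) (hFb : ∫⁻ t in Ioc 0 b, h t = 2 * y)
    (hab : a ≤ b) : ∫⁻ t in Ioc a b, h t = y := by
  have : ∫⁻ t in Ioc 0 b, h t = (∫⁻ t in Ioc 0 a, h t) + ∫⁻ t in Ioc a b, h t := by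
    rw [← Ioc_union_Ioc_eq_Ioc ha.le hab,
      lintegral_union measurableSet_Ioc (Ioc_disjoint_Ioc_of_le le_rfl)]
  rw [hFa, hFb, two_mul] at this
  exact ((ENNReal.add_right_inj hy).1 this).symm

lemma hardy_of_muckenhoupt {p q : ℝ} (hp : 1 < p) (hpq : p ≤ q) {v w : ℝ → ℝ≥0∞}
    (hv : IsWeight v) {A : ℝ≥0∞}
    (hA : ∀ x : ℝ, 0 < x → (∫⁻ t in Ioi x, w t) ^ (1 / q) *
      (∫⁻ t in Ioc (0 : ℝ) x, v t ^ (1 - p / (p - 1))) ^ ((p - 1) / p) ≤ A)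
    {h : ℝ → ℝ≥0∞} (hm : Measurable h) (hfin : ∀ x, 0 < x → ∫⁻ t in Ioc 0 x, h t ≠ ∞) :
    (∫⁻ x in Ioi (0 : ℝ), (∫⁻ t in Ioc (0 : ℝ) x, h t) ^ q * w x) ^ (1 / q) ≤
      4 * A * (∫⁻ t in Ioi (0 : ℝ), h t ^ p * v t) ^ (1 / p) := by
  have hp0 : 0 < p := by linarith
  have hp1 : 0 < p - 1 := by linarith
  have hq : 0 < q := by linarith
  set F : ℝ → ℝ≥0∞ := fun x => ∫⁻ t in Ioc 0 x, h t with hF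
  have hFmono : Monotone F := fun a b hab => lintegral_mono_set (Ioc_subset_Ioc_right hab)
  have hzpow : ∀ k : ℤ, (2 : ℝ≥0∞) ^ k = 2 * 2 ^ (k - 1) := fun k => by
    conv_lhs => rw [show k = 1 + (k - 1) by ring]
    rw [ENNReal.zpow_add (by simp) (by simp), zpow_one]
  have hz0 : ∀ k : ℤ, (2 : ℝ≥0∞) ^ k ≠ 0 := fun k =>
    (ENNReal.zpow_pos (by simp) (by simp) k).ne'
  have hztop : ∀ k : ℤ, (2 : ℝ≥0∞) ^ k ≠ ∞ := fun k =>
    (ENNReal.zpow_lt_top (by simp) (by simp) k).ne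
  have hzlt : ∀ {j k : ℤ}, j < k → (2 : ℝ≥0∞) ^ j < 2 ^ k := fun {j k} hjk => by
    have e : ∀ m : ℤ, (2 : ℝ≥0∞) ^ m = ((2 ^ m : ℝ≥0) : ℝ≥0∞) := fun m => by
      rw [ENNReal.coe_zpow two_ne_zero]; rfl
    rw [e, e, ENNReal.coe_lt_coe]
    exact zpow_lt_zpow_right₀ one_lt_two hjk
  let P : ℤ → Prop := fun k => ∃ b, 0 < b ∧ F b = 2 ^ k
  have hPdown : ∀ {b : ℝ} {k : ℤ}, 0 < b → 2 ^ k ≤ F b → P k := fun {b k} hb hk => by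
    obtain ⟨a, ha, -, hFa⟩ := exists_setLIntegral_Ioc_eq hm hb (hfin b hb) (hz0 k) hk
    exact ⟨a, ha, hFa⟩
  have hPpred : ∀ {k}, P k → P (k - 1) := by
    rintro k ⟨b, hb, hFb⟩
    exact hPdown hb (hFb ▸ (hzlt (sub_one_lt k)).le)
  obtain ⟨x, hx⟩ : ∃ x : ℤ → ℝ, ∀ k, P k → 0 < x k ∧ F (x k) = 2 ^ k := by
    have : ∀ k, ∃ y, P k → 0 < y ∧ F y = 2 ^ k := fun k => by
      by_cases hk : P k
      · exact hk.imp fun b hb _ => hb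
      · exact ⟨0, fun h => (hk h).elim⟩
    exact ⟨_, fun k => (this k).choose_spec⟩
  have hxlt : ∀ {j k}, P j → P k → j < k → x j < x k := fun {j k} hj hk hjk => by
    by_contra! hle
    have := hFmono hle
    rw [(hx j hj).2, (hx k hk).2] at this
    exact absurd (hzlt hjk) this.not_gt
  let D : ℤ → Set ℝ := fun k => {t | P k ∧ t ∈ Ioc (x (k - 1)) (x k)}
  have hDm : ∀ k, MeasurableSet (D k) := fun k =>
    (MeasurableSet.const (P k)).inter measurableSet_Ioc
  have hD_aux : ∀ {j k}, j < k → Disjoint (D j) (D k) := fun {j k} hjk => by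
    rw [Set.disjoint_left]
    rintro t ⟨hj, htj⟩ ⟨hk, htk⟩
    have : x j ≤ x (k - 1) := by
      rcases eq_or_lt_of_le (Int.le_sub_one_of_lt hjk) with h1 | h1
      · rw [h1]
      · exact (hxlt hj (hPpred hk) h1).le
    linarith [htj.2, htk.1]
  have hDdisj : Pairwise (Function.onFun Disjoint D) := fun j k hjk => by
    rcases lt_or_gt_of_ne hjk with h1 | h1
    · exact hD_aux h1
    · exact (hD_aux h1).symm
  have hDsub : ∀ k, D k ⊆ Ioi 0 := by
    rintro k t ⟨hk, ht⟩
    exact (hx _ (hPpred hk)).1.trans ht.1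
  let E : ℤ → Set ℝ := fun k => {y | 0 < y ∧ F y ∈ Ioc ((2 : ℝ≥0∞) ^ k) (2 ^ (k + 1))}
  let a : ℤ → ℝ≥0∞ := fun k => ∫⁻ t in D k, h t ^ p * v t
  have hEm : ∀ k, MeasurableSet (E k) := fun k =>
    measurableSet_Ioi.inter (hFmono.measurable measurableSet_Ioc)
  have hblock : ∀ k, ∫⁻ y in E k, F y ^ q * w y ≤ (4 * A) ^ q * a k ^ (q / p) := fun k => by
    by_cases hk : P k
    · obtain ⟨hxk, hFk⟩ := hx k hk
      obtain ⟨hxk', hFk'⟩ := hx (k - 1) (hPpred hk)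
      have hle : (2 : ℝ≥0∞) ^ (k - 1) ≤ a k ^ (1 / p) *
          (∫⁻ t in Ioc 0 (x k), v t ^ (1 - p / (p - 1))) ^ ((p - 1) / p) := by
        have h1 := setLIntegral_Ioc_eq_of_double hxk' (hztop (k - 1)) hFk'
          (hFk.trans (hzpow k)) (hxlt (hPpred hk) hk (sub_one_lt k)).le
        have hDk : D k = Ioc (x (k - 1)) (x k) := by ext t; simp [D, hk]
        rw [← h1, ← hDk]
        refine (setLIntegral_le_rpow_mul_rpow hp hv hm (hDsub k)).trans ?_
        gcongr
        rw [hDk]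
        exact Ioc_subset_Ioc_left hxk'.le
      have hsub : E k ⊆ Ioi (x k) := fun y hy => by
        by_contra hle
        have := hFmono (not_lt.1 hle)
        rw [hFk] at this
        exact absurd hy.2.1 this.not_gt
      calc ∫⁻ y in E k, F y ^ q * w y
          ≤ ∫⁻ y in E k, ((2 : ℝ≥0∞) ^ (k + 1)) ^ q * w y := by
            refine setLIntegral_mono' (hEm k) fun y hy => ?_
            gcongr
            exact hy.2.2
        _ = ((2 : ℝ≥0∞) ^ (k + 1)) ^ q * ∫⁻ y in E k, w y :=
            lintegral_const_mul' _ _ (ENNReal.rpow_ne_top_of_nonneg hq.le (hztop _))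
        _ ≤ ((2 : ℝ≥0∞) ^ (k + 1)) ^ q * ∫⁻ y in Ioi (x k), w y := by gcongr
        _ = (4 * (2 ^ (k - 1) * (∫⁻ y in Ioi (x k), w y) ^ (1 / q))) ^ q := by
            rw [hzpow (k + 1), add_sub_cancel_right, hzpow k, ← mul_assoc, ← mul_assoc,
              show (2 : ℝ≥0∞) * 2 = 4 by norm_num, ENNReal.mul_rpow_of_nonneg (4 * _) _ hq.le,
              ← ENNReal.rpow_mul, one_div_mul_cancel hq.ne', ENNReal.rpow_one]
        _ ≤ (4 * (a k ^ (1 / p) * A)) ^ q := by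
            refine ENNReal.rpow_le_rpow (mul_le_mul_right ?_ 4) hq.le
            calc _ ≤ a k ^ (1 / p) *
                  (∫⁻ t in Ioc 0 (x k), v t ^ (1 - p / (p - 1))) ^ ((p - 1) / p) *
                    (∫⁻ y in Ioi (x k), w y) ^ (1 / q) := mul_le_mul_left hle _
              _ ≤ a k ^ (1 / p) * A := by
                rw [mul_assoc, mul_comm (_ ^ ((p - 1) / p))]
                gcongr
                exact hA _ hxk
        _ = (4 * A) ^ q * a k ^ (q / p) := by
            rw [show 4 * (a k ^ (1 / p) * A) = 4 * A * a k ^ (1 / p) by ring,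
              ENNReal.mul_rpow_of_nonneg _ _ hq.le, ← ENNReal.rpow_mul, one_div_mul_eq_div]
    · have : E k = ∅ := by
        refine eq_empty_of_forall_notMem fun y hy => hk (hPdown hy.1 hy.2.1.le)
      simp [this]
  have hcover : ∫⁻ y in Ioi (0 : ℝ), F y ^ q * w y ≤ ∑' k, ∫⁻ y in E k, F y ^ q * w y := by
    have hsub : Ioi (0 : ℝ) ⊆ (Ioi 0 ∩ {y | F y = 0}) ∪ ⋃ k, E k := fun y hy => by
      by_cases h0 : F y = 0
      · exact Or.inl ⟨hy, h0⟩
      · obtain ⟨k, hk⟩ := ENNReal.exists_mem_Ioc_zpow h0 (hfin y hy) one_lt_two (by simp)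
        exact Or.inr (mem_iUnion.2 ⟨k, hy, hk⟩)
    refine (lintegral_mono_set hsub).trans ((lintegral_union_le _ _ _).trans ?_)
    have hz : ∫⁻ y in Ioi (0 : ℝ) ∩ {y | F y = 0}, F y ^ q * w y = 0 := by
      refine setLIntegral_eq_zero
        (measurableSet_Ioi.inter (hFmono.measurable (measurableSet_singleton 0))) fun y hy => ?_
      have : F y = 0 := hy.2
      simp [this, hq]
    rw [hz, zero_add]
    exact lintegral_iUnion_le _ _
  have hsum : ∑' k, a k ≤ ∫⁻ t in Ioi (0 : ℝ), h t ^ p * v t := by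
    rw [← lintegral_iUnion hDm hDdisj]
    exact lintegral_mono_set (iUnion_subset hDsub)
  calc (∫⁻ y in Ioi (0 : ℝ), F y ^ q * w y) ^ (1 / q)
      ≤ ((4 * A) ^ q * (∫⁻ t in Ioi (0 : ℝ), h t ^ p * v t) ^ (q / p)) ^ (1 / q) := by
        gcongr
        refine hcover.trans ((ENNReal.tsum_le_tsum hblock).trans ?_)
        rw [ENNReal.tsum_mul_left]
        gcongr
        exact (tsum_rpow_le_rpow_tsum a ((one_le_div hp0).2 hpq)).trans (by gcongr)
    _ = _ := by
        rw [ENNReal.mul_rpow_of_nonneg _ _ (by positivity), ← ENNReal.rpow_mul,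
          ← ENNReal.rpow_mul, mul_one_div_cancel hq.ne', ENNReal.rpow_one]
        congr 2
        field_simp

end HardyWeighted

open HardyWeighted

theorem statement8 (p q : ℝ) (hp : 1 < p) (hpq : p ≤ q) :
    ∃ c₁ c₂ : ℝ≥0, 0 < c₁ ∧ 0 < c₂ ∧
      ∀ v w : ℝ → ℝ≥0∞, IsWeight v → IsWeight w →
        let A : ℝ≥0∞ := ⨆ x ∈ Ioi (0 : ℝ),
          (∫⁻ t in Ioi x, w t) ^ (1 / q) *
            (∫⁻ t in Ioc (0 : ℝ) x, v t ^ (1 - p / (p - 1))) ^ ((p - 1) / p)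
        let C : ℝ≥0∞ := sInf {c : ℝ≥0∞ | ∀ h : ℝ → ℝ≥0∞, Measurable h →
          (∫⁻ x in Ioi (0 : ℝ), (∫⁻ t in Ioc (0 : ℝ) x, h t) ^ q * w x) ^ (1 / q) ≤
            c * (∫⁻ t in Ioi (0 : ℝ), h t ^ p * v t) ^ (1 / p)}
        (c₁ : ℝ≥0∞) * A ≤ C ∧ C ≤ (c₂ : ℝ≥0∞) * A := by
  have hp0 : 0 < p := by linarith
  have hp1 : 0 < p - 1 := by linarith
  have hq : 0 < q := by linarith
  refine ⟨1, 4, one_pos, by norm_num, fun v w hv hw => ?_⟩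
  intro A C
  have hA : ∀ x : ℝ, 0 < x → (∫⁻ t in Ioi x, w t) ^ (1 / q) *
      (∫⁻ t in Ioc (0 : ℝ) x, v t ^ (1 - p / (p - 1))) ^ ((p - 1) / p) ≤ A := fun x hx =>
    le_iSup₂_of_le x hx le_rfl
  have hW0 : ∀ x : ℝ, 0 < x → ∫⁻ t in Ioi x, w t ≠ 0 := fun x hx =>
    setLIntegral_ne_zero_of_ae_pos hw.1 (hw.2.mono fun _ h => h.1)
      (Ioi_subset_Ioi hx.le) (by simp)
  have hV0 : ∀ x : ℝ, 0 < x → ∫⁻ t in Ioc (0 : ℝ) x, v t ^ (1 - p / (p - 1)) ≠ 0 :=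
    fun x hx => setLIntegral_ne_zero_of_ae_pos (hv.1.pow_const _)
      (hv.2.mono fun _ h => ENNReal.rpow_pos h.1 h.2.ne) Ioc_subset_Ioi_self (by simp [hx])
  have hA0 : A ≠ 0 := fun h0 => by
    have h1 := hA 1 one_pos
    rw [h0, nonpos_iff_eq_zero, mul_eq_zero, ENNReal.rpow_eq_zero_iff_of_pos (by positivity),
      ENNReal.rpow_eq_zero_iff_of_pos (by positivity)] at h1
    exact h1.elim (hW0 1 one_pos) (hV0 1 one_pos)
  constructor
  · rw [ENNReal.coe_one, one_mul]
    exact le_sInf fun c hc => iSup₂_le fun x hx => muckenhoupt_le_of_hardy hp hq hv hc hx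
  · rcases eq_or_ne A ∞ with hAtop | hAtop
    · simp [hAtop, ENNReal.mul_top]
    refine sInf_le fun h hm => ?_
    rcases eq_or_ne (∫⁻ t in Ioi (0 : ℝ), h t ^ p * v t) ∞ with hH | hH
    · rw [hH, ENNReal.top_rpow_of_pos (by positivity), ENNReal.mul_top (by simp [hA0])]
      exact le_top
    refine hardy_of_muckenhoupt hp hpq hv hA hm fun x hx => ?_
    refine ne_top_of_le_ne_top (ENNReal.mul_ne_top ?_ ?_)
      (setLIntegral_le_rpow_mul_rpow hp hv hm Ioc_subset_Ioi_self)
    · exact ENNReal.rpow_ne_top_of_nonneg (by positivity)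
        (ne_top_of_le_ne_top hH (lintegral_mono_set Ioc_subset_Ioi_self))
    · intro htop
      refine hAtop (top_unique ?_)
      have h1 := hA x hx
      rwa [htop, ENNReal.mul_top (by
        rw [Ne, ENNReal.rpow_eq_zero_iff_of_pos (by positivity)]; exact hW0 x hx)] at h1
end
end

section
/- Let 1 < p < ∞, 0 < q < p, and let v, w be weights on (0,∞). Then there exist constants c₁, c₂ > 0 depending only on p and q such that the least constant C ∈ [0,∞] for which (∫₀^∞ (∫_x^∞ h(t) dt)^q w(x) dx)^{1/q} ≤ C (∫₀^∞ h(t)^p v(t) dt)^{1/p} holds for all h ∈ M⁺(0,∞) satisfies c₁ B ≤ C ≤ c₂ B, where B := (∫₀^∞ (∫₀^x w(t) dt)^{q/(p-q)} w(x) (∫_x^∞ v(t)^{1-p'} dt)^{q(p-1)/(p-q)} dx)^{(p-q)/(pq)}. -/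
open MeasureTheory Set ENNReal NNReal

noncomputable section

lemma two_rpow_add (a b : ℝ) : (2 : ℝ≥0∞) ^ (a + b) = 2 ^ a * 2 ^ b :=
  ENNReal.rpow_add a b (by norm_num) (by norm_num)

lemma two_rpow_ne_zero (a : ℝ) : (2 : ℝ≥0∞) ^ a ≠ 0 := by simp

lemma two_rpow_ne_top (a : ℝ) : (2 : ℝ≥0∞) ^ a ≠ ∞ := by simp

lemma tsum_two_rpow_lt_top {a : ℝ} (ha : 0 < a) :
    ∑' i : ℕ, (2 : ℝ≥0∞) ^ (-(a * i)) < ∞ := by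
  have h : ∀ i : ℕ, (2 : ℝ≥0∞) ^ (-(a * i)) = ((2 : ℝ≥0∞) ^ (-a)) ^ i := fun i => by
    rw [← ENNReal.rpow_natCast, ← ENNReal.rpow_mul, neg_mul]
  simp_rw [h]
  rw [ENNReal.tsum_geometric, ENNReal.inv_lt_top, tsub_pos_iff_lt]
  exact ENNReal.rpow_lt_one_of_one_lt_of_neg (by norm_num) (by linarith)

/-- A power of a sum is controlled by a geometrically weighted sum of powers. -/
lemma rpow_tsum_le {θ a : ℝ} (hθ : 0 < θ) (g : ℕ → ℝ≥0∞) :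
    (∑' i, g i) ^ θ ≤ (∑' i : ℕ, (2 : ℝ≥0∞) ^ (-(a / θ * i))) ^ θ *
      ∑' i : ℕ, (2 : ℝ≥0∞) ^ (a * i) * g i ^ θ := by
  set M := ∑' i : ℕ, (2 : ℝ≥0∞) ^ (a * i) * g i ^ θ
  have h : ∀ i, g i ≤ (2 : ℝ≥0∞) ^ (-(a / θ * i)) * M ^ θ⁻¹ := fun i => by
    rw [← ENNReal.rpow_le_rpow_iff hθ, ENNReal.mul_rpow_of_nonneg _ _ hθ.le,
      ENNReal.rpow_inv_rpow hθ.ne', ← ENNReal.rpow_mul,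
      show -(a / θ * i) * θ = -(a * i) by field_simp, ENNReal.rpow_neg,
      ← ENNReal.mul_le_iff_le_inv (two_rpow_ne_zero _) (two_rpow_ne_top _)]
    exact ENNReal.le_tsum i
  calc (∑' i, g i) ^ θ ≤ ((∑' i : ℕ, (2 : ℝ≥0∞) ^ (-(a / θ * i))) * M ^ θ⁻¹) ^ θ := by
        rw [← ENNReal.tsum_mul_right]
        gcongr with i
        exact h i
    _ = _ := by rw [ENNReal.mul_rpow_of_nonneg _ _ hθ.le, ENNReal.rpow_inv_rpow hθ.ne']

/-- Discrete Hardy inequality with geometric weights, valid for every positive exponent. -/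
lemma exists_tsum_two_rpow_mul_rpow_tsum_le {s θ : ℝ} (hs : 0 < s) (hθ : 0 < θ) :
    ∃ K : ℝ≥0, 0 < K ∧ ∀ g : ℤ → ℝ≥0∞,
      ∑' k : ℤ, (2 : ℝ≥0∞) ^ (s * k) * (∑' i : ℕ, g (k + i)) ^ θ ≤
        K * ∑' k : ℤ, (2 : ℝ≥0∞) ^ (s * k) * g k ^ θ := by
  set A := (∑' i : ℕ, (2 : ℝ≥0∞) ^ (-(s / 2 / θ * i))) ^ θ with hA
  set D := ∑' i : ℕ, (2 : ℝ≥0∞) ^ (-(s / 2 * i)) with hD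
  have hAt : A ≠ ∞ :=
    ENNReal.rpow_ne_top_of_nonneg hθ.le (tsum_two_rpow_lt_top (by positivity)).ne
  have hDt : D ≠ ∞ := (tsum_two_rpow_lt_top (by positivity)).ne
  refine ⟨(A * D).toNNReal + 1, by positivity, fun g => ?_⟩
  set T := ∑' k : ℤ, (2 : ℝ≥0∞) ^ (s * k) * g k ^ θ with hT
  have hshift : ∀ i : ℕ, ∑' k : ℤ, (2 : ℝ≥0∞) ^ (s * k) *
      ((2 : ℝ≥0∞) ^ (s / 2 * i) * g (k + i) ^ θ) = 2 ^ (-(s / 2 * i)) * T := fun i => by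
    rw [hT, ← (Equiv.addRight (i : ℤ)).tsum_eq (fun k : ℤ => (2 : ℝ≥0∞) ^ (s * k) * g k ^ θ),
      ← ENNReal.tsum_mul_left]
    refine tsum_congr fun k => ?_
    rw [← mul_assoc, ← mul_assoc, ← two_rpow_add, ← two_rpow_add]
    simp only [Equiv.coe_addRight]
    congr 2
    push_cast
    ring
  calc ∑' k : ℤ, (2 : ℝ≥0∞) ^ (s * k) * (∑' i : ℕ, g (k + i)) ^ θ
      ≤ ∑' k : ℤ, (2 : ℝ≥0∞) ^ (s * k) *
          (A * ∑' i : ℕ, (2 : ℝ≥0∞) ^ (s / 2 * i) * g (k + i) ^ θ) := by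
        gcongr with k
        exact rpow_tsum_le hθ fun i => g (k + i)
    _ = A * ∑' k : ℤ, ∑' i : ℕ, (2 : ℝ≥0∞) ^ (s * k) *
          ((2 : ℝ≥0∞) ^ (s / 2 * i) * g (k + i) ^ θ) := by
        rw [← ENNReal.tsum_mul_left]
        refine tsum_congr fun k => ?_
        rw [ENNReal.tsum_mul_left]
        ring
    _ = A * D * T := by
        rw [ENNReal.tsum_comm]
        simp_rw [hshift]
        rw [ENNReal.tsum_mul_right, mul_assoc]
    _ ≤ _ := by
        gcongr
        push_cast
        rw [ENNReal.coe_toNNReal (ENNReal.mul_ne_top hAt hDt)]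
        exact le_self_add

/-- The primitive of `w` vanishing at `0`. -/
def primitive (w : ℝ → ℝ≥0∞) (x : ℝ) : ℝ≥0∞ := ∫⁻ t in Ioc (0 : ℝ) x, w t

/-- The dyadic level sets of the primitive of `w`. -/
def level (w : ℝ → ℝ≥0∞) (k : ℤ) : Set ℝ :=
  {x | 0 < x ∧ (2 : ℝ≥0∞) ^ (k : ℝ) ≤ primitive w x ∧ primitive w x < (2 : ℝ≥0∞) ^ ((k : ℝ) + 1)}

section Levels

variable {w : ℝ → ℝ≥0∞}

lemma primitive_mono : Monotone (primitive w) := fun _ _ h =>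
  lintegral_mono_set (Ioc_subset_Ioc_right h)

lemma primitive_add {x y : ℝ} (hx : 0 ≤ x) (hxy : x ≤ y) :
    primitive w y = primitive w x + ∫⁻ t in Ioc x y, w t := by
  rw [primitive, primitive, ← lintegral_union measurableSet_Ioc (Ioc_disjoint_Ioc_of_le le_rfl),
    Ioc_union_Ioc_eq_Ioc hx hxy]

lemma measurableSet_level (k : ℤ) : MeasurableSet (level w k) := by
  have h := (primitive_mono (w := w)).measurable
  exact measurableSet_Ioi.inter ((h measurableSet_Ici).inter (h measurableSet_Iio))

lemma level_subset (k : ℤ) : level w k ⊆ Ioi 0 := fun _ h => h.1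

lemma lt_of_mem_level {j k : ℤ} (hjk : j < k) {x y : ℝ} (hx : x ∈ level w j)
    (hy : y ∈ level w k) : x < y := by
  by_contra! hyx
  have h1 : (2 : ℝ≥0∞) ^ ((j : ℝ) + 1) ≤ 2 ^ (k : ℝ) :=
    ENNReal.rpow_le_rpow_of_exponent_le (by norm_num) (by exact_mod_cast hjk)
  exact absurd ((hy.2.1.trans (primitive_mono hyx)).trans_lt hx.2.2) (not_lt.2 h1)

lemma pairwise_disjoint_level : Pairwise (Function.onFun Disjoint (level w)) := by
  intro j k hjk
  refine Set.disjoint_left.2 fun x hj hk => ?_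
  rcases hjk.lt_or_gt with h | h
  · exact lt_irrefl _ (lt_of_mem_level h hj hk)
  · exact lt_irrefl _ (lt_of_mem_level h hk hj)

lemma primitive_lt_primitive (hw : Measurable w) (hpos : ∀ᵐ x ∂mu0, 0 < w x)
    (hfin : ∀ x, primitive w x < ∞) {x y : ℝ} (hx : 0 ≤ x) (hxy : x < y) :
    primitive w x < primitive w y := by
  rw [primitive_add hx hxy.le]
  refine ENNReal.lt_add_right (hfin x).ne ?_
  rw [← pos_iff_ne_zero, setLIntegral_pos_iff hw]
  have h0 : ∀ᵐ t, t ∈ Ioi (0 : ℝ) → 0 < w t := (ae_restrict_iff' measurableSet_Ioi).1 hpos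
  have h1 : (Function.support w ∩ Ioc x y : Set ℝ) =ᵐ[volume] Ioc x y := by
    filter_upwards [h0] with t ht
    refine propext ⟨fun h => h.2, fun h => ⟨(ht (hx.trans_lt h.1)).ne', h⟩⟩
  rw [measure_congr h1]
  simpa using hxy

lemma iUnion_level (hw : Measurable w) (hpos : ∀ᵐ x ∂mu0, 0 < w x)
    (hfin : ∀ x, primitive w x < ∞) : ⋃ k, level w k = Ioi 0 := by
  refine subset_antisymm (iUnion_subset level_subset) fun x hx => ?_
  obtain ⟨n, hn⟩ := ENNReal.exists_mem_Ico_zpow (x := primitive w x) (y := 2)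
    (bot_lt_of_lt (primitive_lt_primitive hw hpos hfin le_rfl hx)).ne' (hfin x).ne
    (by norm_num) (by norm_num)
  refine mem_iUnion.2 ⟨n, hx, ?_, ?_⟩
  · rw [ENNReal.rpow_intCast]
    exact hn.1
  · have := hn.2
    rw [← ENNReal.rpow_intCast] at this
    simpa using this

lemma exists_primitive_eq (hw : Measurable w) (hfin : ∀ x, primitive w x < ∞) {y : ℝ} (hy : 0 ≤ y)
    {s : ℝ≥0∞} (hs : s ≤ primitive w y) : ∃ x, 0 ≤ x ∧ x ≤ y ∧ primitive w x = s := by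
  have hint : IntegrableOn (fun t => (w t).toReal) (Icc 0 y) := by
    rw [integrableOn_Icc_iff_integrableOn_Ioc]
    exact integrable_toReal_of_lintegral_ne_top hw.aemeasurable (hfin y).ne
  have heq : ∀ x, ∫ t in Ioc 0 x, (w t).toReal = (primitive w x).toReal := fun x =>
    integral_toReal hw.aemeasurable (ae_lt_top hw (hfin x).ne)
  have hcont := intervalIntegral.continuousOn_primitive hint
  simp_rw [heq] at hcont
  have hst : s ≠ ∞ := (hs.trans_lt (hfin y)).ne
  obtain ⟨x, hx, hxs⟩ := intermediate_value_Icc hy hcont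
    (show s.toReal ∈ _ from ⟨by simp [primitive], ENNReal.toReal_mono (hfin y).ne hs⟩)
  exact ⟨x, hx.1, hx.2, (ENNReal.toReal_eq_toReal_iff' (hfin x).ne hst).1 hxs⟩

lemma lintegral_level_le (hw : Measurable w) (hfin : ∀ x, primitive w x < ∞) (k : ℤ) :
    ∫⁻ t in level w k, w t ≤ 2 ^ ((k : ℝ) + 1) := by
  by_cases h : ∃ y, 0 ≤ y ∧ (2 : ℝ≥0∞) ^ ((k : ℝ) + 1) ≤ primitive w y
  · obtain ⟨y, hy, hky⟩ := h
    obtain ⟨x, hx, -, hxk⟩ := exists_primitive_eq hw hfin hy hky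
    rw [← hxk]
    refine lintegral_mono_set fun t ht => ⟨ht.1, le_of_not_gt fun hxt => ?_⟩
    exact absurd (hxk ▸ primitive_mono hxt.le) (not_le.2 ht.2.2)
  · push Not at h
    have hU : Ioi (0 : ℝ) = ⋃ n : ℕ, Ioc (0 : ℝ) n := by
      ext t
      simp only [mem_Ioi, mem_iUnion, mem_Ioc]
      exact ⟨fun ht => (exists_nat_ge t).imp fun n hn => ⟨ht, hn⟩, fun ⟨_, ht⟩ => ht.1⟩
    calc ∫⁻ t in level w k, w t ≤ ∫⁻ t in Ioi 0, w t := lintegral_mono_set (level_subset k)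
      _ = ⨆ n : ℕ, primitive w n := by
        rw [hU, setLIntegral_iUnion_of_directed]
        · rfl
        · exact Monotone.directed_le fun m n hmn => Ioc_subset_Ioc_right (by exact_mod_cast hmn)
      _ ≤ _ := iSup_le fun n => (h n n.cast_nonneg).le

lemma le_lintegral_level (hw : Measurable w) (hpos : ∀ᵐ x ∂mu0, 0 < w x)
    (hfin : ∀ x, primitive w x < ∞) {k : ℤ} (hk : (level w k).Nonempty) :
    2 ^ ((k : ℝ) - 1) ≤ ∫⁻ t in level w (k - 1), w t := by
  obtain ⟨y, hy0, hky, -⟩ := hk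
  obtain ⟨x₁, hx₁, -, h₁⟩ := exists_primitive_eq hw hfin hy0.le hky
  have hle : (2 : ℝ≥0∞) ^ ((k : ℝ) - 1) ≤ 2 ^ (k : ℝ) :=
    ENNReal.rpow_le_rpow_of_exponent_le (by norm_num) (by linarith)
  obtain ⟨x₀, hx₀, hx₀₁, h₀⟩ := exists_primitive_eq hw hfin hx₁ (hle.trans h₁.ge)
  have hx₀' : 0 < x₀ := by
    refine hx₀.lt_of_ne fun h => two_rpow_ne_zero ((k : ℝ) - 1) ?_
    rw [← h₀, ← h]
    simp [primitive]
  have hsub : Ico x₀ x₁ ⊆ level w (k - 1) := fun t ht => by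
    refine ⟨hx₀'.trans_le ht.1, ?_, ?_⟩
    · push_cast
      exact h₀ ▸ primitive_mono ht.1
    · push_cast
      rw [sub_add_cancel, ← h₁]
      exact primitive_lt_primitive hw hpos hfin (hx₀.trans ht.1) ht.2
  refine le_trans (le_of_eq ?_) (lintegral_mono_set hsub)
  rw [restrict_Ico_eq_restrict_Ioc]
  have h2 := primitive_add (w := w) hx₀ hx₀₁
  have h3 : (2 : ℝ≥0∞) ^ (k : ℝ) = 2 ^ ((k : ℝ) - 1) + 2 ^ ((k : ℝ) - 1) := by
    conv_lhs => rw [← sub_add_cancel (k : ℝ) 1, two_rpow_add, ENNReal.rpow_one]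
    ring
  rw [h₀, h₁, h3] at h2
  exact (ENNReal.add_right_inj (two_rpow_ne_top _)).1 h2

lemma lintegral_Ioi_eq_tsum_level (hw : Measurable w) (hpos : ∀ᵐ x ∂mu0, 0 < w x)
    (hfin : ∀ x, primitive w x < ∞) (f : ℝ → ℝ≥0∞) :
    ∫⁻ t in Ioi 0, f t = ∑' k, ∫⁻ t in level w k, f t := by
  rw [← iUnion_level hw hpos hfin, lintegral_iUnion measurableSet_level pairwise_disjoint_level]

lemma lintegral_Ioi_le_tsum_level (hw : Measurable w) (hpos : ∀ᵐ x ∂mu0, 0 < w x)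
    (hfin : ∀ x, primitive w x < ∞) (f : ℝ → ℝ≥0∞) {k : ℤ} {x : ℝ} (hx : x ∈ level w k) :
    ∫⁻ t in Ioi x, f t ≤ ∑' i : ℕ, ∫⁻ t in level w (k + i), f t := by
  refine le_trans (lintegral_mono_set fun t ht => ?_) (lintegral_iUnion_le _ _)
  have ht0 : t ∈ Ioi (0 : ℝ) := hx.1.trans ht
  rw [← iUnion_level hw hpos hfin] at ht0
  obtain ⟨j, hj⟩ := mem_iUnion.1 ht0
  have hkj : k ≤ j := le_of_not_gt fun h => lt_asymm ht (lt_of_mem_level h hj hx)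
  exact mem_iUnion.2 ⟨(j - k).toNat, by rwa [Int.toNat_of_nonneg (by omega), add_sub_cancel]⟩

lemma lintegral_level_le_Ioi (f : ℝ → ℝ≥0∞) {k : ℤ} {x : ℝ} (hx : x ∈ level w (k - 1)) :
    ∫⁻ t in level w k, f t ≤ ∫⁻ t in Ioi x, f t :=
  lintegral_mono_set fun _ ht => lt_of_mem_level (by omega) hx ht

end Levels

lemma tsum_mul_le_Lp_mul_Lq {ι : Type*} {a b : ℝ} (hab : a.HolderConjugate b) (f g : ι → ℝ≥0∞) :
    ∑' i, f i * g i ≤ (∑' i, f i ^ a) ^ (1 / a) * (∑' i, g i ^ b) ^ (1 / b) := by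
  let _ : MeasurableSpace ι := ⊤
  simpa [lintegral_count] using ENNReal.lintegral_mul_le_Lp_mul_Lq Measure.count hab
    (f := f) (g := g) measurable_from_top.aemeasurable measurable_from_top.aemeasurable

/-- Hölder's inequality against a weight and its dual weight. -/
lemma lintegral_le_weighted {p : ℝ} (hp : 1 < p) {μ : Measure ℝ} {v h : ℝ → ℝ≥0∞}
    (hv : Measurable v) (hv' : ∀ᵐ x ∂μ, 0 < v x ∧ v x < ∞) (hh : Measurable h) :
    ∫⁻ t, h t ∂μ ≤ (∫⁻ t, h t ^ p * v t ∂μ) ^ (1 / p) *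
      (∫⁻ t, v t ^ (1 - p / (p - 1)) ∂μ) ^ ((p - 1) / p) := by
  have hp0 : 0 < p := by linarith
  have hp1 : 0 < p - 1 := by linarith
  have key := ENNReal.lintegral_mul_le_Lp_mul_Lq μ (Real.HolderConjugate.conjExponent hp)
    (f := fun t => h t * v t ^ (1 / p)) (g := fun t => v t ^ (-(1 / p)))
    (hh.mul (hv.pow_const _)).aemeasurable (hv.pow_const _).aemeasurable
  have e1 : ∫⁻ t, h t ∂μ =
      ∫⁻ t, ((fun t => h t * v t ^ (1 / p)) * fun t => v t ^ (-(1 / p))) t ∂μ := by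
    refine lintegral_congr_ae ?_
    filter_upwards [hv'] with t ht
    simp only [Pi.mul_apply]
    rw [mul_assoc, ← ENNReal.rpow_add _ _ ht.1.ne' ht.2.ne]
    simp
  rw [e1]
  refine key.trans (le_of_eq ?_)
  congr 2
  · refine lintegral_congr fun t => ?_
    rw [ENNReal.mul_rpow_of_nonneg _ _ hp0.le, ← ENNReal.rpow_mul, one_div_mul_cancel hp0.ne',
      ENNReal.rpow_one]
  · refine lintegral_congr fun t => ?_
    rw [← ENNReal.rpow_mul, Real.conjExponent]
    congr 1
    field_simp
    ring
  · rw [Real.conjExponent]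
    field_simp

section Hardy

variable {p q : ℝ}

/-- Sufficiency: the weighted inequality for a weight with finite primitive, up to a constant that
comes from the discrete Hardy inequality. -/
lemma lintegral_rpow_mul_le {v w : ℝ → ℝ≥0∞} (hp : 1 < p) (hq : 0 < q) (hqp : q < p) {K : ℝ≥0}
    (hK : ∀ g : ℤ → ℝ≥0∞, ∑' k : ℤ, (2 : ℝ≥0∞) ^ (1 * k : ℝ) * (∑' i : ℕ, g (k + i)) ^ q ≤
      K * ∑' k : ℤ, (2 : ℝ≥0∞) ^ (1 * k : ℝ) * g k ^ q)
    (hv : IsWeight v) (hw : Measurable w) (hpos : ∀ᵐ x ∂mu0, 0 < w x)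
    (hfin : ∀ x, primitive w x < ∞) {h : ℝ → ℝ≥0∞} (hh : Measurable h) :
    ∫⁻ x in Ioi (0 : ℝ), (∫⁻ t in Ioi x, h t) ^ q * w x ≤
      2 * K * ((∫⁻ t in Ioi (0 : ℝ), h t ^ p * v t) ^ (q / p) *
        (2 ^ (p / (p - q)) * ∫⁻ x in Ioi (0 : ℝ), primitive w x ^ (q / (p - q)) * w x *
          (∫⁻ t in Ioi x, v t ^ (1 - p / (p - 1))) ^ (q * (p - 1) / (p - q))) ^ ((p - q) / p)) := by
  have hp0 : 0 < p := by linarith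
  have hp1 : 0 < p - 1 := by linarith
  have hpq : 0 < p - q := by linarith
  set u : ℝ → ℝ≥0∞ := fun t => v t ^ (1 - p / (p - 1)) with hu
  set F : ℤ → ℝ≥0∞ := fun k => ∫⁻ t in level w k, h t ^ p * v t with hF
  set U : ℤ → ℝ≥0∞ := fun k => ∫⁻ t in level w k, u t with hU
  set G : ℤ → ℝ≥0∞ := fun k => ∫⁻ t in level w k, h t with hG
  have hGF : ∀ k, G k ^ q ≤ F k ^ (q / p) * U k ^ (q * (p - 1) / p) := fun k => by
    have h1 := lintegral_le_weighted hp (μ := volume.restrict (level w k)) hv.1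
      (ae_restrict_of_ae_restrict_of_subset (level_subset k) hv.2) hh
    calc G k ^ q ≤ (F k ^ (1 / p) * U k ^ ((p - 1) / p)) ^ q := ENNReal.rpow_le_rpow h1 hq.le
      _ = _ := by
        rw [ENNReal.mul_rpow_of_nonneg _ _ hq.le, ← ENNReal.rpow_mul, ← ENNReal.rpow_mul]
        congr 2 <;> ring
  have hconj : (p / q).HolderConjugate (p / (p - q)) := by
    rw [Real.holderConjugate_iff]
    refine ⟨(one_lt_div hq).2 hqp, ?_⟩
    field_simp
    ring
  have hUI : ∀ k : ℤ, (2 : ℝ≥0∞) ^ (p / (p - q) * k) * U k ^ (q * (p - 1) / (p - q)) ≤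
      2 ^ (p / (p - q)) * ∫⁻ x in level w (k - 1), primitive w x ^ (q / (p - q)) * w x *
          (∫⁻ t in Ioi x, u t) ^ (q * (p - 1) / (p - q)) := fun k => by
    rcases (level w k).eq_empty_or_nonempty with he | hne
    · simp [hU, he, ENNReal.zero_rpow_of_pos (div_pos (mul_pos hq hp1) hpq)]
    · calc (2 : ℝ≥0∞) ^ (p / (p - q) * k) * U k ^ (q * (p - 1) / (p - q))
          = 2 ^ (p / (p - q)) * (((2 : ℝ≥0∞) ^ ((k : ℝ) - 1)) ^ (q / (p - q)) *
              2 ^ ((k : ℝ) - 1) * U k ^ (q * (p - 1) / (p - q))) := by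
            rw [← ENNReal.rpow_mul, ← mul_assoc, ← two_rpow_add, ← two_rpow_add]
            congr 2
            field_simp
            ring
        _ ≤ 2 ^ (p / (p - q)) * (((2 : ℝ≥0∞) ^ ((k : ℝ) - 1)) ^ (q / (p - q)) *
              (∫⁻ x in level w (k - 1), w x) * U k ^ (q * (p - 1) / (p - q))) := by
            gcongr
            exact le_lintegral_level hw hpos hfin hne
        _ = 2 ^ (p / (p - q)) * ∫⁻ x in level w (k - 1),
              ((2 : ℝ≥0∞) ^ ((k : ℝ) - 1)) ^ (q / (p - q)) * w x *
                U k ^ (q * (p - 1) / (p - q)) := by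
            rw [lintegral_mul_const _ (hw.const_mul _), lintegral_const_mul _ hw]
        _ ≤ _ := by
            gcongr 2 ^ (p / (p - q)) * ?_
            refine setLIntegral_mono' (measurableSet_level _) fun x hx => ?_
            have h1 := hx.2.1
            push_cast at h1
            gcongr
            exact lintegral_level_le_Ioi u hx
  calc ∫⁻ x in Ioi (0 : ℝ), (∫⁻ t in Ioi x, h t) ^ q * w x
      = ∑' k, ∫⁻ x in level w k, (∫⁻ t in Ioi x, h t) ^ q * w x :=
        lintegral_Ioi_eq_tsum_level hw hpos hfin _
    _ ≤ ∑' k, ∫⁻ x in level w k, (∑' i : ℕ, G (k + i)) ^ q * w x := by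
        refine ENNReal.tsum_le_tsum fun k =>
          setLIntegral_mono' (measurableSet_level k) fun x hx => ?_
        gcongr
        exact lintegral_Ioi_le_tsum_level hw hpos hfin h hx
    _ ≤ ∑' k : ℤ, (∑' i : ℕ, G (k + i)) ^ q * 2 ^ ((k : ℝ) + 1) := by
        refine ENNReal.tsum_le_tsum fun k => ?_
        rw [lintegral_const_mul _ hw]
        gcongr
        exact lintegral_level_le hw hfin k
    _ = 2 * ∑' k : ℤ, (2 : ℝ≥0∞) ^ (1 * k : ℝ) * (∑' i : ℕ, G (k + i)) ^ q := by
        rw [← ENNReal.tsum_mul_left]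
        refine tsum_congr fun k => ?_
        rw [two_rpow_add, ENNReal.rpow_one, one_mul]
        ring
    _ ≤ 2 * (K * ∑' k : ℤ, (2 : ℝ≥0∞) ^ (1 * k : ℝ) * G k ^ q) := by
        gcongr
        exact hK G
    _ ≤ 2 * (K * ∑' k : ℤ, F k ^ (q / p) *
          ((2 : ℝ≥0∞) ^ (k : ℝ) * U k ^ (q * (p - 1) / p))) := by
        gcongr 2 * (K * ?_)
        refine ENNReal.tsum_le_tsum fun k => ?_
        calc _ ≤ (2 : ℝ≥0∞) ^ (1 * k : ℝ) * (F k ^ (q / p) * U k ^ (q * (p - 1) / p)) := by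
              gcongr
              exact hGF k
          _ = _ := by
              rw [one_mul]
              ring
    _ ≤ 2 * (K * ((∑' k, F k) ^ (q / p) *
          (∑' k : ℤ, (2 : ℝ≥0∞) ^ (p / (p - q) * k) * U k ^ (q * (p - 1) / (p - q))) ^
            ((p - q) / p))) := by
        gcongr 2 * (K * ?_)
        refine (tsum_mul_le_Lp_mul_Lq hconj _ _).trans (le_of_eq ?_)
        rw [one_div_div, one_div_div]
        congr 2
        · refine tsum_congr fun k => ?_
          rw [← ENNReal.rpow_mul, show q / p * (p / q) = 1 by field_simp, ENNReal.rpow_one]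
        · refine tsum_congr fun k => ?_
          rw [ENNReal.mul_rpow_of_nonneg _ _ (div_pos hp0 hpq).le, ← ENNReal.rpow_mul,
            ← ENNReal.rpow_mul]
          congr 2
          · ring
          · field_simp
    _ ≤ _ := by
        rw [lintegral_Ioi_eq_tsum_level hw hpos hfin (fun t => h t ^ p * v t),
          lintegral_Ioi_eq_tsum_level hw hpos hfin (fun x => primitive w x ^ (q / (p - q)) * w x *
            (∫⁻ t in Ioi x, u t) ^ (q * (p - 1) / (p - q))), mul_assoc 2 (K : ℝ≥0∞)]
        gcongr 2 * (K * (_ * ?_))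
        refine ENNReal.rpow_le_rpow ?_ (by positivity)
        rw [← (Equiv.subRight (1 : ℤ)).tsum_eq (fun k => ∫⁻ x in level w k,
            primitive w x ^ (q / (p - q)) * w x *
              (∫⁻ t in Ioi x, u t) ^ (q * (p - 1) / (p - q))), ← ENNReal.tsum_mul_left]
        exact ENNReal.tsum_le_tsum hUI

/-- Necessity: testing the weighted inequality on functions that are multiples of `u` on each
dyadic level set. -/
lemma lintegral_le_of_hardy {v w u : ℝ → ℝ≥0∞} (hp : 1 < p) (hq : 0 < q) (hqp : q < p) {K : ℝ≥0}
    (hK : ∀ g : ℤ → ℝ≥0∞, ∑' k : ℤ, (2 : ℝ≥0∞) ^ (p / (p - q) * k) *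
        (∑' i : ℕ, g (k + i)) ^ (q * (p - 1) / (p - q)) ≤
      K * ∑' k : ℤ, (2 : ℝ≥0∞) ^ (p / (p - q) * k) * g k ^ (q * (p - 1) / (p - q)))
    (hw : Measurable w) (hpos : ∀ᵐ x ∂mu0, 0 < w x)
    (hfin : ∀ x, primitive w x < ∞) (hu : Measurable u) (huint : ∫⁻ t in Ioi (0 : ℝ), u t ≠ ∞)
    (huv : ∀ᵐ t ∂mu0, u t ^ p * v t ≤ u t) {c : ℝ≥0∞}
    (hc : ∀ h : ℝ → ℝ≥0∞, Measurable h →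
      (∫⁻ x in Ioi (0 : ℝ), (∫⁻ t in Ioi x, h t) ^ q * w x) ^ (1 / q) ≤
            c * (∫⁻ t in Ioi (0 : ℝ), h t ^ p * v t) ^ (1 / p)) :
    ∫⁻ x in Ioi (0 : ℝ), primitive w x ^ (q / (p - q)) * w x *
        (∫⁻ t in Ioi x, u t) ^ (q * (p - 1) / (p - q)) ≤ K * (4 * c ^ q) ^ (p / (p - q)) := by
  have hp0 : 0 < p := by linarith
  have hp1 : 0 < p - 1 := by linarith
  have hpq : 0 < p - q := by linarith
  have hβ : 0 < q * (p - 1) / (p - q) := by positivity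
  have hγ : 0 < p / (p - q) := by positivity
  set U : ℤ → ℝ≥0∞ := fun k => ∫⁻ t in level w k, u t with hU
  have hUt : ∀ k, U k ≠ ∞ := fun k =>
    ((lintegral_mono_set (level_subset k)).trans_lt huint.lt_top).ne
  set S : ℤ → ℝ≥0∞ := fun k => (2 : ℝ≥0∞) ^ (p / (p - q) * k) * U k ^ (q * (p - 1) / (p - q))
    with hS
  have hSt : ∀ k, S k ≠ ∞ := fun k =>
    ENNReal.mul_ne_top (two_rpow_ne_top _) (ENNReal.rpow_ne_top_of_nonneg hβ.le (hUt k))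
  have hsum : ∀ s : Finset ℤ, ∑ k ∈ s, S k ≤ (2 * c ^ q) ^ (p / (p - q)) := fun s => by
    classical
    set a : ℤ → ℝ≥0∞ := fun k => if k ∈ s then
      (2 : ℝ≥0∞) ^ (k / (p - q)) * U k ^ ((q * (p - 1) / (p - q) - 1) / p) else 0 with ha
    set h : ℝ → ℝ≥0∞ := fun t => ∑' k, (level w k).indicator (fun t => a k * u t) t with hh
    have hhm : Measurable h := Measurable.tsum fun k =>
      (hu.const_mul _).indicator (measurableSet_level k)
    have hhk : ∀ k, ∀ t ∈ level w k, h t = a k * u t := fun k t ht => by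
      rw [hh]
      simp only
      rw [tsum_eq_single k, indicator_of_mem ht]
      intro j hj
      exact indicator_of_notMem (fun hj' => (pairwise_disjoint_level hj).le_bot ⟨hj', ht⟩) _
    have hX : ∫⁻ t in Ioi (0 : ℝ), h t ^ p * v t ≤ ∑ k ∈ s, S k := by
      have hterm : ∀ k, ∫⁻ t in level w k, h t ^ p * v t ≤ if k ∈ s then S k else 0 := fun k => by
        have h1 : ∫⁻ t in level w k, h t ^ p * v t ≤ a k ^ p * U k := by
          rw [hU, ← lintegral_const_mul _ hu]
          refine lintegral_mono_ae ?_
          filter_upwards [ae_restrict_of_ae_restrict_of_subset (level_subset k) huv,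
            ae_restrict_mem (measurableSet_level k)] with t ht htk
          rw [hhk k t htk, ENNReal.mul_rpow_of_nonneg _ _ hp0.le, mul_assoc]
          gcongr
        refine h1.trans ?_
        split_ifs with hk
        · rcases eq_or_ne (U k) 0 with h0 | h0
          · simp [h0]
          · simp only [ha, hS, if_pos hk]
            rw [ENNReal.mul_rpow_of_nonneg _ _ hp0.le, ← ENNReal.rpow_mul, ← ENNReal.rpow_mul,
              mul_assoc]
            nth_rw 2 [← ENNReal.rpow_one (U k)]
            rw [← ENNReal.rpow_add _ _ h0 (hUt k)]
            refine le_of_eq ?_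
            congr 2 <;> field_simp
            ring
        · simp [ha, hk, ENNReal.zero_rpow_of_pos hp0]
      rw [lintegral_Ioi_eq_tsum_level hw hpos hfin]
      refine (ENNReal.tsum_le_tsum hterm).trans (le_of_eq ?_)
      rw [tsum_eq_sum (s := s) fun k hk => if_neg hk]
      exact Finset.sum_congr rfl fun k hk => if_pos hk
    have hY : (∑ k ∈ s, S k) ≤ 2 * ∫⁻ x in Ioi (0 : ℝ), (∫⁻ t in Ioi x, h t) ^ q * w x := by
      have hterm : ∀ k ∈ s, S k ≤
          ∫⁻ x in level w (k - 1), 2 * ((∫⁻ t in Ioi x, h t) ^ q * w x) := fun k hk => by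
        rcases eq_or_ne (U k) 0 with h0 | h0
        · simp [hS, h0, ENNReal.zero_rpow_of_pos hβ]
        have hne : (level w k).Nonempty := by
          by_contra hne
          simp [hU, not_nonempty_iff_eq_empty.1 hne] at h0
        have haU : a k * U k ≤ ∫⁻ t in level w k, h t := by
          rw [hU, ← lintegral_const_mul _ hu]
          exact setLIntegral_mono' (measurableSet_level k) fun t ht => (hhk k t ht).ge
        calc S k = 2 * (a k * U k) ^ q * 2 ^ ((k : ℝ) - 1) := by
              have haU' : a k * U k = 2 ^ (k / (p - q)) * U k ^ ((p - 1) / (p - q)) := by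
                simp only [ha, if_pos hk]
                nth_rw 2 [← ENNReal.rpow_one (U k)]
                rw [mul_assoc, ← ENNReal.rpow_add _ _ h0 (hUt k)]
                congr 2
                field_simp
                ring
              rw [haU', ENNReal.mul_rpow_of_nonneg _ _ hq.le, ← ENNReal.rpow_mul,
                ← ENNReal.rpow_mul, ← mul_assoc, mul_right_comm]
              nth_rw 1 [← ENNReal.rpow_one 2]
              rw [← two_rpow_add, ← two_rpow_add]
              simp only [hS]
              congr 2 <;> field_simp
              ring
          _ ≤ 2 * (a k * U k) ^ q * ∫⁻ x in level w (k - 1), w x := by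
              gcongr
              exact le_lintegral_level hw hpos hfin hne
          _ = ∫⁻ x in level w (k - 1), 2 * ((a k * U k) ^ q * w x) := by
              rw [← lintegral_const_mul _ hw]
              simp_rw [mul_assoc]
          _ ≤ _ := by
              refine setLIntegral_mono' (measurableSet_level _) fun x hx => ?_
              gcongr
              exact haU.trans (lintegral_level_le_Ioi h hx)
      refine (Finset.sum_le_sum hterm).trans ((ENNReal.sum_le_tsum s).trans (le_of_eq ?_))
      rw [lintegral_Ioi_eq_tsum_level hw hpos hfin, ← (Equiv.subRight (1 : ℤ)).tsum_eq
        (fun k => ∫⁻ x in level w k, (∫⁻ t in Ioi x, h t) ^ q * w x), ← ENNReal.tsum_mul_left]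
      exact tsum_congr fun k => lintegral_const_mul' _ _ (by norm_num)
    set T := ∑ k ∈ s, S k with hT
    have hTt : T ≠ ∞ := ENNReal.sum_ne_top.2 fun k _ => hSt k
    have hTle : T ^ ((p - q) / p) * T ^ (q / p) ≤ 2 * c ^ q * T ^ (q / p) := by
      rw [← ENNReal.rpow_add_of_nonneg _ _ (by positivity) (by positivity),
        show (p - q) / p + q / p = 1 by field_simp; ring, ENNReal.rpow_one]
      refine hY.trans ?_
      rw [mul_assoc]
      gcongr
      have h1 := ENNReal.rpow_le_rpow (hc h hhm) hq.le
      rw [← ENNReal.rpow_mul, one_div_mul_cancel hq.ne', ENNReal.rpow_one,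
        ENNReal.mul_rpow_of_nonneg _ _ hq.le, ← ENNReal.rpow_mul,
        show 1 / p * q = q / p by ring] at h1
      refine h1.trans ?_
      gcongr
    rcases eq_or_ne T 0 with h0 | h0
    · simp [h0]
    · have h2 : T ^ ((p - q) / p) ≤ 2 * c ^ q :=
        (ENNReal.mul_le_mul_iff_left
          (by simp [ENNReal.rpow_eq_zero_iff, h0, hTt])
          (ENNReal.rpow_ne_top_of_nonneg (by positivity) hTt)).1 hTle
      calc T = (T ^ ((p - q) / p)) ^ (p / (p - q)) := by
            rw [← ENNReal.rpow_mul, show (p - q) / p * (p / (p - q)) = 1 by field_simp,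
              ENNReal.rpow_one]
        _ ≤ _ := ENNReal.rpow_le_rpow h2 hγ.le
  calc ∫⁻ x in Ioi (0 : ℝ), primitive w x ^ (q / (p - q)) * w x *
        (∫⁻ t in Ioi x, u t) ^ (q * (p - 1) / (p - q))
      = ∑' k, ∫⁻ x in level w k, primitive w x ^ (q / (p - q)) * w x *
        (∫⁻ t in Ioi x, u t) ^ (q * (p - 1) / (p - q)) :=
        lintegral_Ioi_eq_tsum_level hw hpos hfin _
    _ ≤ ∑' k : ℤ, ∫⁻ x in level w k, ((2 : ℝ≥0∞) ^ ((k : ℝ) + 1)) ^ (q / (p - q)) * w x *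
        (∑' i : ℕ, U (k + i)) ^ (q * (p - 1) / (p - q)) := by
        refine ENNReal.tsum_le_tsum fun k =>
          setLIntegral_mono' (measurableSet_level k) fun x hx => ?_
        have h1 := hx.2.2.le
        gcongr
        exact lintegral_Ioi_le_tsum_level hw hpos hfin u hx
    _ ≤ ∑' k : ℤ, ((2 : ℝ≥0∞) ^ ((k : ℝ) + 1)) ^ (q / (p - q)) * 2 ^ ((k : ℝ) + 1) *
        (∑' i : ℕ, U (k + i)) ^ (q * (p - 1) / (p - q)) := by
        refine ENNReal.tsum_le_tsum fun k => ?_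
        rw [lintegral_mul_const _ (hw.const_mul _), lintegral_const_mul _ hw]
        gcongr
        exact lintegral_level_le hw hfin k
    _ = 2 ^ (p / (p - q)) * ∑' k : ℤ, (2 : ℝ≥0∞) ^ (p / (p - q) * k) *
        (∑' i : ℕ, U (k + i)) ^ (q * (p - 1) / (p - q)) := by
        rw [← ENNReal.tsum_mul_left]
        refine tsum_congr fun k => ?_
        rw [← ENNReal.rpow_mul, ← mul_assoc, ← two_rpow_add, ← two_rpow_add]
        congr 2
        field_simp
        ring
    _ ≤ 2 ^ (p / (p - q)) * (K * ∑' k, S k) := by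
        gcongr
        exact hK U
    _ ≤ 2 ^ (p / (p - q)) * (K * (2 * c ^ q) ^ (p / (p - q))) := by
        gcongr
        rw [ENNReal.tsum_eq_iSup_sum]
        exact iSup_le hsum
    _ = _ := by
        rw [show (4 : ℝ≥0∞) * c ^ q = 2 * (2 * c ^ q) by ring,
          ENNReal.mul_rpow_of_nonneg 2 (2 * c ^ q) hγ.le]
        ring

end Hardy

lemma iSup_rpow {ι : Type*} (f : ι → ℝ≥0∞) {a : ℝ} (ha : 0 < a) : (⨆ i, f i) ^ a = ⨆ i, f i ^ a :=
  (ENNReal.orderIsoRpow a ha).map_iSup f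

lemma iSup_mul_of_monotone {f g : ℕ → ℝ≥0∞} (hf : Monotone f) (hg : Monotone g) :
    (⨆ n, f n) * ⨆ n, g n = ⨆ n, f n * g n := by
  refine le_antisymm ?_ (iSup_le fun n => mul_le_mul' (le_iSup f n) (le_iSup g n))
  rw [ENNReal.iSup_mul]
  refine iSup_le fun i => ?_
  rw [ENNReal.mul_iSup]
  exact iSup_le fun j => (mul_le_mul' (hf (le_max_left i j)) (hg (le_max_right i j))).trans
    (le_iSup (fun n => f n * g n) (max i j))

/-- Truncation of a weight at height `n + 1`. -/
def trunc (w : ℝ → ℝ≥0∞) (n : ℕ) (x : ℝ) : ℝ≥0∞ := min (w x) (n + 1)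

section Trunc

variable {w : ℝ → ℝ≥0∞}

lemma measurable_trunc (hw : Measurable w) (n : ℕ) : Measurable (trunc w n) :=
  hw.min measurable_const

lemma trunc_mono (w : ℝ → ℝ≥0∞) : Monotone (trunc w) := fun m n hmn x => by
  unfold trunc
  gcongr

lemma trunc_le (n : ℕ) (x : ℝ) : trunc w n x ≤ w x := min_le_left _ _

lemma iSup_trunc (x : ℝ) : ⨆ n, trunc w n x = w x := by
  have h : ⨆ n : ℕ, ((n : ℝ≥0∞) + 1) = ∞ := by
    rw [← ENNReal.iSup_add, ENNReal.iSup_natCast, top_add]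
  simp only [trunc]
  rw [← inf_iSup_eq, h, inf_top_eq]

lemma ae_trunc_pos (hpos : ∀ᵐ x ∂mu0, 0 < w x) (n : ℕ) : ∀ᵐ x ∂mu0, 0 < trunc w n x := by
  filter_upwards [hpos] with x hx
  exact lt_min hx (by positivity)

lemma setLIntegral_trunc_lt_top (n : ℕ) {s : Set ℝ} (hs : volume s < ∞) :
    ∫⁻ t in s, trunc w n t < ∞ := by
  refine lt_of_le_of_lt (lintegral_mono fun t => min_le_right _ _) ?_
  rw [setLIntegral_const]
  exact ENNReal.mul_lt_top (by finiteness) hs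

lemma primitive_trunc_lt_top (n : ℕ) (x : ℝ) : primitive (trunc w n) x < ∞ :=
  setLIntegral_trunc_lt_top n (by simp)

lemma setLIntegral_iSup_trunc (hw : Measurable w) (s : Set ℝ) :
    ⨆ n, ∫⁻ t in s, trunc w n t = ∫⁻ t in s, w t := by
  rw [← lintegral_iSup (measurable_trunc hw) (trunc_mono w)]
  exact lintegral_congr iSup_trunc

end Trunc

/-- Truncation of a weight at height `n + 1`, restricted to `(-∞, n)`. -/
def cutoff (u : ℝ → ℝ≥0∞) (n : ℕ) : ℝ → ℝ≥0∞ := (Iio (n : ℝ)).indicator (trunc u n)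

section Cutoff

variable {u : ℝ → ℝ≥0∞}

lemma measurable_cutoff (hu : Measurable u) (n : ℕ) : Measurable (cutoff u n) :=
  (measurable_trunc hu n).indicator measurableSet_Iio

lemma cutoff_mono (u : ℝ → ℝ≥0∞) : Monotone (cutoff u) := fun m n hmn x => by
  refine (indicator_le_indicator (trunc_mono u hmn x)).trans ?_
  exact indicator_le_indicator_of_subset (Iio_subset_Iio (by exact_mod_cast hmn))
    (fun _ => zero_le) x

lemma cutoff_le (n : ℕ) (x : ℝ) : cutoff u n x ≤ u x :=
  (indicator_le_self _ _ x).trans (trunc_le n x)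

lemma iSup_cutoff (x : ℝ) : ⨆ n, cutoff u n x = u x := by
  refine le_antisymm (iSup_le fun n => cutoff_le n x) ?_
  obtain ⟨m, hm⟩ := exists_nat_gt x
  rw [← iSup_trunc (w := u) x]
  refine iSup_le fun n => le_iSup_of_le (max m n) ?_
  have hx : x ∈ Iio ((max m n : ℕ) : ℝ) := hm.trans_le (by exact_mod_cast le_max_left m n)
  rw [cutoff, indicator_of_mem hx]
  exact trunc_mono u (le_max_right m n) x

lemma setLIntegral_cutoff_ne_top (n : ℕ) : ∫⁻ t in Ioi (0 : ℝ), cutoff u n t ≠ ∞ := by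
  unfold cutoff
  rw [setLIntegral_indicator measurableSet_Iio]
  refine (setLIntegral_trunc_lt_top n ?_).ne
  rw [inter_comm, Ioi_inter_Iio]
  simp

lemma setLIntegral_iSup_cutoff (hu : Measurable u) (s : Set ℝ) :
    ⨆ n, ∫⁻ t in s, cutoff u n t = ∫⁻ t in s, u t := by
  rw [← lintegral_iSup (measurable_cutoff hu) (cutoff_mono u)]
  exact lintegral_congr iSup_cutoff

end Cutoff

lemma measurable_lintegral_Ioi (f : ℝ → ℝ≥0∞) : Measurable fun x => ∫⁻ t in Ioi x, f t :=
  Antitone.measurable fun _ _ h => lintegral_mono_set (Ioi_subset_Ioi h)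

lemma iSup_lintegral_trunc_cutoff {u w : ℝ → ℝ≥0∞} {a b : ℝ} (ha : 0 < a) (hb : 0 < b)
    (hw : Measurable w) (hu : Measurable u) :
    ⨆ n, ∫⁻ x in Ioi (0 : ℝ), primitive (trunc w n) x ^ a * trunc w n x *
        (∫⁻ t in Ioi x, cutoff u n t) ^ b =
      ∫⁻ x in Ioi (0 : ℝ), primitive w x ^ a * w x * (∫⁻ t in Ioi x, u t) ^ b := by
  have m1 : ∀ x, Monotone fun n => primitive (trunc w n) x ^ a := fun x m n hmn =>
    ENNReal.rpow_le_rpow (lintegral_mono (trunc_mono w hmn)) ha.le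
  have m2 : ∀ x, Monotone fun n => trunc w n x := fun x m n hmn => trunc_mono w hmn x
  have m3 : ∀ x, Monotone fun n => (∫⁻ t in Ioi x, cutoff u n t) ^ b := fun x m n hmn =>
    ENNReal.rpow_le_rpow (lintegral_mono (cutoff_mono u hmn)) hb.le
  have m12 : ∀ x, Monotone fun n => primitive (trunc w n) x ^ a * trunc w n x :=
    fun x => (m1 x).mul' (m2 x)
  rw [← lintegral_iSup]
  · refine lintegral_congr fun x => ?_
    rw [← iSup_mul_of_monotone (m12 x) (m3 x), ← iSup_mul_of_monotone (m1 x) (m2 x),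
      ← iSup_rpow _ ha, ← iSup_rpow _ hb, iSup_trunc, setLIntegral_iSup_cutoff hu]
    congr 3
    exact setLIntegral_iSup_trunc hw _
  · intro n
    exact ((primitive_mono.measurable.pow_const _).mul (measurable_trunc hw n)).mul
      ((measurable_lintegral_Ioi _).pow_const _)
  · exact fun m n hmn x => (m12 x).mul' (m3 x) hmn

lemma cutoff_rpow_mul_le {p : ℝ} (hp : 1 < p) {v : ℝ → ℝ≥0∞} (n : ℕ) {t : ℝ}
    (ht : 0 < v t ∧ v t < ∞) :
    cutoff (fun t => v t ^ (1 - p / (p - 1))) n t ^ p * v t ≤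
      cutoff (fun t => v t ^ (1 - p / (p - 1))) n t := by
  have hp1 : 0 < p - 1 := by linarith
  set y := cutoff (fun t => v t ^ (1 - p / (p - 1))) n t with hy
  have h1 : y ^ (p - 1) * v t ≤ 1 := by
    calc y ^ (p - 1) * v t ≤ (v t ^ (1 - p / (p - 1))) ^ (p - 1) * v t := by
          gcongr
          exact cutoff_le (u := fun t => v t ^ (1 - p / (p - 1))) n t
      _ = 1 := by
          rw [← ENNReal.rpow_mul, show (1 - p / (p - 1)) * (p - 1) = -1 by field_simp; ring,
            ENNReal.rpow_neg_one, ENNReal.inv_mul_cancel ht.1.ne' ht.2.ne]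
  calc y ^ p * v t = y * (y ^ (p - 1) * v t) := by
        rw [← mul_assoc]
        nth_rw 2 [← ENNReal.rpow_one y]
        rw [← ENNReal.rpow_add_of_nonneg _ _ zero_le_one hp1.le, add_sub_cancel]
    _ ≤ y := mul_le_of_le_one_right' h1

theorem statement9 (p q : ℝ) (hp : 1 < p) (hq : 0 < q) (hqp : q < p) :
    ∃ c₁ c₂ : ℝ≥0, 0 < c₁ ∧ 0 < c₂ ∧
      ∀ v w : ℝ → ℝ≥0∞, IsWeight v → IsWeight w →
        let B : ℝ≥0∞ :=
          (∫⁻ x in Ioi (0 : ℝ),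
              (∫⁻ t in Ioc (0 : ℝ) x, w t) ^ (q / (p - q)) * w x *
                (∫⁻ t in Ioi x, v t ^ (1 - p / (p - 1))) ^ (q * (p - 1) / (p - q))) ^
            ((p - q) / (p * q))
        let C : ℝ≥0∞ := sInf {c : ℝ≥0∞ | ∀ h : ℝ → ℝ≥0∞, Measurable h →
          (∫⁻ x in Ioi (0 : ℝ), (∫⁻ t in Ioi x, h t) ^ q * w x) ^ (1 / q) ≤
            c * (∫⁻ t in Ioi (0 : ℝ), h t ^ p * v t) ^ (1 / p)}
        (c₁ : ℝ≥0∞) * B ≤ C ∧ C ≤ (c₂ : ℝ≥0∞) * B := by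
  have hp0 : 0 < p := by linarith
  have hp1 : 0 < p - 1 := by linarith
  have hpq : 0 < p - q := by linarith
  have hα : 0 < q / (p - q) := by positivity
  have hβ : 0 < q * (p - 1) / (p - q) := by positivity
  have hγ : 0 < p / (p - q) := by positivity
  have he : 0 < (p - q) / (p * q) := by positivity
  obtain ⟨K, hK0, hK⟩ := exists_tsum_two_rpow_mul_rpow_tsum_le zero_lt_one hq
  obtain ⟨L, hL0, hL⟩ := exists_tsum_two_rpow_mul_rpow_tsum_le hγ hβ
  set D : ℝ≥0 := L ^ ((p - q) / (p * q)) * 4 ^ (1 / q) with hD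
  have hD0 : 0 < D := by positivity
  refine ⟨D⁻¹, (4 * K) ^ (1 / q), by positivity, by positivity, fun v w hv hw => ?_⟩
  have hpos : ∀ᵐ x ∂mu0, 0 < w x := hw.2.mono fun x hx => hx.1
  have hu : Measurable fun t => v t ^ (1 - p / (p - 1)) := hv.1.pow_const _
  intro B C
  set I : ℝ≥0∞ := ∫⁻ x in Ioi (0 : ℝ), primitive w x ^ (q / (p - q)) * w x *
    (∫⁻ t in Ioi x, v t ^ (1 - p / (p - 1))) ^ (q * (p - 1) / (p - q)) with hI
  have hB : B = I ^ ((p - q) / (p * q)) := rfl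
  constructor
  · refine le_sInf fun c hc => ?_
    have hIle : I ≤ L * (4 * c ^ q) ^ (p / (p - q)) := by
      rw [hI, ← iSup_lintegral_trunc_cutoff hα hβ hw.1 hu]
      refine iSup_le fun n => lintegral_le_of_hardy hp hq hqp hL (measurable_trunc hw.1 n)
        (ae_trunc_pos hpos n) (primitive_trunc_lt_top n) (measurable_cutoff hu n)
        (setLIntegral_cutoff_ne_top n) (hv.2.mono fun t ht => cutoff_rpow_mul_le hp n ht)
        (c := c) fun h hh => le_trans ?_ (hc h hh)
      gcongr with x
      exact trunc_le n x
    have hBc : B ≤ D * c := by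
      calc B ≤ (L * (4 * c ^ q) ^ (p / (p - q))) ^ ((p - q) / (p * q)) := by
            rw [hB]
            gcongr
        _ = D * c := by
            rw [ENNReal.mul_rpow_of_nonneg _ _ he.le, ← ENNReal.rpow_mul,
              show p / (p - q) * ((p - q) / (p * q)) = 1 / q by field_simp,
              ENNReal.mul_rpow_of_nonneg _ _ (by positivity), ← ENNReal.rpow_mul,
              mul_one_div_cancel hq.ne', ENNReal.rpow_one, hD, ENNReal.coe_mul,
              ENNReal.coe_rpow_of_nonneg _ he.le, ENNReal.coe_rpow_of_nonneg _ (by positivity),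
              mul_assoc]
            norm_cast
    rw [ENNReal.coe_inv hD0.ne']
    exact (ENNReal.mul_le_iff_le_inv (by simp) (by simp [hD0.ne'])).2 (by rwa [inv_inv])
  · refine sInf_le fun h hh => ?_
    set X := ∫⁻ t in Ioi (0 : ℝ), h t ^ p * v t with hX
    have hle : ∫⁻ x in Ioi (0 : ℝ), (∫⁻ t in Ioi x, h t) ^ q * w x ≤
        2 * K * (X ^ (q / p) * (2 ^ (p / (p - q)) * I) ^ ((p - q) / p)) := by
      have hsup : ∫⁻ x in Ioi (0 : ℝ), (∫⁻ t in Ioi x, h t) ^ q * w x =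
          ⨆ n, ∫⁻ x in Ioi (0 : ℝ), (∫⁻ t in Ioi x, h t) ^ q * trunc w n x := by
        rw [← lintegral_iSup]
        · simp_rw [← ENNReal.mul_iSup, iSup_trunc]
        · exact fun n => ((measurable_lintegral_Ioi h).pow_const q).mul (measurable_trunc hw.1 n)
        · intro m n hmn x
          dsimp only
          gcongr
          exact trunc_mono w hmn x
      rw [hsup]
      refine iSup_le fun n => (lintegral_rpow_mul_le hp hq hqp hK hv (measurable_trunc hw.1 n)
        (ae_trunc_pos hpos n) (primitive_trunc_lt_top n) hh).trans ?_
      rw [hI]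
      unfold primitive
      gcongr with x t x <;> first | positivity | exact trunc_le n _
    calc (∫⁻ x in Ioi (0 : ℝ), (∫⁻ t in Ioi x, h t) ^ q * w x) ^ (1 / q)
        ≤ (2 * K * (X ^ (q / p) * (2 ^ (p / (p - q)) * I) ^ ((p - q) / p))) ^ (1 / q) := by
          gcongr
      _ = (4 * K * (X ^ (q / p) * I ^ ((p - q) / p))) ^ (1 / q) := by
          rw [ENNReal.mul_rpow_of_nonneg _ I (by positivity), ← ENNReal.rpow_mul,
            show p / (p - q) * ((p - q) / p) = 1 by field_simp, ENNReal.rpow_one]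
          ring_nf
      _ = _ := by
          rw [ENNReal.mul_rpow_of_nonneg _ _ (by positivity),
            ENNReal.mul_rpow_of_nonneg (X ^ _) _ (by positivity), ← ENNReal.rpow_mul,
            ← ENNReal.rpow_mul, hB, ENNReal.coe_rpow_of_nonneg _ (by positivity), ENNReal.coe_mul,
            show q / p * (1 / q) = 1 / p by field_simp,
            show (p - q) / p * (1 / q) = (p - q) / (p * q) by field_simp]
          push_cast
          ring
end
end
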